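/- arXiv:1502.01202 — 2 statements merged into one kernel-verified Lean document; each statement's English description precedes it below -/
import Mathlib

section
/- Let α ∈ ℝ with |α| ∈ (0,1/2), let f(z) = ((z−1)/(z+1))^α be the holomorphic branch on ℂ∖[−1,1] with f(∞) = 1, and for each n let Q_{n,0}, Q_{n,1}, Q_{n,2} be type I Hermite–Padé polynomials of order n for (1, f, f²). Then every zero of each polynomial Q_{n,k}, k = 0,1,2, lies in ℝ∖[−1,1]; moreover the function ρ_n(z) = Q_{n,1}(z) + 2cos(απ) Q_{n,2}(z) f_0(z), holomorphic on ℂ∖F, has at least 2n+1 zeros, counted with multiplicity, in the open interval (−1,1). -/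
open Polynomial Filter Asymptotics Bornology Topology

namespace HP


/-- positive coefficients and only real zeros -/
def RN (n : ℕ) (c : ℕ → ℝ) : Prop :=
  (∀ i ≤ n, 0 < c i) ∧
    ∀ z : ℂ, ∑ i ∈ Finset.range (n + 1), (c i : ℂ) * z ^ i = 0 → z.im = 0

noncomputable def pol (n : ℕ) (c : ℕ → ℝ) : ℂ[X] :=
  ∑ i ∈ Finset.range (n + 1), C (c i : ℂ) * X ^ i

lemma eval_pol (n : ℕ) (c : ℕ → ℝ) (z : ℂ) :
    (pol n c).eval z = ∑ i ∈ Finset.range (n + 1), (c i : ℂ) * z ^ i := by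
  simp [pol, eval_finsetSum]

lemma coeff_pol (n : ℕ) (c : ℕ → ℝ) (j : ℕ) :
    (pol n c).coeff j = if j ≤ n then (c j : ℂ) else 0 := by
  simp [pol, coeff_C_mul, coeff_X_pow]

lemma natDegree_pol {n : ℕ} {c : ℕ → ℝ} (h : 0 < c n) : (pol n c).natDegree = n := by
  apply natDegree_eq_of_le_of_coeff_ne_zero
  · rw [natDegree_le_iff_coeff_eq_zero]
    intro N hN
    rw [coeff_pol, if_neg (by omega)]
  · rw [coeff_pol, if_pos le_rfl]
    exact_mod_cast h.ne'

lemma lead_pol {n : ℕ} {c : ℕ → ℝ} (h : 0 < c n) : (pol n c).leadingCoeff = c n := by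
  rw [leadingCoeff, natDegree_pol h, coeff_pol, if_pos le_rfl]

lemma RN.root_neg {n : ℕ} {c : ℕ → ℝ} (h : RN n c) {z : ℂ}
    (hz : ∑ i ∈ Finset.range (n + 1), (c i : ℂ) * z ^ i = 0) : z.im = 0 ∧ z.re < 0 := by
  have h1 := h.2 z hz
  refine ⟨h1, ?_⟩
  by_contra hneg
  push Not at hneg
  have hzr : z = (z.re : ℂ) := by apply Complex.ext <;> simp [h1]
  rw [hzr] at hz
  have hz' : ∑ i ∈ Finset.range (n + 1), c i * z.re ^ i = 0 := by exact_mod_cast hz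
  have h0 : 0 < ∑ i ∈ Finset.range (n + 1), c i * z.re ^ i := by
    apply Finset.sum_pos'
    · intro i hi
      have := h.1 i (by simpa [Nat.lt_succ_iff] using hi)
      positivity
    · refine ⟨0, by simp, ?_⟩
      simpa using h.1 0 (Nat.zero_le _)
  linarith

lemma im_pos_aux {z : ℂ} (hz : z.im ≠ 0) {r : ℂ} (hr : r.im = 0 ∧ r.re < 0) :
    0 < z.im * (z * (1 / (z - r))).im := by
  have hne : z - r ≠ 0 := by
    intro h
    have := congrArg Complex.im h
    simp [hr.1] at this
    exact hz this
  have hn : 0 < Complex.normSq (z - r) := Complex.normSq_pos.mpr hne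
  have : (z * (1 / (z - r))).im = (- r.re * z.im) / Complex.normSq (z - r) := by
    rw [mul_one_div, Complex.div_im]
    simp [hr.1]
    field_simp
    ring
  rw [this]
  have : z.im * (-r.re * z.im / Complex.normSq (z - r)) = (-r.re) * z.im ^ 2 / Complex.normSq (z - r) := by ring
  rw [this]
  have h2 : 0 < z.im ^ 2 := by positivity
  have h3 : 0 < - r.re := by linarith [hr.2]
  positivity

lemma im_sum_aux {z : ℂ} (hz : z.im ≠ 0) (s : Multiset ℂ) (hs : ∀ r ∈ s, r.im = 0 ∧ r.re < 0) :
    (s ≠ 0 → 0 < z.im * (z * (s.map fun r => 1 / (z - r)).sum).im) := by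
  induction s using Multiset.induction with
  | empty => simp
  | cons a s ih =>
    intro _
    have ha := im_pos_aux hz (hs a (by simp))
    rw [Multiset.map_cons, Multiset.sum_cons, mul_add, Complex.add_im, mul_add]
    by_cases h0 : s = 0
    · subst h0; simpa using ha
    · have := ih (fun r hr => hs r (by simp [hr])) h0
      linarith

lemma RN.mul_add {n : ℕ} {c : ℕ → ℝ} (h : RN n c) {s : ℝ} (hs : 0 < s) :
    RN n (fun i => (s + i) * c i) := by
  refine ⟨fun i hi => ?_, fun z hz => ?_⟩
  · have := h.1 i hi
    positivity
  by_contra him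
  have hp : (pol n c).eval z ≠ 0 := by
    rw [eval_pol]; intro h0; exact him (h.2 z h0)
  have hder : z * (derivative (pol n c)).eval z + s * (pol n c).eval z = 0 := by
    rw [← hz, eval_pol, pol, derivative_sum, eval_finsetSum, Finset.mul_sum, Finset.mul_sum,
      ← Finset.sum_add_distrib]
    refine Finset.sum_congr rfl fun i _ => ?_
    rcases i with _ | i
    · simp
    · simp
      ring
  have hsp := IsAlgClosed.splits (pol n c)
  have hq := hsp.eval_derivative_div_eval_of_ne_zero hp
  have hn0 : 0 < c n := h.1 n le_rfl
  have hpne : pol n c ≠ 0 := by intro h0; simp [h0] at hp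
  have hq2 : z * ((pol n c).roots.map fun r => 1 / (z - r)).sum = -(s : ℂ) := by
    rw [← hq]
    field_simp
    linear_combination hder
  by_cases hr : (pol n c).roots = 0
  · rw [hr] at hq2
    simp at hq2
    exact hs.ne' hq2
  · have := im_sum_aux him (pol n c).roots (fun r hr => by
      rw [mem_roots hpne, IsRoot.def, eval_pol] at hr
      exact h.root_neg hr) hr
    rw [hq2] at this
    simp at this

lemma RN.scale {n : ℕ} {c : ℕ → ℝ} (h : RN n c) {t u : ℝ} (ht : 0 < t) (hu : 0 < u) :
    RN n (fun i => u * t ^ i * c i) := by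
  refine ⟨fun i hi => ?_, fun z hz => ?_⟩
  · have := h.1 i hi
    positivity
  have : (u : ℂ) * ∑ i ∈ Finset.range (n + 1), (c i : ℂ) * ((t : ℂ) * z) ^ i = 0 := by
    rw [← hz, Finset.mul_sum]
    refine Finset.sum_congr rfl fun i _ => ?_
    push_cast
    ring
  have hu' : (u : ℂ) ≠ 0 := by exact_mod_cast hu.ne'
  have := h.2 _ ((mul_eq_zero.mp this).resolve_left hu')
  simp [ht.ne'] at this
  exact this

lemma RN.congr {n : ℕ} {c d : ℕ → ℝ} (h : RN n c) (hcd : ∀ i ≤ n, d i = c i) : RN n d := by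
  refine ⟨fun i hi => by rw [hcd i hi]; exact h.1 i hi, fun z hz => h.2 z ?_⟩
  rw [← hz]
  refine Finset.sum_congr rfl fun i hi => ?_
  rw [hcd i (by simpa [Nat.lt_succ_iff] using hi)]

lemma RN.reverse {n : ℕ} {c : ℕ → ℝ} (h : RN n c) : RN n (fun i => c (n - i)) := by
  refine ⟨fun i hi => h.1 _ (by omega), fun z hz => ?_⟩
  by_cases hz0 : z = 0
  · simp [hz0]
  have : ∑ i ∈ Finset.range (n + 1), (c i : ℂ) * (z⁻¹) ^ i = 0 := by
    have h2 : z ^ n * ∑ i ∈ Finset.range (n + 1), (c i : ℂ) * (z⁻¹) ^ i = 0 := by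
      rw [← hz, Finset.mul_sum, ← Finset.sum_range_reflect]
      refine Finset.sum_congr rfl fun i hi => ?_
      have hi' : i ≤ n := by simpa [Nat.lt_succ_iff] using hi
      have e1 : n + 1 - 1 - i = n - i := by omega
      rw [e1]
      have e2 : z ^ n = z ^ i * z ^ (n - i) := by rw [← pow_add]; congr 1; omega
      rw [e2, inv_pow]
      field_simp
    exact (mul_eq_zero.mp h2).resolve_left (pow_ne_zero _ hz0)
  have := h.2 _ this
  simp [Complex.inv_im, hz0] at this
  exact this

lemma prod_norm_aux {z : ℂ} (s : Multiset ℂ) (hs : ∀ r ∈ s, r.im = 0) :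
    |z.im| ^ (Multiset.card s) ≤ ‖(s.map fun r => z - r).prod‖ := by
  induction s using Multiset.induction with
  | empty => simp
  | cons a s ih =>
    rw [Multiset.map_cons, Multiset.prod_cons, norm_mul, Multiset.card_cons, pow_succ']
    have ha : |z.im| ≤ ‖z - a‖ := by
      have := Complex.abs_im_le_norm (z - a)
      rwa [Complex.sub_im, hs a (by simp), sub_zero] at this
    have := ih (fun r hr => hs r (by simp [hr]))
    gcongr

lemma RN.lower {n : ℕ} {c : ℕ → ℝ} (h : RN n c) (z : ℂ) :
    c n * |z.im| ^ n ≤ ‖∑ i ∈ Finset.range (n + 1), (c i : ℂ) * z ^ i‖ := by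
  have hn0 : 0 < c n := h.1 n le_rfl
  have hsp := IsAlgClosed.splits (pol n c)
  have hpne : pol n c ≠ 0 := by
    intro h0
    have := lead_pol hn0
    rw [h0] at this
    simp at this
    exact hn0.ne (by exact_mod_cast this)
  rw [← eval_pol, hsp.eval_eq_prod_roots, lead_pol hn0, norm_mul]
  have hc : Multiset.card (pol n c).roots = n := by
    rw [← hsp.natDegree_eq_card_roots, natDegree_pol hn0]
  have h2 := prod_norm_aux (z := z) (pol n c).roots (fun r hr => by
      rw [mem_roots hpne, IsRoot.def, eval_pol] at hr
      exact h.2 r hr)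
  rw [hc] at h2
  have h3 : ‖(c n : ℂ)‖ = c n := by simp [abs_of_pos hn0]
  rw [h3]
  gcongr

lemma RN.limit {n : ℕ} {c : ℕ → ℕ → ℝ} {d : ℕ → ℝ} (h : ∀ᶠ N in atTop, RN n (c N))
    (hd : ∀ i ≤ n, 0 < d i) (hl : ∀ i ≤ n, Tendsto (fun N => c N i) atTop (𝓝 (d i))) :
    RN n d := by
  refine ⟨hd, fun z hz => ?_⟩
  by_contra him
  have t1 : Tendsto (fun N => ‖∑ i ∈ Finset.range (n + 1), (c N i : ℂ) * z ^ i‖) atTop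
      (𝓝 ‖∑ i ∈ Finset.range (n + 1), (d i : ℂ) * z ^ i‖) := by
    apply Tendsto.norm
    apply tendsto_finsetSum
    intro i hi
    have hi' : i ≤ n := by simpa [Nat.lt_succ_iff] using hi
    exact ((Complex.continuous_ofReal.tendsto _).comp (hl i hi')).mul_const _
  have t2 : Tendsto (fun N => c N n * |z.im| ^ n) atTop (𝓝 (d n * |z.im| ^ n)) :=
    (hl n le_rfl).mul_const _
  have := le_of_tendsto_of_tendsto t2 t1 (h.mono fun N hN => hN.lower z)
  rw [hz, norm_zero] at this
  have h1 := hd n le_rfl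
  have h2 : 0 < |z.im| := abs_pos.mpr him
  have : 0 < d n * |z.im| ^ n := by positivity
  linarith

lemma RN.prod {n : ℕ} {c : ℕ → ℝ} (h : RN n c) {s : ℝ} (hs : 0 < s) (N : ℕ) :
    RN n (fun i => (∏ j ∈ Finset.range N, (s + i + j)) * c i) := by
  induction N with
  | zero => simpa using h
  | succ N ih =>
    refine (ih.mul_add (s := s + N) (by positivity)).congr fun i _ => ?_
    rw [Finset.prod_range_succ]
    ring

lemma RN.gamma {n : ℕ} {c : ℕ → ℝ} (h : RN n c) {s : ℝ} (hs : 0 < s) :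
    RN n (fun i => c i / Real.Gamma (i + s)) := by
  refine RN.limit (c := fun N i => c i / Real.GammaSeq (i + s) N) ?_ ?_ ?_
  · filter_upwards [eventually_gt_atTop 0] with N hN
    have hN' : (0 : ℝ) < N := by exact_mod_cast hN
    refine ((h.prod hs (N + 1)).scale (t := (N : ℝ)⁻¹)
      (u := ((N : ℝ) ^ s * (N.factorial : ℝ))⁻¹) (by positivity) (by positivity)).congr fun i _ => ?_
    have h1 : (N : ℝ) ^ ((i : ℝ) + s) = (N : ℝ) ^ i * (N : ℝ) ^ s := by
      rw [Real.rpow_add hN', Real.rpow_natCast]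
    have h2 : ∏ j ∈ Finset.range (N + 1), ((i : ℝ) + s + j) = ∏ j ∈ Finset.range (N + 1), (s + i + j) :=
      Finset.prod_congr rfl fun j _ => by ring
    have h3 : 0 < ∏ j ∈ Finset.range (N + 1), (s + (i : ℝ) + j) :=
      Finset.prod_pos fun j _ => by positivity
    rw [Real.GammaSeq, h1, h2, inv_pow]
    field_simp
  · intro i hi
    have := h.1 i hi
    have : 0 < Real.Gamma (i + s) := Real.Gamma_pos_of_pos (by positivity)
    have := h.1 i hi
    positivity
  · intro i hi
    exact tendsto_const_nhds.div (Real.GammaSeq_tendsto_Gamma _)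
      (Real.Gamma_pos_of_pos (by positivity)).ne'

lemma RN.gamma' {n : ℕ} {c : ℕ → ℝ} (h : RN n c) {s : ℝ} (hs : 0 < s) :
    RN n (fun i => c i / Real.Gamma ((n - i : ℕ) + s)) := by
  refine (h.reverse.gamma hs).reverse.congr fun i hi => ?_
  have : n - (n - i) = i := by omega
  simp only [this]

lemma RN.choose (n : ℕ) : RN n (fun i => (n.choose i : ℝ)) := by
  refine ⟨fun i hi => Nat.cast_pos.mpr (Nat.choose_pos hi), fun z hz => ?_⟩
  have : (z + 1) ^ n = 0 := by
    rw [← hz, add_pow]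
    refine Finset.sum_congr rfl fun i _ => ?_
    push_cast
    ring
  have h1 : z + 1 = 0 := by
    by_contra hne
    exact pow_ne_zero n hne this
  have h2 : z = -1 := by linear_combination h1
  simp [h2]



lemma prod_gamma {β : ℝ} (hβ : -1 < β) (m : ℕ) :
    ∏ j ∈ Finset.range m, ((j : ℝ) + 1 + β) = Real.Gamma (m + (1 + β)) / Real.Gamma (1 + β) := by
  have h0 : 0 < Real.Gamma (1 + β) := Real.Gamma_pos_of_pos (by linarith)
  induction m with
  | zero => simp [h0.ne']
  | succ m ih =>
    rw [Finset.prod_range_succ, ih]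
    have e : ((m + 1 : ℕ) : ℝ) + (1 + β) = (m + (1 + β)) + 1 := by push_cast; ring
    have hpos : (0 : ℝ) < m + (1 + β) := by
      have : (0 : ℝ) ≤ m := by positivity
      linarith
    rw [e, Real.Gamma_add_one hpos.ne']
    ring

lemma E_formula {β : ℝ} (hβ : -1 < β) (hβ' : β < 1) (i m : ℕ) :
    ∏ l ∈ Finset.range (i + m + 1), ((i : ℝ) - l + β) =
      β * (-1) ^ m * (Real.Gamma (i + (1 + β)) / Real.Gamma (1 + β)) *
        (Real.Gamma (m + (1 - β)) / Real.Gamma (1 - β)) := by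
  have e : i + m + 1 = (i + 1) + m := by ring
  rw [e, Finset.prod_range_add, ← prod_gamma hβ, ← Finset.prod_range_reflect]
  rw [Finset.prod_range_succ']
  have h1 : (1 : ℝ) - β = 1 + (-β) := by ring
  have h2 : ∏ k ∈ Finset.range m, ((i : ℝ) - ((i + 1 + k : ℕ) : ℝ) + β) =
      (-1) ^ m * (Real.Gamma (m + (1 - β)) / Real.Gamma (1 - β)) := by
    rw [h1, ← prod_gamma (by linarith)]
    have : ((-1 : ℝ)) ^ m = ∏ j ∈ Finset.range m, (-1 : ℝ) := by simp
    rw [this, ← Finset.prod_mul_distrib]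
    refine Finset.prod_congr rfl fun k _ => ?_
    push_cast
    ring
  rw [h2]
  have h3 : ∀ k ∈ Finset.range i, ((i : ℝ) - ((i + 1 - 1 - (k + 1) : ℕ) : ℝ) + β) = (k : ℝ) + 1 + β := by
    intro k hk
    have : k < i := by simpa using hk
    have e : i + 1 - 1 - (k + 1) = i - (k + 1) := by omega
    rw [e, Nat.cast_sub (by omega)]
    push_cast
    ring
  rw [Finset.prod_congr rfl h3]
  simp
  ring

lemma F_formula (i m : ℕ) :
    ∏ l ∈ Finset.range (i + m + 1), (if l = i then (1 : ℝ) else ((i : ℝ) - l)) =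
      (-1) ^ m * (i.factorial : ℝ) * (m.factorial : ℝ) := by
  have e : i + m + 1 = (i + 1) + m := by ring
  rw [e, Finset.prod_range_add, Finset.prod_range_succ, if_pos rfl]
  have h1 : ∏ x ∈ Finset.range i, (if x = i then (1 : ℝ) else ((i : ℝ) - x)) = i.factorial := by
    rw [← Finset.prod_range_add_one_eq_factorial, ← Finset.prod_range_reflect]
    push_cast
    refine Finset.prod_congr rfl fun k hk => ?_
    have hk : k < i := by simpa using hk
    rw [if_neg (by omega)]
    rw [show i - 1 - k = i - (k + 1) by omega, Nat.cast_sub (by omega)]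
    push_cast
    ring
  have h2 : ∏ k ∈ Finset.range m, (if i + 1 + k = i then (1 : ℝ) else ((i : ℝ) - ((i + 1 + k : ℕ) : ℝ))) =
      (-1) ^ m * m.factorial := by
    rw [← Finset.prod_range_add_one_eq_factorial]
    have : ((-1 : ℝ)) ^ m = ∏ j ∈ Finset.range m, (-1 : ℝ) := by simp
    push_cast
    rw [this, ← Finset.prod_mul_distrib]
    refine Finset.prod_congr rfl fun k hk => ?_
    rw [if_neg (by omega)]
    ring
  rw [h1, h2]
  ring

noncomputable def cc (n : ℕ) (β₁ β₂ : ℝ) (i : ℕ) : ℝ :=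
  (n.choose i : ℝ) / Real.Gamma (i + (1 + β₁)) / Real.Gamma ((n - i : ℕ) + (1 - β₁))
    / Real.Gamma (i + (1 + β₂)) / Real.Gamma ((n - i : ℕ) + (1 - β₂))

lemma cc_formula (n : ℕ) {β₁ β₂ : ℝ} (h1 : |β₁| < 1) (h2 : |β₂| < 1) (h1' : β₁ ≠ 0) (h2' : β₂ ≠ 0) :
    ∃ κ : ℝ, κ ≠ 0 ∧ ∀ i ≤ n, (-1 : ℝ) ^ i = κ * cc n β₁ β₂ i *
      ((∏ l ∈ Finset.range (n + 1), (if l = i then (1 : ℝ) else ((i : ℝ) - l))) *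
      (∏ l ∈ Finset.range (n + 1), ((i : ℝ) - l + β₁)) *
      (∏ l ∈ Finset.range (n + 1), ((i : ℝ) - l + β₂))) := by
  rw [abs_lt] at h1 h2
  have g1 : 0 < Real.Gamma (1 + β₁) := Real.Gamma_pos_of_pos (by linarith)
  have g2 : 0 < Real.Gamma (1 - β₁) := Real.Gamma_pos_of_pos (by linarith)
  have g3 : 0 < Real.Gamma (1 + β₂) := Real.Gamma_pos_of_pos (by linarith)
  have g4 : 0 < Real.Gamma (1 - β₂) := Real.Gamma_pos_of_pos (by linarith)
  refine ⟨(-1) ^ n * (Real.Gamma (1 + β₁) * Real.Gamma (1 - β₁) * Real.Gamma (1 + β₂) *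
    Real.Gamma (1 - β₂)) / ((n.factorial : ℝ) * β₁ * β₂), ?_, ?_⟩
  · have : (n.factorial : ℝ) ≠ 0 := by exact_mod_cast n.factorial_ne_zero
    have := g1.ne'
    have := g2.ne'
    have := g3.ne'
    have := g4.ne'
    have : (-1 : ℝ) ^ n ≠ 0 := pow_ne_zero _ (by norm_num)
    positivity
  · intro i hi
    obtain ⟨m, rfl⟩ := Nat.exists_eq_add_of_le hi
    rw [F_formula, E_formula h1.1 h1.2, E_formula h2.1 h2.2, cc]
    have hm : i + m - i = m := by omega
    rw [hm]
    have hi0 : (0 : ℝ) ≤ i := by positivity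
    have hm0 : (0 : ℝ) ≤ m := by positivity
    have k1 : 0 < Real.Gamma (i + (1 + β₁)) := Real.Gamma_pos_of_pos (by linarith)
    have k2 : 0 < Real.Gamma (m + (1 - β₁)) := Real.Gamma_pos_of_pos (by linarith)
    have k3 : 0 < Real.Gamma (i + (1 + β₂)) := Real.Gamma_pos_of_pos (by linarith)
    have k4 : 0 < Real.Gamma (m + (1 - β₂)) := Real.Gamma_pos_of_pos (by linarith)
    have hc : ((i + m).choose i : ℝ) * i.factorial * m.factorial = (i + m).factorial := by
      have := Nat.choose_mul_factorial_mul_factorial (Nat.le_add_right i m)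
      rw [hm] at this
      exact_mod_cast this
    have hf : ((i + m).factorial : ℝ) ≠ 0 := by exact_mod_cast (i + m).factorial_ne_zero
    have hs : ((-1 : ℝ) ^ m) * (-1) ^ m = 1 := by rw [← mul_pow]; simp
    rw [← hc] at hf ⊢
    generalize Real.Gamma (i + (1 + β₁)) = A1 at *
    generalize Real.Gamma (i + (1 + β₂)) = A2 at *
    generalize Real.Gamma (m + (1 - β₁)) = A3 at *
    generalize Real.Gamma (m + (1 - β₂)) = A4 at *
    generalize Real.Gamma (1 + β₁) = B1 at *
    generalize Real.Gamma (1 + β₂) = B2 at *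
    generalize Real.Gamma (1 - β₁) = B3 at *
    generalize Real.Gamma (1 - β₂) = B4 at *
    generalize ((i + m).choose i : ℝ) = T1 at *
    generalize (i.factorial : ℝ) = T2 at *
    generalize (m.factorial : ℝ) = T3 at *
    have hT1 : T1 ≠ 0 := by rintro rfl; simp at hf
    have hT2 : T2 ≠ 0 := by rintro rfl; simp at hf
    have hT3 : T3 ≠ 0 := by rintro rfl; simp at hf
    rw [pow_add]
    generalize (-1 : ℝ) ^ m = e at *
    field_simp
    linear_combination (- (e ^ 2 + 1)) * hs

lemma mom_poly {ι : Type*} (I : Finset ι) (a s : ι → ℝ) (N : ℕ)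
    (h : ∀ m < N, ∑ p ∈ I, a p * s p ^ m = 0) (P : ℝ[X]) (hP : P.natDegree < N) :
    ∑ p ∈ I, a p * P.eval (s p) = 0 := by
  have : ∀ p ∈ I, a p * P.eval (s p) = ∑ m ∈ Finset.range N, P.coeff m * (a p * s p ^ m) := by
    intro p _
    rw [eval_eq_sum_range' hP, Finset.mul_sum]
    refine Finset.sum_congr rfl fun m _ => by ring
  rw [Finset.sum_congr rfl this, Finset.sum_comm]
  refine Finset.sum_eq_zero fun m hm => ?_
  rw [← Finset.mul_sum, h m (by simpa using hm), mul_zero]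

lemma ratio {ι : Type*} [DecidableEq ι] (I : Finset ι) (a s : ι → ℝ) (N : ℕ) (hN : I.card ≤ N + 1)
    (h : ∀ m < N, ∑ p ∈ I, a p * s p ^ m = 0)
    (p q : ι) (hp : p ∈ I) (hq : q ∈ I) :
    a p * ∏ r ∈ I.erase p, (s p - s r) = a q * ∏ r ∈ I.erase q, (s q - s r) := by
  by_cases hpq : p = q
  · rw [hpq]
  set J := (I.erase p).erase q with hJ
  have hqI : q ∈ I.erase p := by simp [hq, Ne.symm hpq]
  have hJ' : J = (I.erase q).erase p := Finset.erase_right_comm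
  have hpI : p ∈ I.erase q := by simp [hp, hpq]
  have key := mom_poly I a s N h (∏ r ∈ J, (X - C (s r))) (by
    rw [natDegree_prod_of_monic _ _ (fun r _ => monic_X_sub_C _)]
    simp
    have h1 := Finset.card_erase_of_mem hqI
    have h2 := Finset.card_erase_of_mem hp
    rw [← hJ] at h1
    have h3 := Finset.card_pos.mpr ⟨q, hqI⟩
    omega)
  simp only [eval_prod, eval_sub, eval_X, eval_C] at key
  rw [← Finset.add_sum_erase I _ hp, ← Finset.add_sum_erase (I.erase p) _ hqI,
    Finset.sum_eq_zero (s := (I.erase p).erase q) (fun r hr => by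
      rw [Finset.prod_eq_zero (i := r) hr (by simp), mul_zero])] at key
  rw [← Finset.mul_prod_erase (I.erase p) _ hqI, ← Finset.mul_prod_erase (I.erase q) _ hpI, ← hJ, ← hJ']
  linear_combination (s p - s q) * key



def II (n : ℕ) : Finset (Fin 3 × ℕ) := Finset.univ ×ˢ Finset.range (n + 1)

noncomputable def ss (α : ℝ) (p : Fin 3 × ℕ) : ℝ := p.2 + (p.1 : ℕ) * α

lemma mem_II {n : ℕ} {p : Fin 3 × ℕ} : p ∈ II n ↔ p.2 ≤ n := by
  simp [II]

lemma ss_inj {α : ℝ} (hα0 : 0 < |α|) (hα2 : |α| < 1 / 2) (p q : Fin 3 × ℕ) (h : ss α p = ss α q) :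
    p = q := by
  have h0 : α ≠ 0 := abs_pos.mp hα0
  rw [abs_lt] at hα2
  obtain ⟨k, i⟩ := p
  obtain ⟨l, j⟩ := q
  simp only [ss] at h
  have hk : ((k : ℕ) : ℝ) - ((l : ℕ) : ℝ) = ((k : ℕ) - (l : ℕ) : ℤ) := by push_cast; ring
  have hi : (j : ℝ) - (i : ℝ) = ((j : ℕ) - (i : ℕ) : ℤ) := by push_cast; ring
  have e : (((k : ℕ) - (l : ℕ) : ℤ) : ℝ) * α = ((j : ℕ) - (i : ℕ) : ℤ) := by
    rw [← hk, ← hi]; linarith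
  have hk1 : (-2 : ℤ) ≤ ((k : ℕ) - (l : ℕ) : ℤ) := by omega
  have hk2 : ((k : ℕ) - (l : ℕ) : ℤ) ≤ 2 := by omega
  generalize hd : ((k : ℕ) - (l : ℕ) : ℤ) = d at *
  generalize hd' : ((j : ℕ) - (i : ℕ) : ℤ) = d' at *
  have b1 : ((d' : ℤ) : ℝ) < 1 := by
    rw [← e]
    interval_cases d <;> push_cast <;> linarith
  have b2 : (-1 : ℝ) < ((d' : ℤ) : ℝ) := by
    rw [← e]
    interval_cases d <;> push_cast <;> linarith
  have b3 : d' < 1 := by exact_mod_cast b1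
  have b4 : -1 < d' := by exact_mod_cast b2
  have b5 : d' = 0 := by omega
  rw [b5] at e
  have : d = 0 := by
    have := (mul_eq_zero.mp (e.trans (by simp))).resolve_right h0
    exact_mod_cast this
  ext
  · simp only; omega
  · simp only; omega

lemma D_formula (n : ℕ) (α : ℝ) (k : Fin 3) (i : ℕ) (hi : i ≤ n) :
    ∏ r ∈ (II n).erase (k, i), (ss α (k, i) - ss α r) =
      ∏ l : Fin 3, if l = k then (∏ j ∈ Finset.range (n + 1), (if j = i then (1 : ℝ) else ((i : ℝ) - j)))
        else ∏ j ∈ Finset.range (n + 1), ((i : ℝ) - j + (((k : ℕ) : ℝ) - ((l : ℕ) : ℝ)) * α) := by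
  have h1 : ∏ r ∈ (II n).erase (k, i), (ss α (k, i) - ss α r) =
      ∏ r ∈ II n, if r = (k, i) then 1 else (ss α (k, i) - ss α r) := by
    rw [← Finset.mul_prod_erase (II n) _ (mem_II.mpr hi : (k, i) ∈ II n)]
    rw [if_pos rfl, one_mul]
    refine Finset.prod_congr rfl fun r hr => ?_
    rw [if_neg (Finset.ne_of_mem_erase hr)]
  rw [h1, II, Finset.prod_product]
  refine Finset.prod_congr rfl fun l _ => ?_
  split_ifs with hl
  · subst hl
    refine Finset.prod_congr rfl fun j _ => ?_
    simp [ss]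
  · refine Finset.prod_congr rfl fun j _ => ?_
    rw [if_neg (by simp [hl])]
    simp only [ss]
    ring

lemma RN_cc (n : ℕ) {β₁ β₂ : ℝ} (h1 : |β₁| < 1) (h2 : |β₂| < 1) : RN n (cc n β₁ β₂) := by
  rw [abs_lt] at h1 h2
  exact ((((RN.choose n).gamma (s := 1 + β₁) (by linarith)).gamma' (s := 1 - β₁) (by linarith)).gamma
    (s := 1 + β₂) (by linarith)).gamma' (s := 1 - β₂) (by linarith)

lemma coef_RN (n : ℕ) {α : ℝ} (hα0 : 0 < |α|) (hα2 : |α| < 1 / 2) (a : Fin 3 × ℕ → ℝ)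
    (hne : ∃ p ∈ II n, a p ≠ 0)
    (h : ∀ m < 3 * n + 2, ∑ p ∈ II n, a p * ss α p ^ m = 0) (k : Fin 3) :
    ∃ κ : ℝ, κ ≠ 0 ∧ ∃ c : ℕ → ℝ, RN n c ∧ ∀ i ≤ n, (-1) ^ i * a (k, i) = κ * c i := by
  have hinj : ∀ p ∈ II n, ∀ q ∈ II n, p ≠ q → ss α p ≠ ss α q :=
    fun p _ q _ hpq he => hpq (ss_inj hα0 hα2 p q he)
  have hr := ratio (II n) a (ss α) (3 * n + 2) (by simp [II]; omega) h
  obtain ⟨p0, hp0, hap0⟩ := hne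
  set K := a p0 * ∏ r ∈ (II n).erase p0, (ss α p0 - ss α r) with hK
  have hK0 : K ≠ 0 := by
    refine mul_ne_zero hap0 (Finset.prod_ne_zero_iff.mpr fun r hr => ?_)
    rw [sub_ne_zero]
    exact hinj _ hp0 _ (Finset.mem_of_mem_erase hr) (Finset.ne_of_mem_erase hr).symm
  have h0 : α ≠ 0 := abs_pos.mp hα0
  have main : ∀ β₁ β₂ : ℝ, |β₁| < 1 → |β₂| < 1 → β₁ ≠ 0 → β₂ ≠ 0 →
      (∀ i ≤ n, ∏ r ∈ (II n).erase (k, i), (ss α (k, i) - ss α r) =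
        ((∏ l ∈ Finset.range (n + 1), (if l = i then (1 : ℝ) else ((i : ℝ) - l))) *
      (∏ l ∈ Finset.range (n + 1), ((i : ℝ) - l + β₁)) *
      (∏ l ∈ Finset.range (n + 1), ((i : ℝ) - l + β₂)))) →
      ∃ κ : ℝ, κ ≠ 0 ∧ ∃ c : ℕ → ℝ, RN n c ∧ ∀ i ≤ n, (-1) ^ i * a (k, i) = κ * c i := by
    intro β₁ β₂ h1 h2 h1' h2' hD
    obtain ⟨κ, hκ, hf⟩ := cc_formula n h1 h2 h1' h2'
    refine ⟨κ * K, mul_ne_zero hκ hK0, cc n β₁ β₂, RN_cc n h1 h2, fun i hi => ?_⟩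
    have e1 := hr (k, i) p0 (mem_II.mpr hi) hp0
    rw [hD i hi, ← hK] at e1
    rw [hf i hi, ← e1]
    ring
  have hα := abs_lt.mp hα2
  fin_cases k
  · refine main (-α) (-2 * α) (by rw [abs_lt]; constructor <;> linarith)
      (by rw [abs_lt]; constructor <;> linarith) (by simpa using h0) (by simpa using h0) fun i hi => ?_
    rw [D_formula n α _ i hi]
    simp [Fin.prod_univ_three]
  · refine main α (-α) (by rw [abs_lt]; constructor <;> linarith)
      (by rw [abs_lt]; constructor <;> linarith) (by simpa using h0) (by simpa using h0) fun i hi => ?_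
    rw [D_formula n α _ i hi]
    simp [Fin.prod_univ_three]
    rw [show ((1 : ℝ) - 2) * α = -α by ring]
    congr 1
    exact mul_comm _ _
  · refine main (2 * α) α (by rw [abs_lt]; constructor <;> linarith)
      (by rw [abs_lt]; constructor <;> linarith) (by simpa using h0) (by simpa using h0) fun i hi => ?_
    rw [D_formula n α _ i hi]
    simp [Fin.prod_univ_three]
    norm_num
    ring

lemma zero_loc (n : ℕ) (a : ℕ → ℝ) {κ : ℝ} (hκ : κ ≠ 0) {c : ℕ → ℝ} (hc : RN n c)
    (h : ∀ i ≤ n, (-1) ^ i * a i = κ * c i) (z : ℂ)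
    (hz : ∑ i ∈ Finset.range (n + 1), (a i : ℂ) * (z - 1) ^ i * (z + 1) ^ (n - i) = 0) :
    z.im = 0 ∧ 1 < |z.re| := by
  have ha : ∀ i ≤ n, a i = κ * (-1) ^ i * c i := by
    intro i hi
    have hs : ((-1 : ℝ) ^ i) * (-1) ^ i = 1 := by rw [← mul_pow]; simp
    have := h i hi
    linear_combination (-1) ^ i * this - a i * hs
  by_cases hz1 : z + 1 = 0
  · exfalso
    rw [Finset.sum_range_succ, Finset.sum_eq_zero (fun i hi => by
      have : i < n := by simpa using hi
      rw [hz1, zero_pow (by omega), mul_zero])] at hz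
    have hz2 : z - 1 = -2 := by linear_combination hz1
    rw [hz2] at hz
    simp at hz
    have h1 := ha n le_rfl
    rw [hz] at h1
    have := hc.1 n le_rfl
    have h3 : κ * (-1) ^ n * c n ≠ 0 := by
      have : (-1 : ℝ) ^ n ≠ 0 := pow_ne_zero _ (by norm_num)
      positivity
    exact h3 h1.symm
  set y : ℂ := (1 - z) / (1 + z) with hy
  have hz1' : 1 + z ≠ 0 := by rwa [add_comm]
  have hB : ∑ i ∈ Finset.range (n + 1), (c i : ℂ) * y ^ i = 0 := by
    have : (κ : ℂ) * (1 + z) ^ n * ∑ i ∈ Finset.range (n + 1), (c i : ℂ) * y ^ i = 0 := by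
      rw [← hz, Finset.mul_sum]
      refine Finset.sum_congr rfl fun i hi => ?_
      have hi' : i ≤ n := by simpa [Nat.lt_succ_iff] using hi
      rw [ha i hi', hy, div_pow]
      have e2 : (1 + z) ^ n = (1 + z) ^ i * (1 + z) ^ (n - i) := by rw [← pow_add]; congr 1; omega
      have e3 : (z - 1) ^ i = (-1) ^ i * (1 - z) ^ i := by rw [← mul_pow]; congr 1; ring
      have hs : ((-1 : ℂ) ^ i) * (-1) ^ i = 1 := by rw [← mul_pow]; simp
      rw [e2, e3, add_comm z 1]
      push_cast
      field_simp
      linear_combination (-(κ * c i * (1 - z) ^ i : ℂ)) * hs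
    have hκ' : (κ : ℂ) ≠ 0 := by exact_mod_cast hκ
    exact (mul_eq_zero.mp this).resolve_left (mul_ne_zero hκ' (pow_ne_zero _ hz1'))
  obtain ⟨hy1, hy2⟩ := hc.root_neg hB
  have hyr : y = (y.re : ℂ) := by apply Complex.ext <;> simp [hy1]
  set t := y.re with ht
  have e1 : (t : ℂ) * (1 + z) = 1 - z := by
    rw [← hyr, hy]; field_simp
  have ere := congrArg Complex.re e1
  have eim := congrArg Complex.im e1
  simp at ere eim
  have ht1 : 1 + t ≠ 0 := by
    intro h0
    have : t = -1 := by linarith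
    rw [this] at ere
    linarith
  have him : z.im = 0 := by
    have : (1 + t) * z.im = 0 := by linarith
    exact (mul_eq_zero.mp this).resolve_left ht1
  refine ⟨him, ?_⟩
  have hre : z.re * (1 + t) = 1 - t := by linarith
  by_contra hle
  push Not at hle
  rw [abs_le] at hle
  rcases lt_or_gt_of_ne ht1 with h1 | h1
  · nlinarith
  · nlinarith



lemma repr_basis (n : ℕ) : ∀ Q : ℝ[X], Q.natDegree ≤ n → ∃ a : ℕ → ℝ, ∀ z : ℂ,
    aeval z Q = ∑ i ∈ Finset.range (n + 1), (a i : ℂ) * (z - 1) ^ i * (z + 1) ^ (n - i) := by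
  induction n with
  | zero =>
    intro Q hQ
    rw [Nat.le_zero, natDegree_eq_zero] at hQ
    obtain ⟨c, rfl⟩ := hQ
    exact ⟨fun _ => c, fun z => by simp⟩
  | succ n ih =>
    intro Q hQ
    set c : ℝ := Q.eval 1 / 2 ^ (n + 1) with hc
    set P : ℝ[X] := Q - C c * (X + C 1) ^ (n + 1) with hP
    have hroot : P.IsRoot 1 := by
      simp [hP, IsRoot.def, hc]
      norm_num
    have hfac : (X - C 1) * (P /ₘ (X - C 1)) = P := mul_divByMonic_eq_iff_isRoot.mpr hroot
    have hdegP : P.natDegree ≤ n + 1 := by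
      refine (natDegree_sub_le _ _).trans (max_le hQ ?_)
      refine (natDegree_C_mul_le _ _).trans ?_
      refine natDegree_pow_le.trans ?_
      rw [natDegree_X_add_C]
      omega
    have hdeg : (P /ₘ (X - C 1)).natDegree ≤ n := by
      rw [natDegree_divByMonic _ (monic_X_sub_C _), natDegree_X_sub_C]
      omega
    obtain ⟨b, hb⟩ := ih _ hdeg
    refine ⟨fun i => if i = 0 then c else b (i - 1), fun z => ?_⟩
    have hQe : Q = (X - C 1) * (P /ₘ (X - C 1)) + C c * (X + C 1) ^ (n + 1) := by
      rw [hfac, hP]; ring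
    rw [hQe, Finset.sum_range_succ']
    simp only [map_add, map_mul, map_sub, map_pow, aeval_X, aeval_C, hb]
    simp [Finset.mul_sum]
    refine Finset.sum_congr rfl fun i _ => ?_
    ring

lemma poly_zero (N : ℕ) : ∀ M : ℕ → ℝ,
    ((fun τ : ℝ => ∑ m ∈ Finset.range N, M m * τ ^ m) =O[𝓝[<] 0] fun τ => τ ^ N) →
    ∀ m < N, M m = 0 := by
  induction N with
  | zero => intro M _ m hm; omega
  | succ N ih =>
    intro M h
    have hcont : Tendsto (fun τ : ℝ => ∑ m ∈ Finset.range (N + 1), M m * τ ^ m) (𝓝[<] 0) (𝓝 (M 0)) := by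
      have : Continuous (fun τ : ℝ => ∑ m ∈ Finset.range (N + 1), M m * τ ^ m) := by fun_prop
      have h2 := this.tendsto 0
      have e : ∑ m ∈ Finset.range (N + 1), M m * (0 : ℝ) ^ m = M 0 := by
        rw [Finset.sum_range_succ']; simp
      rw [e] at h2
      exact h2.mono_left nhdsWithin_le_nhds
    have hz : Tendsto (fun τ : ℝ => τ ^ (N + 1)) (𝓝[<] 0) (𝓝 0) := by
      have : Continuous (fun τ : ℝ => τ ^ (N + 1)) := by fun_prop
      have h2 := this.tendsto 0
      simp only [zero_pow (Nat.succ_ne_zero N)] at h2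
      exact h2.mono_left nhdsWithin_le_nhds
    have h0 : M 0 = 0 := tendsto_nhds_unique hcont (h.trans_tendsto hz)
    have h3 := ih (fun m => M (m + 1)) (by
      refine (h.mul (isBigO_refl (fun τ : ℝ => τ⁻¹) _)).congr' ?_ ?_
      · filter_upwards [self_mem_nhdsWithin] with τ hτ
        have hτ : τ ≠ 0 := ne_of_lt hτ
        rw [Finset.sum_range_succ', h0]
        simp only [zero_mul, add_zero, Finset.sum_mul]
        refine Finset.sum_congr rfl fun m _ => ?_
        rw [pow_succ]
        field_simp
      · filter_upwards [self_mem_nhdsWithin] with τ hτ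
        have hτ : τ ≠ 0 := ne_of_lt hτ
        rw [pow_succ]
        field_simp)
    intro m hm
    rcases m with _ | m
    · exact h0
    · exact h3 m (by omega)

lemma moments {ι : Type*} (I : Finset ι) (a s : ι → ℝ) (N : ℕ)
    (h : (fun τ : ℝ => ∑ p ∈ I, a p * Real.exp (s p * τ)) =O[𝓝[<] 0] fun τ => τ ^ N) :
    ∀ m < N, ∑ p ∈ I, a p * s p ^ m = 0 := by
  have h1 : (fun τ : ℝ => ∑ p ∈ I, a p * (Real.exp (s p * τ) -
      ∑ m ∈ Finset.range N, (s p * τ) ^ m / (m.factorial : ℝ))) =O[𝓝[<] 0] fun τ => τ ^ N := by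
    refine IsBigO.fun_sum fun p _ => IsBigO.const_mul_left ?_ _
    have ht : Tendsto (fun τ : ℝ => s p * τ) (𝓝[<] 0) (𝓝 0) := by
      have : Continuous (fun τ : ℝ => s p * τ) := by fun_prop
      have h2 := this.tendsto 0
      rw [mul_zero] at h2
      exact h2.mono_left nhdsWithin_le_nhds
    refine ((Real.exp_sub_sum_range_isBigO_pow N).comp_tendsto ht).trans ?_
    simp only [Function.comp_def, mul_pow]
    exact (isBigO_refl _ _).const_mul_left _
  have h2 := poly_zero N (fun m => (∑ p ∈ I, a p * s p ^ m) / (m.factorial : ℝ)) (by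
    refine (h.sub h1).congr_left fun τ => ?_
    rw [← Finset.sum_sub_distrib]
    simp only [Finset.sum_div, Finset.sum_mul]
    rw [Finset.sum_comm]
    refine Finset.sum_congr rfl fun p _ => ?_
    rw [mul_sub, sub_sub_cancel, Finset.mul_sum]
    refine Finset.sum_congr rfl fun m _ => ?_
    rw [mul_pow]
    ring)
  intro m hm
  have h3 := h2 m hm
  have : (m.factorial : ℝ) ≠ 0 := by exact_mod_cast m.factorial_ne_zero
  exact (div_eq_zero_iff.mp h3).resolve_right this

lemma ode (α : ℝ) (f : ℂ → ℂ) (I : Set ℝ) (hI : IsOpen I) (hI' : IsPreconnected I)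
    (h1 : ∀ x ∈ I, x - 1 ≠ 0 ∧ x + 1 ≠ 0) (hd : ∀ x ∈ I, DifferentiableAt ℂ f (x : ℂ))
    (hp : ∀ x ∈ I, ((x : ℂ) ^ 2 - 1) * deriv f x = 2 * (α : ℂ) * f x) (x₀ : ℝ) (hx₀ : x₀ ∈ I) :
    ∃ K : ℂ, ∀ x ∈ I, f x = K * (Real.exp (α * (Real.log (x - 1) - Real.log (x + 1))) : ℝ) := by
  set g : ℝ → ℂ := fun x => f x * (Real.exp (-(α * (Real.log (x - 1) - Real.log (x + 1)))) : ℝ) with hg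
  have hder : ∀ x ∈ I, HasDerivAt g 0 x := by
    intro x hx
    obtain ⟨ha, hb⟩ := h1 x hx
    have d1 : HasDerivAt (fun y : ℝ => f y) (deriv f x) x := (hd x hx).hasDerivAt.comp_ofReal
    have d2 : HasDerivAt (fun y : ℝ => Real.log (y - 1) - Real.log (y + 1))
        (1 / (x - 1) - 1 / (x + 1)) x :=
      (((hasDerivAt_id x).sub_const 1).log ha).sub (((hasDerivAt_id x).add_const 1).log hb)
    have d3 := ((d2.const_mul α).fun_neg.exp).ofReal_comp
    have d4 := d1.mul d3
    refine d4.congr_deriv ?_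
    have hp' := hp x hx
    have ha' : (x : ℂ) - 1 ≠ 0 := by exact_mod_cast ha
    have hb' : (x : ℂ) + 1 ≠ 0 := by exact_mod_cast hb
    have hdf : deriv f x = 2 * (α : ℂ) * f x / (((x : ℂ) - 1) * (x + 1)) := by
      field_simp
      linear_combination hp'
    rw [hdf]
    push_cast
    field_simp
    ring
  refine ⟨g x₀, fun x hx => ?_⟩
  have hc : g x₀ = g x := hI.is_const_of_deriv_eq_zero hI'
    (fun y hy => (hder y hy).differentiableAt.differentiableWithinAt)
    (fun y hy => (hder y hy).deriv) hx₀ hx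
  rw [hc, hg]
  simp only
  rw [mul_assoc, ← Complex.ofReal_mul, ← Real.exp_add]
  simp

noncomputable def xx (τ : ℝ) : ℝ := (1 + Real.exp τ) / (1 - Real.exp τ)

lemma xx_facts {τ : ℝ} (hτ : τ < 0) : 0 < 1 - Real.exp τ ∧ xx τ - 1 = 2 * Real.exp τ / (1 - Real.exp τ) ∧
    xx τ + 1 = 2 / (1 - Real.exp τ) ∧ 1 < xx τ ∧
    Real.log (xx τ - 1) - Real.log (xx τ + 1) = τ ∧ (xx τ)⁻¹ ≤ |τ| ∧ (xx τ + 1)⁻¹ ≤ |τ| := by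
  have h1 : Real.exp τ < 1 := by simpa using hτ
  have h0 := Real.exp_pos τ
  have h2 : 0 < 1 - Real.exp τ := by linarith
  have e1 : xx τ - 1 = 2 * Real.exp τ / (1 - Real.exp τ) := by rw [xx]; field_simp; ring
  have e2 : xx τ + 1 = 2 / (1 - Real.exp τ) := by rw [xx]; field_simp; ring
  have p1 : 0 < xx τ - 1 := by rw [e1]; positivity
  have hb : 1 - Real.exp τ ≤ |τ| := by
    rw [abs_of_neg hτ]
    linarith [Real.add_one_le_exp τ]
  refine ⟨h2, e1, e2, by linarith, ?_, ?_, ?_⟩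
  · rw [← Real.log_div p1.ne' (by linarith), e1, e2]
    rw [show 2 * Real.exp τ / (1 - Real.exp τ) / (2 / (1 - Real.exp τ)) = Real.exp τ by field_simp]
    exact Real.log_exp τ
  · refine le_trans ?_ hb
    rw [xx, inv_div, div_le_iff₀ (by linarith)]
    nlinarith
  · refine le_trans ?_ hb
    rw [e2, inv_div, div_le_iff₀ (by norm_num)]
    linarith

lemma xx_tendsto : Tendsto (fun τ : ℝ => (xx τ : ℂ)) (𝓝[<] 0) (cobounded ℂ) := by
  rw [← tendsto_norm_atTop_iff_cobounded]
  have t1 : Tendsto (fun τ : ℝ => 1 + Real.exp τ) (𝓝[<] 0) (𝓝 2) := by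
    have : Continuous (fun τ : ℝ => 1 + Real.exp τ) := by fun_prop
    have h2 := this.tendsto 0
    rw [Real.exp_zero, show (1 : ℝ) + 1 = 2 by norm_num] at h2
    exact h2.mono_left nhdsWithin_le_nhds
  have t2 : Tendsto (fun τ : ℝ => 1 - Real.exp τ) (𝓝[<] 0) (𝓝[>] 0) := by
    refine tendsto_nhdsWithin_iff.mpr ⟨?_, ?_⟩
    · have : Continuous (fun τ : ℝ => 1 - Real.exp τ) := by fun_prop
      have h2 := this.tendsto 0
      rw [Real.exp_zero, sub_self] at h2
      exact h2.mono_left nhdsWithin_le_nhds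
    · filter_upwards [self_mem_nhdsWithin] with τ hτ using (xx_facts hτ).1
  have t3 := Tendsto.pos_mul_atTop (by norm_num : (0 : ℝ) < 2) t1 (tendsto_inv_nhdsGT_zero.comp t2)
  refine t3.congr' ?_
  filter_upwards [self_mem_nhdsWithin] with τ hτ
  have := (xx_facts hτ).2.2.2.1
  rw [Complex.norm_real, Real.norm_of_nonneg (by linarith), xx, div_eq_mul_inv]
  rfl


open MeasureTheory in
lemma beta_int {u v : ℝ} (hu : 0 < u) (hv : 0 < v) :
    IntegrableOn (fun x : ℝ => x ^ (u - 1) * (1 - x) ^ (v - 1)) (Set.Ioo 0 1) ∧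
    ∫ x in Set.Ioo (0 : ℝ) 1, x ^ (u - 1) * (1 - x) ^ (v - 1) =
      Real.Gamma u * Real.Gamma v / Real.Gamma (u + v) := by
  have hc := Complex.betaIntegral_convergent (u := u) (v := v) (by simpa) (by simpa)
  rw [intervalIntegrable_iff_integrableOn_Ioc_of_le (by simp)] at hc
  have heq : ∀ x ∈ Set.Ioc (0 : ℝ) 1, RCLike.re ((x : ℂ) ^ ((u : ℂ) - 1) * (1 - (x : ℂ)) ^ ((v : ℂ) - 1)) =
      x ^ (u - 1) * (1 - x) ^ (v - 1) := by
    intro x hx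
    norm_cast
    rw [← Complex.ofReal_cpow, ← Complex.ofReal_cpow, RCLike.re_to_complex,
      Complex.re_mul_ofReal, Complex.ofReal_re]
    all_goals linarith [hx.1, hx.2]
  constructor
  · have := hc.re
    refine IntegrableOn.mono_set ?_ Set.Ioo_subset_Ioc_self
    exact IntegrableOn.congr_fun this heq measurableSet_Ioc
  · have h1 := ProbabilityTheory.beta_eq_betaIntegralReal u v hu hv
    rw [ProbabilityTheory.beta] at h1
    rw [h1, Complex.betaIntegral, intervalIntegral.integral_of_le (by norm_num),
      ← integral_Ioc_eq_integral_Ioo, ← RCLike.re_to_complex, ← integral_re hc]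
    exact (setIntegral_congr_fun measurableSet_Ioc heq).symm

lemma gamma_shift (x : ℝ) (m : ℕ) (h : ∀ j < m, x + j ≠ 0) :
    Real.Gamma (x + m) = (∏ j ∈ Finset.range m, (x + j)) * Real.Gamma x := by
  induction m with
  | zero => simp
  | succ m ih =>
    have e : x + ((m + 1 : ℕ) : ℝ) = (x + m) + 1 := by push_cast; ring
    rw [e, Real.Gamma_add_one (h m (by omega)), ih (fun j hj => h j (by omega)),
      Finset.prod_range_succ]
    ring

noncomputable def TT (n m : ℕ) : ℝ[X] :=
  X * (∏ j ∈ Finset.range m, (X + C (1 + j : ℝ))) * ∏ j ∈ Finset.range n, (C (1 + j : ℝ) - X)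

lemma TT_deg (n m : ℕ) : (TT n m).natDegree ≤ 1 + m + n := by
  refine natDegree_mul_le_of_le (natDegree_mul_le_of_le natDegree_X_le ?_) ?_
  · refine (natDegree_prod_le _ _).trans ?_
    refine (Finset.sum_le_card_nsmul _ _ 1 fun j _ => ?_).trans (by simp)
    rw [natDegree_X_add_C]
  · refine (natDegree_prod_le _ _).trans ?_
    refine (Finset.sum_le_card_nsmul _ _ 1 fun j _ => ?_).trans (by simp)
    refine (natDegree_sub_le _ _).trans ?_
    rw [natDegree_C, natDegree_X]
    simp

lemma TT_eval (n m : ℕ) (s : ℝ) (h1 : -1 < s) (h2 : s < n + 1) :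
    Real.sin (Real.pi * s) * (Real.Gamma (s + m + 1) * Real.Gamma (n - s + 1)) =
      Real.pi * (TT n m).eval s := by
  simp only [TT, eval_mul, eval_X, eval_prod, eval_add, eval_sub, eval_C]
  by_cases hs : Real.sin (Real.pi * s) = 0
  · rw [hs, zero_mul]
    obtain ⟨t, ht⟩ := Real.sin_eq_zero_iff.mp hs
    have hts : s = t := by
      have := Real.pi_pos
      apply mul_left_cancel₀ this.ne'
      linarith
    rw [hts] at h1 h2
    have t1 : -1 < t := by exact_mod_cast h1
    have t2 : t < n + 1 := by exact_mod_cast h2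
    symm
    obtain ⟨r, rfl⟩ : ∃ r : ℕ, t = r := ⟨t.toNat, by omega⟩
    rcases r with _ | r
    · simp at hts
      simp [hts]
    · rw [Finset.prod_eq_zero (s := Finset.range n) (i := r)]
      · simp
      · simp; omega
      · rw [hts]; push_cast; ring
  · have hIntg : ∀ t : ℤ, s ≠ t := by
      intro t ht
      apply hs
      rw [ht, mul_comm]
      exact Real.sin_int_mul_pi t
    have g1 := gamma_shift (s + 1) m (fun j _ h0 => hIntg (-(1 + j)) (by push_cast; linarith))
    have g2 := gamma_shift (1 - s) n (fun j _ h0 => hIntg (1 + j) (by push_cast; linarith))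
    have g3 := Real.Gamma_add_one (s := s) (fun h0 => hIntg 0 (by simpa using h0))
    have g4 := Real.Gamma_mul_Gamma_one_sub s
    have e1 : s + m + 1 = s + 1 + m := by ring
    have e2 : n - s + 1 = 1 - s + n := by ring
    rw [e1, e2, g1, g2, g3]
    have p1 : ∏ j ∈ Finset.range m, (s + (1 + (j : ℝ))) = ∏ j ∈ Finset.range m, (s + 1 + (j : ℝ)) :=
      Finset.prod_congr rfl fun j _ => by ring
    have p2 : ∏ j ∈ Finset.range n, (1 + (j : ℝ) - s) = ∏ j ∈ Finset.range n, (1 - s + (j : ℝ)) :=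
      Finset.prod_congr rfl fun j _ => by ring
    rw [p1, p2]
    rw [eq_div_iff hs] at g4
    linear_combination (s * (∏ j ∈ Finset.range m, (s + 1 + (j : ℝ))) * ∏ j ∈ Finset.range n, (1 - s + (j : ℝ))) * g4

noncomputable def GG (n : ℕ) (α : ℝ) (a : Fin 3 × ℕ → ℝ) (u : ℝ) : ℝ :=
  ∑ p ∈ II n, a p * Real.sin (Real.pi * ss α p) * (u ^ (ss α p) * (1 - u) ^ (n - ss α p))

lemma ss_bounds {n : ℕ} {α : ℝ} (hα2 : |α| < 1 / 2) {p : Fin 3 × ℕ} (hp : p ∈ II n) :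
    -1 < ss α p ∧ ss α p < n + 1 := by
  rw [mem_II] at hp
  have h1 : (p.2 : ℝ) ≤ n := by exact_mod_cast hp
  have h0 : (0 : ℝ) ≤ p.2 := by positivity
  rw [abs_lt] at hα2
  obtain ⟨k, i⟩ := p
  simp only [ss] at *
  fin_cases k <;> simp <;> constructor <;> linarith

open MeasureTheory in
lemma GG_orth (n : ℕ) {α : ℝ} (hα2 : |α| < 1 / 2) (a : Fin 3 × ℕ → ℝ)
    (h : ∀ m < 3 * n + 2, ∑ p ∈ II n, a p * ss α p ^ m = 0) (m : ℕ) (hm : m ≤ 2 * n) :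
    IntegrableOn (fun u => GG n α a u * u ^ m) (Set.Ioo 0 1) ∧
    ∫ u in Set.Ioo (0 : ℝ) 1, GG n α a u * u ^ m = 0 := by
  have hcongr : Set.EqOn (fun u : ℝ => ∑ p ∈ II n, a p * Real.sin (Real.pi * ss α p) *
      (u ^ ((ss α p + m + 1) - 1) * (1 - u) ^ ((n - ss α p + 1) - 1)))
      (fun u : ℝ => GG n α a u * u ^ m) (Set.Ioo 0 1) := by
    intro u hu
    simp only [GG, Finset.sum_mul]
    refine Finset.sum_congr rfl fun p _ => ?_
    rw [add_sub_cancel_right, add_sub_cancel_right, Real.rpow_add hu.1, Real.rpow_natCast]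
    ring
  have hb : ∀ p ∈ II n, 0 < ss α p + m + 1 ∧ 0 < n - ss α p + 1 := by
    intro p hp
    obtain ⟨b1, b2⟩ := ss_bounds hα2 hp
    have : (0 : ℝ) ≤ m := by positivity
    constructor <;> linarith
  have hIntg : ∀ p ∈ II n, IntegrableOn (fun u : ℝ => a p * Real.sin (Real.pi * ss α p) *
      (u ^ ((ss α p + m + 1) - 1) * (1 - u) ^ ((n - ss α p + 1) - 1))) (Set.Ioo 0 1) :=
    fun p hp => (beta_int (hb p hp).1 (hb p hp).2).1.const_mul _
  constructor
  · refine IntegrableOn.congr_fun ?_ hcongr measurableSet_Ioo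
    exact integrable_finsetSum _ hIntg
  · rw [← setIntegral_congr_fun measurableSet_Ioo hcongr, integral_finsetSum _ hIntg]
    have e : ∀ p ∈ II n, ∫ u in Set.Ioo (0 : ℝ) 1, a p * Real.sin (Real.pi * ss α p) *
      (u ^ ((ss α p + m + 1) - 1) * (1 - u) ^ ((n - ss α p + 1) - 1)) =
        (Real.pi / Real.Gamma (n + m + 2)) * (a p * (TT n m).eval (ss α p)) := by
      intro p hp
      rw [integral_const_mul, (beta_int (hb p hp).1 (hb p hp).2).2]
      obtain ⟨b1, b2⟩ := ss_bounds hα2 hp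
      have := TT_eval n m (ss α p) b1 b2
      rw [show ss α p + m + 1 + (n - ss α p + 1) = (n : ℝ) + m + 2 by ring]
      linear_combination (a p / Real.Gamma (n + m + 2)) * this
    rw [Finset.sum_congr rfl e, ← Finset.mul_sum, mom_poly (II n) a (ss α) (3 * n + 2) h, mul_zero]
    have := TT_deg n m
    omega

lemma const_sign {h : ℝ → ℝ} {c b : ℝ} (hc : ContinuousOn h (Set.Ioo c b))
    (hne : ∀ x ∈ Set.Ioo c b, h x ≠ 0) :
    (∀ x ∈ Set.Ioo c b, 0 < h x) ∨ (∀ x ∈ Set.Ioo c b, h x < 0) := by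
  by_contra hcon
  push Not at hcon
  obtain ⟨⟨x, hx, hx1⟩, ⟨y, hy, hy1⟩⟩ := hcon
  obtain ⟨t, ht, ht0⟩ := isPreconnected_Ioo.intermediate_value hx hy hc ⟨hx1, hy1⟩
  exact hne t ht ht0

lemma sign_poly (G : ℝ → ℝ) (Z : Finset ℝ) : ∀ b : ℝ, ContinuousOn G (Set.Ioo 0 b) →
    (∀ x ∈ Set.Ioo 0 b, x ∉ Z → G x ≠ 0) →
    ∃ q : ℝ[X], q.natDegree ≤ Z.card ∧ (∀ x, x ∉ Z → q.eval x ≠ 0) ∧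
      ∀ x ∈ Set.Ioo 0 b, x ∉ Z → 0 < G x * q.eval x := by
  induction Z using Finset.induction_on_max with
  | empty =>
    intro b hc hne
    rcases const_sign hc (fun x hx => hne x hx (by simp)) with h | h
    · exact ⟨1, by simp, by simp, fun x hx _ => by simpa using h x hx⟩
    · exact ⟨-1, by simp, by simp, fun x hx _ => by simpa using h x hx⟩
  | insert a Z hmax ih =>
    intro b hc hne
    have haZ : a ∉ Z := fun h => lt_irrefl _ (hmax a h)
    rw [Finset.card_insert_of_notMem haZ]
    rcases le_or_gt b a with hba | hab
    · obtain ⟨q, h1, h2, h3⟩ := ih b hc (fun x hx hxZ => hne x hx (by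
        rw [Finset.mem_insert, not_or]; exact ⟨(hx.2.trans_le hba).ne, hxZ⟩))
      refine ⟨q, by omega, fun x hx => h2 x fun h => hx (Finset.mem_insert_of_mem h), fun x hx hxZ =>
        h3 x hx fun h => hxZ (Finset.mem_insert_of_mem h)⟩
    · obtain ⟨q, h1, h2, h3⟩ := ih a (hc.mono (Set.Ioo_subset_Ioo_right hab.le))
        (fun x hx hxZ => hne x ⟨hx.1, hx.2.trans hab⟩ (by
        rw [Finset.mem_insert, not_or]; exact ⟨hx.2.ne, hxZ⟩))
      have hout : ∀ x, a < x → x ∉ Z := fun x hx hxZ => lt_asymm hx (hmax x hxZ)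
      have hsub : Set.Ioo (max a 0) b ⊆ Set.Ioo 0 b := Set.Ioo_subset_Ioo_left (le_max_right _ _)
      have hcs : ContinuousOn (fun x => G x * q.eval x) (Set.Ioo (max a 0) b) :=
        (hc.mono hsub).mul q.continuous.continuousOn
      have hgt : ∀ x ∈ Set.Ioo (max a 0) b, a < x := fun x hx => (le_max_left _ _).trans_lt hx.1
      rcases const_sign hcs (fun x hx => mul_ne_zero (hne x (hsub hx) (by
        rw [Finset.mem_insert, not_or]; exact ⟨(hgt x hx).ne', hout x (hgt x hx)⟩))
          (h2 x (hout x (hgt x hx)))) with h | h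
      · refine ⟨q, by omega, fun x hx => h2 x fun h => hx (Finset.mem_insert_of_mem h), fun x hx hxZ => ?_⟩
        rw [Finset.mem_insert, not_or] at hxZ
        rcases lt_or_gt_of_ne hxZ.1 with hl | hg
        · exact h3 x ⟨hx.1, hl⟩ hxZ.2
        · exact h x ⟨max_lt hg hx.1, hx.2⟩
      · refine ⟨q * (C a - X), ?_, fun x hx => ?_, fun x hx hxZ => ?_⟩
        · refine natDegree_mul_le_of_le h1 ((natDegree_sub_le _ _).trans ?_)
          simp
        · rw [Finset.mem_insert, not_or] at hx
          rw [eval_mul]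
          refine mul_ne_zero (h2 x hx.2) ?_
          simp only [eval_sub, eval_C, eval_X]
          exact sub_ne_zero.mpr (Ne.symm hx.1)
        · rw [Finset.mem_insert, not_or] at hxZ
          simp only [eval_mul, eval_sub, eval_C, eval_X]
          rw [← mul_assoc]
          rcases lt_or_gt_of_ne hxZ.1 with hl | hg
          · exact mul_pos (h3 x ⟨hx.1, hl⟩ hxZ.2) (by linarith)
          · exact mul_pos_of_neg_of_neg (h x ⟨max_lt hg hx.1, hx.2⟩) (by linarith)

lemma GG_cont (n : ℕ) (α : ℝ) (a : Fin 3 × ℕ → ℝ) : ContinuousOn (GG n α a) (Set.Ioo 0 1) := by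
  unfold GG
  refine continuousOn_finsetSum _ fun p _ => ContinuousOn.mul continuousOn_const (ContinuousOn.mul ?_ ?_)
  · exact continuousOn_id.rpow_const fun x hx => Or.inl hx.1.ne'
  · exact (continuousOn_const.sub continuousOn_id).rpow_const fun x hx => Or.inl (sub_pos.mpr hx.2).ne'

open MeasureTheory in
lemma GG_zeros (n : ℕ) {α : ℝ} (hα2 : |α| < 1 / 2) (a : Fin 3 × ℕ → ℝ)
    (h : ∀ m < 3 * n + 2, ∑ p ∈ II n, a p * ss α p ^ m = 0) :
    ∃ S : Finset ℝ, 2 * n + 1 ≤ S.card ∧ ∀ u ∈ S, u ∈ Set.Ioo (0 : ℝ) 1 ∧ GG n α a u = 0 := by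
  by_cases hinf : {u | u ∈ Set.Ioo (0 : ℝ) 1 ∧ GG n α a u = 0}.Infinite
  · obtain ⟨S, hS, hcard⟩ := hinf.exists_subset_card_eq (2 * n + 1)
    exact ⟨S, hcard.ge, fun u hu => hS hu⟩
  rw [Set.not_infinite] at hinf
  by_contra hno
  set Z := hinf.toFinset with hZ
  have hcard : Z.card ≤ 2 * n := by
    by_contra hlt
    exact hno ⟨Z, by omega, fun u hu => by simpa [hZ] using hu⟩
  have hcont := GG_cont n α a
  obtain ⟨q, hq1, hq2, hq3⟩ := sign_poly (GG n α a) Z 1 hcont (fun x hx hxZ h0 => hxZ (by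
    rw [hZ, Set.Finite.mem_toFinset]; exact ⟨hx, h0⟩))
  have hIntg : ∀ m ∈ Finset.range (2 * n + 1), IntegrableOn
      (fun u => q.coeff m * (GG n α a u * u ^ m)) (Set.Ioo 0 1) := fun m hm =>
    (GG_orth n hα2 a h m (by simp at hm; omega)).1.const_mul _
  have hfun : (fun u => GG n α a u * q.eval u) =
      fun u => ∑ m ∈ Finset.range (2 * n + 1), q.coeff m * (GG n α a u * u ^ m) := by
    funext u
    rw [eval_eq_sum_range' (show q.natDegree < 2 * n + 1 by omega), Finset.mul_sum]
    exact Finset.sum_congr rfl fun m _ => by ring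
  have hI : IntegrableOn (fun u => GG n α a u * q.eval u) (Set.Ioo 0 1) := by
    rw [hfun]; exact integrable_finsetSum _ hIntg
  have h0 : ∫ u in Set.Ioo (0 : ℝ) 1, GG n α a u * q.eval u = 0 := by
    rw [hfun, integral_finsetSum _ hIntg]
    refine Finset.sum_eq_zero fun m hm => ?_
    rw [integral_const_mul, (GG_orth n hα2 a h m (by simp at hm; omega)).2, mul_zero]
  have hnn : ∀ u ∈ Set.Ioo (0 : ℝ) 1, 0 ≤ GG n α a u * q.eval u := by
    intro u hu
    by_cases huZ : u ∈ Z
    · rw [hZ, Set.Finite.mem_toFinset] at huZ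
      rw [huZ.2, zero_mul]
    · exact (hq3 u hu huZ).le
  have hpos := (setIntegral_pos_iff_support_of_nonneg_ae
    (ae_restrict_of_forall_mem measurableSet_Ioo hnn) hI).mpr (by
      have hsub : Set.Ioo (0 : ℝ) 1 \ (Z : Set ℝ) ⊆
          (Function.support fun u => GG n α a u * q.eval u) ∩ Set.Ioo 0 1 := by
        intro u hu
        exact ⟨(hq3 u hu.1 (by simpa using hu.2)).ne', hu.1⟩
      refine lt_of_lt_of_le ?_ (measure_mono hsub)
      rw [measure_sdiff_null (Z.finite_toSet.measure_zero _)]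
      simp)
  linarith



lemma sum_II {M : Type*} [AddCommMonoid M] (n : ℕ) (F : Fin 3 × ℕ → M) :
    ∑ p ∈ II n, F p = ∑ i ∈ Finset.range (n + 1), F (0, i) + ∑ i ∈ Finset.range (n + 1), F (1, i)
      + ∑ i ∈ Finset.range (n + 1), F (2, i) := by
  rw [II, Finset.sum_product, Fin.sum_univ_three]

noncomputable def BB (n : ℕ) (a : Fin 3 × ℕ → ℝ) (k : Fin 3) (u : ℝ) : ℝ :=
  ∑ i ∈ Finset.range (n + 1), a (k, i) * ((-1) ^ i * u ^ i * (1 - u) ^ (n - i))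

lemma GG_eq (n : ℕ) (α : ℝ) (a : Fin 3 × ℕ → ℝ) (u : ℝ) (hu : u ∈ Set.Ioo (0 : ℝ) 1) :
    GG n α a u = Real.sin (α * Real.pi) * Real.exp (α * (Real.log u - Real.log (1 - u))) *
      (BB n a 1 u + 2 * Real.cos (α * Real.pi) * BB n a 2 u *
        Real.exp (α * (Real.log u - Real.log (1 - u)))) := by
  set w := Real.exp (α * (Real.log u - Real.log (1 - u))) with hw
  have hu1 : 0 < 1 - u := sub_pos.mpr hu.2
  have key : ∀ (k : Fin 3), ∑ i ∈ Finset.range (n + 1), a (k, i) * Real.sin (Real.pi * ss α (k, i)) *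
      (u ^ (ss α (k, i)) * (1 - u) ^ (n - ss α (k, i))) =
      Real.sin ((k : ℕ) * (α * Real.pi)) * w ^ (k : ℕ) * BB n a k u := by
    intro k
    rw [BB, Finset.mul_sum]
    refine Finset.sum_congr rfl fun i hi => ?_
    have hi' : i ≤ n := by simpa [Nat.lt_succ_iff] using hi
    have e1 : Real.sin (Real.pi * ss α (k, i)) = (-1) ^ i * Real.sin ((k : ℕ) * (α * Real.pi)) := by
      rw [ss, show Real.pi * ((i : ℝ) + (k : ℕ) * α) = (k : ℕ) * (α * Real.pi) + i * Real.pi by ring,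
        Real.sin_add_nat_mul_pi]
    have e2 : u ^ (ss α (k, i)) * (1 - u) ^ ((n : ℝ) - ss α (k, i)) =
        u ^ i * (1 - u) ^ (n - i) * w ^ (k : ℕ) := by
      have : (n : ℝ) - ss α (k, i) = ((n - i : ℕ) : ℝ) + (-((k : ℕ) * α)) := by
        rw [Nat.cast_sub hi', ss]; ring
      rw [this, ss, Real.rpow_add hu.1, Real.rpow_add hu1, Real.rpow_natCast, Real.rpow_natCast,
        Real.rpow_def_of_pos hu.1, Real.rpow_def_of_pos hu1, hw, ← Real.exp_nat_mul]
      have : Real.exp ((k : ℕ) * (α * (Real.log u - Real.log (1 - u)))) =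
          Real.exp (Real.log u * ((k : ℕ) * α)) * Real.exp (Real.log (1 - u) * (-((k : ℕ) * α))) := by
        rw [← Real.exp_add]; congr 1; ring
      rw [this]
      ring
    rw [e1, e2]
    ring
  rw [GG, sum_II, key 0, key 1, key 2]
  simp [Real.sin_two_mul]
  ring

lemma aeval_BB (n : ℕ) (a : Fin 3 × ℕ → ℝ) (k : Fin 3) (u : ℝ) :
    ∑ i ∈ Finset.range (n + 1), (a (k, i) : ℂ) * (((1 - 2 * u : ℝ) : ℂ) - 1) ^ i *
      (((1 - 2 * u : ℝ) : ℂ) + 1) ^ (n - i) = ((2 ^ n * BB n a k u : ℝ) : ℂ) := by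
  rw [BB, Finset.mul_sum]
  push_cast
  refine Finset.sum_congr rfl fun i hi => ?_
  have hi' : i ≤ n := by simpa [Nat.lt_succ_iff] using hi
  rw [show (1 - 2 * (u : ℂ) - 1) = 2 * ((-1) * u) by ring, show (1 - 2 * (u : ℂ) + 1) = 2 * (1 - u) by ring]
  have : (2 : ℂ) ^ n = 2 ^ i * 2 ^ (n - i) := by rw [← pow_add]; congr 1; omega
  rw [this]
  simp only [mul_pow]
  ring

lemma f_eq (α : ℝ) (f : ℂ → ℂ)
    (hf_dom : DifferentiableOn ℂ f {z : ℂ | ¬(z.im = 0 ∧ |z.re| ≤ 1)})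
    (hf_pearson : ∀ z ∈ {z : ℂ | ¬(z.im = 0 ∧ |z.re| ≤ 1)},
      (z ^ 2 - 1) * deriv f z = 2 * (α : ℂ) * f z)
    (hf_inf : Tendsto f (cobounded ℂ) (𝓝 1)) (τ : ℝ) (hτ : τ < 0) :
    f (xx τ) = (Real.exp (α * τ) : ℝ) := by
  have hopen : IsOpen {z : ℂ | ¬(z.im = 0 ∧ |z.re| ≤ 1)} := by
    have : IsClosed {z : ℂ | z.im = 0 ∧ |z.re| ≤ 1} :=
      (isClosed_eq Complex.continuous_im continuous_const).inter
        (isClosed_le Complex.continuous_re.abs continuous_const)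
    exact this.isOpen_compl
  have hmem : ∀ x ∈ Set.Ioi (1 : ℝ), (x : ℂ) ∈ {z : ℂ | ¬(z.im = 0 ∧ |z.re| ≤ 1)} := by
    intro x hx
    simp only [Set.mem_ofPred_eq, Complex.ofReal_im, Complex.ofReal_re, true_and, not_le]
    exact lt_of_lt_of_le hx (le_abs_self x)
  obtain ⟨K, hK⟩ := ode α f (Set.Ioi 1) isOpen_Ioi isPreconnected_Ioi
    (fun x hx => by have : 1 < x := hx; constructor <;> linarith)
    (fun x hx => hf_dom.differentiableAt (hopen.mem_nhds (hmem x hx)))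
    (fun x hx => hf_pearson _ (hmem x hx)) 2 (by simp)
  have hK' : ∀ τ < 0, f (xx τ) = K * (Real.exp (α * τ) : ℝ) := by
    intro τ hτ
    obtain ⟨-, -, -, h4, h5, -⟩ := xx_facts hτ
    rw [hK _ h4, h5]
  have hK1 : K = 1 := by
    have t1 := hf_inf.comp xx_tendsto
    have t2 : Tendsto (fun τ : ℝ => K * (Real.exp (α * τ) : ℝ)) (𝓝[<] 0) (𝓝 K) := by
      have : Continuous (fun τ : ℝ => K * ((Real.exp (α * τ) : ℝ) : ℂ)) := by fun_prop
      have h2 := this.tendsto 0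
      simp only [mul_zero, Real.exp_zero, Complex.ofReal_one, mul_one] at h2
      exact h2.mono_left nhdsWithin_le_nhds
    refine tendsto_nhds_unique t2 (t1.congr' ?_)
    filter_upwards [self_mem_nhdsWithin] with τ hτ using hK' τ hτ
  rw [hK' τ hτ, hK1, one_mul]

lemma f₀_eq (α : ℝ) (f₀ : ℂ → ℂ)
    (hf₀_dom : DifferentiableOn ℂ f₀ {z : ℂ | ¬(z.im = 0 ∧ 1 ≤ |z.re|)})
    (hf₀_pearson : ∀ z ∈ {z : ℂ | ¬(z.im = 0 ∧ 1 ≤ |z.re|)},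
      (z ^ 2 - 1) * deriv f₀ z = 2 * (α : ℂ) * f₀ z)
    (hf₀_0 : f₀ 0 = 1) (u : ℝ) (hu : u ∈ Set.Ioo (0 : ℝ) 1) :
    f₀ ((1 - 2 * u : ℝ) : ℂ) = (Real.exp (α * (Real.log u - Real.log (1 - u))) : ℝ) := by
  have hopen : IsOpen {z : ℂ | ¬(z.im = 0 ∧ 1 ≤ |z.re|)} := by
    have : IsClosed {z : ℂ | z.im = 0 ∧ 1 ≤ |z.re|} :=
      (isClosed_eq Complex.continuous_im continuous_const).inter
        (isClosed_le continuous_const Complex.continuous_re.abs)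
    exact this.isOpen_compl
  have hmem : ∀ x ∈ Set.Ioo (-1 : ℝ) 1, (x : ℂ) ∈ {z : ℂ | ¬(z.im = 0 ∧ 1 ≤ |z.re|)} := by
    intro x hx
    simp only [Set.mem_ofPred_eq, Complex.ofReal_im, Complex.ofReal_re, true_and, not_le]
    exact abs_lt.mpr hx
  obtain ⟨K, hK⟩ := ode α f₀ (Set.Ioo (-1) 1) isOpen_Ioo isPreconnected_Ioo
    (fun x hx => ⟨by linarith [hx.2] |> fun h : x - 1 < 0 => h.ne, by linarith [hx.1] |> fun h : 0 < x + 1 => h.ne'⟩)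
    (fun x hx => hf₀_dom.differentiableAt (hopen.mem_nhds (hmem x hx)))
    (fun x hx => hf₀_pearson _ (hmem x hx)) 0 (by simp)
  have hK1 : K = 1 := by
    have := hK 0 (by simp)
    simp [hf₀_0] at this
    exact this.symm
  rw [hK _ ⟨by linarith [hu.2], by linarith [hu.1]⟩, hK1, one_mul]
  have hu0 := hu.1
  have hu1 : 0 < 1 - u := sub_pos.mpr hu.2
  rw [show 1 - 2 * u - 1 = -(2 * u) by ring, show 1 - 2 * u + 1 = 2 * (1 - u) by ring,
    Real.log_neg_eq_log, Real.log_mul (by norm_num) hu0.ne', Real.log_mul (by norm_num) hu1.ne']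
  congr 3
  ring

lemma HP_moments (α : ℝ) (f : ℂ → ℂ) (hf : ∀ τ < 0, f (xx τ) = (Real.exp (α * τ) : ℝ))
    (n : ℕ) (a : Fin 3 × ℕ → ℝ) (q : Fin 3 → ℂ → ℂ)
    (hq : ∀ k z, q k z = ∑ i ∈ Finset.range (n + 1), (a (k, i) : ℂ) * (z - 1) ^ i * (z + 1) ^ (n - i))
    (hHP : (fun z : ℂ => q 0 z + q 1 z * f z + q 2 z * f z ^ 2)
      =O[cobounded ℂ] fun z => (z ^ (2 * n + 2))⁻¹) :
    ∀ m < 3 * n + 2, ∑ p ∈ II n, a p * ss α p ^ m = 0 := by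
  apply moments
  have h1 := (hHP.comp_tendsto xx_tendsto).mul
    (isBigO_refl (fun τ : ℝ => ((((xx τ + 1) ^ n)⁻¹ : ℝ) : ℂ)) (𝓝[<] 0))
  have h2 : (fun τ : ℝ => ((∑ p ∈ II n, a p * Real.exp (ss α p * τ) : ℝ) : ℂ)) =O[𝓝[<] 0]
      (fun τ : ℝ => τ ^ (3 * n + 2)) := by
    refine (h1.congr' ?_ EventuallyEq.rfl).trans ?_
    · filter_upwards [self_mem_nhdsWithin] with τ hτ
      obtain ⟨h1, h2, h3, h4, h5, h6, h7⟩ := xx_facts hτ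
      have hx : ((xx τ : ℂ) + 1) ≠ 0 := by
        have : xx τ + 1 ≠ 0 := by linarith
        exact_mod_cast this
      have hrel : (xx τ : ℂ) - 1 = (xx τ + 1) * (Real.exp τ : ℝ) := by
        have : xx τ - 1 = (xx τ + 1) * Real.exp τ := by rw [h2, h3]; ring
        exact_mod_cast this
      have key : ∀ k : Fin 3, q k (xx τ) * f (xx τ) ^ (k : ℕ) * (((xx τ + 1) ^ n)⁻¹ : ℝ) =
          ∑ i ∈ Finset.range (n + 1), ((a (k, i) * Real.exp (ss α (k, i) * τ) : ℝ) : ℂ) := by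
        intro k
        rw [hq, Finset.sum_mul, Finset.sum_mul]
        refine Finset.sum_congr rfl fun i hi => ?_
        have hi' : i ≤ n := by simpa [Nat.lt_succ_iff] using hi
        have e2 : ((xx τ : ℂ) + 1) ^ n = (xx τ + 1) ^ i * (xx τ + 1) ^ (n - i) := by
          rw [← pow_add]; congr 1; omega
        have e3 : Real.exp (ss α (k, i) * τ) = Real.exp τ ^ i * Real.exp (α * τ) ^ (k : ℕ) := by
          rw [← Real.exp_nat_mul, ← Real.exp_nat_mul, ← Real.exp_add, ss]
          congr 1
          ring
        rw [hrel, hf τ hτ, e3]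
        push_cast
        rw [e2, mul_pow]
        field_simp
      have k0 := key 0
      have k1 := key 1
      have k2 := key 2
      simp only [Fin.val_zero, Fin.val_one, Fin.val_two, pow_zero, pow_one, mul_one] at k0 k1 k2
      simp only [Function.comp_apply]
      rw [sum_II]
      push_cast at k0 k1 k2 ⊢
      rw [← k0, ← k1, ← k2]
      ring
    · refine IsBigO.of_bound 1 ?_
      filter_upwards [self_mem_nhdsWithin] with τ hτ
      obtain ⟨h1, h2, h3, h4, h5, h6, h7⟩ := xx_facts hτ
      simp only [Function.comp_apply]
      have p0 : 0 < xx τ := by linarith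
      have p1 : 0 < xx τ + 1 := by linarith
      rw [norm_mul, norm_inv, norm_pow, Complex.norm_real, Complex.norm_real, norm_inv, norm_pow, norm_pow,
        Real.norm_of_nonneg p0.le, Real.norm_of_nonneg p1.le, one_mul, Real.norm_eq_abs,
        ← inv_pow, ← inv_pow]
      calc (xx τ)⁻¹ ^ (2 * n + 2) * (xx τ + 1)⁻¹ ^ n ≤ |τ| ^ (2 * n + 2) * |τ| ^ n := by gcongr
        _ = |τ| ^ (3 * n + 2) := by rw [← pow_add]; congr 1; ring
  exact (IsBigO.of_norm_left (h2.norm_left.congr_left fun τ => by rw [Complex.norm_real]))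

end HP

/-- For real `α` with `|α| ∈ (0,1/2)`, let `f` be the branch of `((z−1)/(z+1))^α`
on `ℂ∖[−1,1]` with `f(∞)=1`, and `f₀` the branch of `((1−z)/(1+z))^α` on `ℂ∖F`,
`F = {x ∈ ℝ : |x| ≥ 1}`, with `f₀(0)=1` (both characterized by the Pearson equation
`(z²−1) g' = 2α g` together with the normalization).  If `Q₀, Q₁, Q₂` (real coefficients)
are type I Hermite–Padé polynomials of order `n` for `(1, f, f²)`, then every (complex)
zero of each `Q_k` lies in `ℝ∖[−1,1]`, and `ρ_n = Q₁ + 2cos(απ) Q₂ f₀` has at least `2n+1`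
zeros, counted with multiplicity, in `(−1,1)`. -/
theorem stmt_4 (α : ℝ) (hα0 : 0 < |α|) (hα2 : |α| < 1 / 2)
    (f : ℂ → ℂ)
    (hf_dom : DifferentiableOn ℂ f {z : ℂ | ¬(z.im = 0 ∧ |z.re| ≤ 1)})
    (hf_pearson : ∀ z ∈ {z : ℂ | ¬(z.im = 0 ∧ |z.re| ≤ 1)},
      (z ^ 2 - 1) * deriv f z = 2 * (α : ℂ) * f z)
    (hf_inf : Tendsto f (cobounded ℂ) (𝓝 1))
    (f₀ : ℂ → ℂ)
    (hf₀_dom : DifferentiableOn ℂ f₀ {z : ℂ | ¬(z.im = 0 ∧ 1 ≤ |z.re|)})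
    (hf₀_pearson : ∀ z ∈ {z : ℂ | ¬(z.im = 0 ∧ 1 ≤ |z.re|)},
      (z ^ 2 - 1) * deriv f₀ z = 2 * (α : ℂ) * f₀ z)
    (hf₀_0 : f₀ 0 = 1)
    (n : ℕ) (Q : Fin 3 → Polynomial ℝ)
    (hQ : ∃ k, Q k ≠ 0)
    (hdeg : ∀ k, (Q k).natDegree ≤ n)
    (hHP : (fun z : ℂ => aeval z (Q 0) + aeval z (Q 1) * f z + aeval z (Q 2) * f z ^ 2)
      =O[cobounded ℂ] fun z => (z ^ (2 * n + 2))⁻¹) :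
    (∀ k, ∀ z : ℂ, aeval z (Q k) = 0 → z.im = 0 ∧ 1 < |z.re|) ∧
    (∃ (S : Finset ℝ) (m : ℝ → ℕ),
      (∀ x ∈ S, x ∈ Set.Ioo (-1 : ℝ) 1) ∧
      2 * n + 1 ≤ ∑ x ∈ S, m x ∧
      ∀ x ∈ S, ∀ j < m x,
        iteratedDeriv j
          (fun z : ℂ => aeval z (Q 1) + ((2 * Real.cos (α * Real.pi) : ℝ) : ℂ)
            * aeval z (Q 2) * f₀ z) (x : ℂ) = 0) := by
  classical
  choose b hb using fun k => HP.repr_basis n (Q k) (hdeg k)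
  set a : Fin 3 × ℕ → ℝ := fun p => b p.1 p.2 with ha
  have hne : ∃ p ∈ HP.II n, a p ≠ 0 := by
    by_contra hcon
    push Not at hcon
    obtain ⟨k, hk⟩ := hQ
    apply hk
    have hz : ∀ z : ℂ, aeval z (Q k) = 0 := by
      intro z
      rw [hb]
      refine Finset.sum_eq_zero fun i hi => ?_
      have hi' : i ≤ n := by simpa [Nat.lt_succ_iff] using hi
      have := hcon (k, i) (HP.mem_II.mpr hi')
      simp only [ha] at this
      rw [this]
      simp
    have hmap : (Q k).map (algebraMap ℝ ℂ) = 0 := by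
      apply Polynomial.funext
      intro z
      rw [Polynomial.eval_map_algebraMap, hz, Polynomial.eval_zero]
    exact (Polynomial.map_eq_zero (algebraMap ℝ ℂ)).mp hmap
  have hf := HP.f_eq α f hf_dom hf_pearson hf_inf
  have hmom := HP.HP_moments α f hf n a (fun k z => aeval z (Q k)) (fun k z => hb k z) hHP
  refine ⟨?_, ?_⟩
  · intro k z hz
    obtain ⟨κ, hκ, c, hc, hcoef⟩ := HP.coef_RN n hα0 hα2 a hne hmom k
    rw [hb] at hz
    exact HP.zero_loc n (b k) hκ hc hcoef z hz
  · obtain ⟨S, hcard, hS⟩ := HP.GG_zeros n hα2 a hmom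
    refine ⟨S.image (fun u => 1 - 2 * u), fun _ => 1, ?_, ?_, ?_⟩
    · intro x hx
      obtain ⟨u, hu, rfl⟩ := Finset.mem_image.mp hx
      obtain ⟨⟨h0, h1⟩, -⟩ := hS u hu
      exact ⟨by linarith, by linarith⟩
    · rw [Finset.sum_const, smul_eq_mul, mul_one, Finset.card_image_of_injective]
      · exact hcard
      · intro u v huv
        simp only at huv
        linarith
    · intro x hx j hj
      obtain ⟨u, hu, rfl⟩ := Finset.mem_image.mp hx
      obtain ⟨huI, hG⟩ := hS u hu
      obtain rfl : j = 0 := Nat.lt_one_iff.mp hj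
      have hsin : Real.sin (α * Real.pi) ≠ 0 := by
        have hpos : 0 < Real.sin (|α| * Real.pi) :=
          Real.sin_pos_of_pos_of_lt_pi (mul_pos hα0 Real.pi_pos) (by nlinarith [Real.pi_pos])
        rcases abs_choice α with h | h
        · rw [h] at hpos
          exact hpos.ne'
        · rw [h, neg_mul, Real.sin_neg] at hpos
          intro h0
          rw [h0] at hpos
          simp at hpos
      rw [HP.GG_eq n α a u huI] at hG
      have hB := (mul_eq_zero.mp hG).resolve_left (mul_ne_zero hsin (Real.exp_ne_zero _))
      have e := fun k => HP.aeval_BB n a k u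
      simp only [iteratedDeriv_zero]
      rw [hb, hb, HP.f₀_eq α f₀ hf₀_dom hf₀_pearson hf₀_0 u huI]
      have e1 := e 1
      have e2 := e 2
      simp only [ha] at e1 e2
      rw [e1, e2, ← Complex.ofReal_mul, ← Complex.ofReal_mul, ← Complex.ofReal_add,
        ← Complex.ofReal_zero]
      congr 1
      linear_combination (2 : ℝ) ^ n * hB
end

section
/- Let α ∈ ℝ with |α| ∈ (0,1/2), let f(z) = ((z−1)/(z+1))^α be the holomorphic branch on ℂ∖[−1,1] with f(∞) = 1, and for each n let Q_{n,0}, Q_{n,1}, Q_{n,2} be type I Hermite–Padé polynomials of order n for (1, f, f²). Then for each k ∈ {0,1,2} the normalized zero counting measures of Q_{n,k} converge, as n → ∞, to the absolutely continuous probability measure ν on {x ∈ ℝ : |x| > 1} with density ν'(x) = (√3/(2π)) · (x²−1)^{−1/3} · [ (|x|−1)^{−1/3} − (|x|+1)^{−1/3} ]; that is, for every continuous compactly supported function φ : ℝ → ℝ, (1/n) Σ_{x : Q_{n,k}(x)=0} φ(x) → ∫_{|x|>1} φ(x) ν'(x) dx, where the zeros are counted with multiplicity. -/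
open Polynomial Filter Asymptotics Bornology Topology MeasureTheory

/-- The density `ν'(x) = (√3/(2π)) (x²−1)^{−1/3} [(|x|−1)^{−1/3} − (|x|+1)^{−1/3}]` of the
limit zero distribution `ν` on `{x ∈ ℝ : |x| > 1}`. -/
noncomputable def nuDensity (x : ℝ) : ℝ :=
  Real.sqrt 3 / (2 * Real.pi) * (x ^ 2 - 1) ^ (-(1 / 3) : ℝ) *
    ((|x| - 1) ^ (-(1 / 3) : ℝ) - (|x| + 1) ^ (-(1 / 3) : ℝ))


theorem hp_logder {K : Type*} [Field K] (W : Multiset K) (z : K) (h : ∀ w ∈ W, z + w ≠ 0) :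
    z * ((W.map (fun w => X + C w)).prod.derivative).eval z =
      ((W.map (fun w => X + C w)).prod).eval z * (W.map (fun w => z / (z + w))).sum := by
  induction W using Multiset.induction_on with
  | empty => simp
  | cons a W ih =>
    have h1 := ih (fun w hw => h w (Multiset.mem_cons_of_mem hw))
    have h2 := h a (Multiset.mem_cons_self a W)
    simp only [Multiset.map_cons, Multiset.prod_cons, Multiset.sum_cons, derivative_mul, eval_add,
      eval_mul, derivative_add, derivative_X, derivative_C, eval_X, eval_C, add_zero, eval_one] at *
    rw [mul_add, mul_left_comm z (z + a), h1]
    field_simp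

def HPGood (n : ℕ) (c : ℕ → ℝ) : Prop :=
  (∀ j ≤ n, 0 < c j) ∧ ∀ z : ℂ, z.im ≠ 0 → ∑ j ∈ Finset.range (n + 1), (c j : ℂ) * z ^ j ≠ 0

noncomputable def hpPoly (n : ℕ) (c : ℕ → ℝ) : ℝ[X] :=
  ∑ j ∈ Finset.range (n + 1), C (c j) * X ^ j

theorem hpPoly_coeff (n : ℕ) (c : ℕ → ℝ) (j : ℕ) :
    (hpPoly n c).coeff j = if j ≤ n then c j else 0 := by
  simp [hpPoly, coeff_C_mul, coeff_X_pow, Nat.lt_succ_iff]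

theorem hpPoly_natDegree (n : ℕ) (c : ℕ → ℝ) (h : c n ≠ 0) : (hpPoly n c).natDegree = n := by
  apply le_antisymm
  · rw [natDegree_le_iff_coeff_eq_zero]
    intro N hN
    rw [hpPoly_coeff, if_neg (by omega)]
  · apply le_natDegree_of_ne_zero
    rw [hpPoly_coeff]; simpa using h

theorem hp_factor (n : ℕ) (c : ℕ → ℝ) (h : HPGood n c) :
    ∃ W : Multiset ℝ, Multiset.card W = n ∧ (∀ w ∈ W, 0 < w) ∧
      hpPoly n c = C (c n) * (W.map (fun w => X + C w)).prod := by
  obtain ⟨hpos, hz⟩ := h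
  have hcn := hpos n le_rfl
  have hnd := hpPoly_natDegree n c hcn.ne'
  set p := hpPoly n c with hp
  set P : ℂ[X] := p.map (algebraMap ℝ ℂ) with hP
  have hPe : ∀ z : ℂ, P.eval z = ∑ j ∈ Finset.range (n + 1), (c j : ℂ) * z ^ j := by
    intro z
    simp [hP, hp, hpPoly, Polynomial.map_sum, eval_finsetSum]
  have hlc : p.leadingCoeff = c n := by
    rw [leadingCoeff, hnd, hpPoly_coeff]; simp
  have hp0 : p ≠ 0 := by
    intro h0; rw [h0] at hlc; simp at hlc; exact hcn.ne hlc
  have hPn : P.natDegree = n := by rw [hP, natDegree_map, hnd]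
  have hspl : P.Splits := IsAlgClosed.splits P
  have hP0 : P ≠ 0 := by
    rw [hP]; exact (Polynomial.map_ne_zero_iff (algebraMap ℝ ℂ).injective).2 hp0
  have hroot : ∀ r ∈ P.roots, r = ((r.re : ℝ) : ℂ) ∧ r.re < 0 := by
    intro r hr
    have h1 : P.eval r = 0 := by simpa using (mem_roots hP0).1 hr
    have h2 : r.im = 0 := by
      by_contra hne
      exact hz r hne (by rw [← hPe]; exact h1)
    have h3 : r = ((r.re : ℝ) : ℂ) := by
      apply Complex.ext <;> simp [h2]
    refine ⟨h3, ?_⟩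
    by_contra hge
    push Not at hge
    rw [h3, hPe] at h1
    have h4 : (∑ j ∈ Finset.range (n + 1), c j * r.re ^ j) = 0 := by
      have : ((∑ j ∈ Finset.range (n + 1), c j * r.re ^ j : ℝ) : ℂ) = 0 := by
        rw [← h1]; push_cast; rfl
      exact_mod_cast this
    have h5 : 0 < ∑ j ∈ Finset.range (n + 1), c j * r.re ^ j := by
      rw [Finset.sum_range_succ']
      have := hpos 0 (Nat.zero_le _)
      have h6 : 0 ≤ ∑ k ∈ Finset.range n, c (k + 1) * r.re ^ (k + 1) := by
        apply Finset.sum_nonneg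
        intro i hi
        have := hpos (i + 1) (by have := Finset.mem_range.1 hi; omega)
        positivity
      simp; linarith
    linarith
  refine ⟨P.roots.map (fun r => -r.re), ?_, ?_, ?_⟩
  · rw [Multiset.card_map, ← hPn]; exact hspl.natDegree_eq_card_roots.symm
  · intro w hw
    obtain ⟨r, hr, rfl⟩ := Multiset.mem_map.1 hw
    linarith [(hroot r hr).2]
  · apply Polynomial.map_injective (algebraMap ℝ ℂ) (algebraMap ℝ ℂ).injective
    have h1 := hspl.eq_prod_roots
    have h2 : P.leadingCoeff = algebraMap ℝ ℂ (c n) := by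
      rw [hP, leadingCoeff_map, hlc]
    rw [h2] at h1
    rw [← hP]
    conv_lhs => rw [h1]
    rw [Polynomial.map_mul, map_C, Polynomial.map_multiset_prod, Multiset.map_map, Multiset.map_map]
    congr 2
    apply Multiset.map_congr rfl
    intro r hr
    have := (hroot r hr).1
    simp only [Function.comp, Polynomial.map_add, map_X, map_C, map_neg]
    conv_lhs => rw [this]
    simp [sub_eq_add_neg]

theorem hp_eval_C (n : ℕ) (c : ℕ → ℝ) (z : ℂ) : ((hpPoly n c).map (algebraMap ℝ ℂ)).eval z =
    ∑ j ∈ Finset.range (n + 1), (c j : ℂ) * z ^ j := by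
  simp [hpPoly, Polynomial.map_sum, eval_finsetSum]

/-- complex factorisation data -/
theorem hp_factorC (n : ℕ) (c : ℕ → ℝ) (h : HPGood n c) :
    ∃ W : Multiset ℝ, Multiset.card W = n ∧ (∀ w ∈ W, 0 < w) ∧ ∀ z : ℂ, z.im ≠ 0 →
      ((∑ j ∈ Finset.range (n + 1), (c j : ℂ) * z ^ j) =
        c n * (W.map (fun w : ℝ => z + (w : ℂ))).prod) ∧
      (∑ j ∈ Finset.range (n + 1), ((j : ℂ) * c j) * z ^ j) =
       (∑ j ∈ Finset.range (n + 1), (c j : ℂ) * z ^ j) *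
        (W.map (fun w : ℝ => z / (z + (w : ℂ)))).sum := by
  obtain ⟨W, h1, h2, h3⟩ := hp_factor n c h
  refine ⟨W, h1, h2, fun z hz => ?_⟩
  have h4 : (hpPoly n c).map (algebraMap ℝ ℂ) =
      C (c n : ℂ) * ((W.map (fun w : ℝ => (w : ℂ))).map (fun w => X + C w)).prod := by
    rw [h3, Polynomial.map_mul, map_C, Polynomial.map_multiset_prod, Multiset.map_map,
      Multiset.map_map]
    congr 2
    apply Multiset.map_congr rfl
    intro r hr
    simp
  have h5 := hp_eval_C n c z
  constructor
  · rw [← h5, h4]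
    simp [eval_multiset_prod]
  · have h6 := hp_logder (W.map (fun w : ℝ => (w : ℂ))) z (by
      intro w hw
      obtain ⟨r, hr, rfl⟩ := Multiset.mem_map.1 hw
      intro h0
      apply hz
      have := congrArg Complex.im h0
      simpa using this)
    have h7 : z * ((hpPoly n c).map (algebraMap ℝ ℂ)).derivative.eval z =
        ∑ j ∈ Finset.range (n + 1), ((j : ℂ) * c j) * z ^ j := by
      simp only [hpPoly, Polynomial.map_sum, derivative_sum, eval_finsetSum, Finset.mul_sum]
      apply Finset.sum_congr rfl
      intro j hj
      rcases j with _ | j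
      · simp
      · simp; ring
    rw [← h7, ← h5, h4, derivative_mul]
    simp only [derivative_C, zero_mul, zero_add, eval_mul, eval_C]
    rw [mul_left_comm, h6, Multiset.map_map]
    simp only [Multiset.map_map, Function.comp_def]
    ring

theorem hp_im (W : Multiset ℝ) (hW : ∀ w ∈ W, 0 < w) (z : ℂ) (hz : z.im ≠ 0) :
    ∃ t : ℝ, 0 ≤ t ∧ (W ≠ 0 → 0 < t) ∧
      ((W.map (fun w : ℝ => z / (z + (w : ℂ)))).sum).im = t * z.im := by
  induction W using Multiset.induction_on with
  | empty => exact ⟨0, le_rfl, by simp, by simp⟩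
  | cons a W ih =>
    obtain ⟨t, ht, -, h⟩ := ih (fun w hw => hW w (Multiset.mem_cons_of_mem hw))
    have ha := hW a (Multiset.mem_cons_self a W)
    have hN : 0 < Complex.normSq (z + a) := by
      rw [Complex.normSq_pos]
      intro h0
      apply hz
      have := congrArg Complex.im h0
      simpa using this
    refine ⟨a / Complex.normSq (z + a) + t, by positivity, fun _ => by positivity, ?_⟩
    rw [Multiset.map_cons, Multiset.sum_cons, Complex.add_im, h, Complex.div_im]
    simp only [Complex.add_re, Complex.add_im, Complex.ofReal_re, Complex.ofReal_im]
    field_simp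
    ring

theorem hp_step1 (n : ℕ) (c : ℕ → ℝ) (h : HPGood n c) (a : ℝ) (ha : 0 < a) :
    HPGood n (fun j => (j + a) * c j) := by
  refine ⟨fun j hj => mul_pos (by positivity) (h.1 j hj), fun z hz => ?_⟩
  obtain ⟨W, hW1, hW2, hW3⟩ := hp_factorC n c h
  obtain ⟨h1, h2⟩ := hW3 z hz
  obtain ⟨t, ht0, ht1, ht⟩ := hp_im W hW2 z hz
  have h3 : (∑ j ∈ Finset.range (n + 1), (((j + a) * c j : ℝ) : ℂ) * z ^ j) =
      (∑ j ∈ Finset.range (n + 1), (c j : ℂ) * z ^ j) *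
        ((W.map (fun w : ℝ => z / (z + (w : ℂ)))).sum + a) := by
    rw [mul_add, ← h2, Finset.sum_mul, ← Finset.sum_add_distrib]
    apply Finset.sum_congr rfl
    intro j hj
    push_cast; ring
  rw [h3]
  apply mul_ne_zero (h.2 z hz)
  intro h0
  by_cases hW : W = 0
  · subst hW; simp at h0; exact ha.ne' h0
  · have := congrArg Complex.im h0
    simp [ht] at this
    rcases this with h | h
    · exact (ht1 hW).ne' h
    · exact hz h

theorem hp_step2 (n : ℕ) (c : ℕ → ℝ) (h : HPGood n c) (a : ℝ) (ha : 0 < a) :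
    HPGood n (fun j => (n - j + a) * c j) := by
  refine ⟨fun j hj => mul_pos (by
    have : (j : ℝ) ≤ n := by exact_mod_cast hj
    linarith) (h.1 j hj), fun z hz => ?_⟩
  obtain ⟨W, hW1, hW2, hW3⟩ := hp_factorC n c h
  obtain ⟨h1, h2⟩ := hW3 z hz
  obtain ⟨t, ht0, ht1, ht⟩ := hp_im W hW2 z hz
  have h3 : (∑ j ∈ Finset.range (n + 1), (((n - j + a) * c j : ℝ) : ℂ) * z ^ j) =
      (∑ j ∈ Finset.range (n + 1), (c j : ℂ) * z ^ j) *
        ((n : ℂ) + a - (W.map (fun w : ℝ => z / (z + (w : ℂ)))).sum) := by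
    rw [mul_sub, ← h2, Finset.sum_mul, ← Finset.sum_sub_distrib]
    apply Finset.sum_congr rfl
    intro j hj
    push_cast; ring
  rw [h3]
  apply mul_ne_zero (h.2 z hz)
  intro h0
  by_cases hW : W = 0
  · subst hW; simp at hW1; subst hW1; simp at h0; exact ha.ne' h0
  · have := congrArg Complex.im h0
    simp [ht] at this
    rcases this with h | h
    · exact (ht1 hW).ne' h
    · exact hz h

theorem hp_lower (n : ℕ) (c : ℕ → ℝ) (h : HPGood n c) (z : ℂ) (hz : z.im ≠ 0) :
    c n * |z.im| ^ n ≤ ‖∑ j ∈ Finset.range (n + 1), (c j : ℂ) * z ^ j‖ := by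
  obtain ⟨W, hW1, hW2, hW3⟩ := hp_factorC n c h
  rw [(hW3 z hz).1, norm_mul, Complex.norm_real, Real.norm_of_nonneg (h.1 n le_rfl).le]
  apply mul_le_mul_of_nonneg_left _ (h.1 n le_rfl).le
  rw [← hW1]
  clear hW1 hW2 hW3
  induction W using Multiset.induction_on with
  | empty => simp
  | cons a W ih =>
    rw [Multiset.map_cons, Multiset.prod_cons, norm_mul, Multiset.card_cons, pow_succ']
    apply mul_le_mul _ ih (by positivity) (norm_nonneg _)
    have := Complex.abs_im_le_norm (z + a)
    simpa using this

theorem hp_limit (n : ℕ) (c : ℕ → ℕ → ℝ) (d : ℕ → ℝ) (h : ∀ m, HPGood n (c m))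
    (hd : ∀ j ≤ n, 0 < d j) (hl : ∀ j ≤ n, Tendsto (fun m => c m j) atTop (𝓝 (d j))) :
    HPGood n d := by
  refine ⟨hd, fun z hz h0 => ?_⟩
  have h1 : Tendsto (fun m => ‖∑ j ∈ Finset.range (n + 1), (c m j : ℂ) * z ^ j‖) atTop
      (𝓝 ‖∑ j ∈ Finset.range (n + 1), (d j : ℂ) * z ^ j‖) := by
    apply Tendsto.norm
    apply tendsto_finsetSum
    intro j hj
    apply Tendsto.mul_const
    exact (Complex.continuous_ofReal.tendsto _).comp
      (hl j (Nat.lt_succ_iff.1 (Finset.mem_range.1 hj)))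
  have h2 : Tendsto (fun m => c m n * |z.im| ^ n) atTop (𝓝 (d n * |z.im| ^ n)) :=
    (hl n le_rfl).mul_const _
  have h3 := le_of_tendsto_of_tendsto' h2 h1 (fun m => hp_lower n (c m) (h m) z hz)
  rw [h0, norm_zero] at h3
  have : 0 < d n * |z.im| ^ n := mul_pos (hd n le_rfl) (pow_pos (abs_pos.2 hz) _)
  linarith


noncomputable def hpg (m : ℕ) (t : ℝ) : ℝ := ∏ k ∈ Finset.range m, (t + (k + 1))

theorem hpg_pos (m : ℕ) (t : ℝ) (ht : -1 < t) : 0 < hpg m t := by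
  apply Finset.prod_pos
  intro k hk
  have : (0 : ℝ) ≤ k := by positivity
  linarith

theorem hpg_rec (m : ℕ) (t : ℝ) : hpg m (t + 1) * (t + 1) = hpg m t * (t + 1 + m) := by
  induction m with
  | zero => simp [hpg]
  | succ m ih =>
    unfold hpg at *
    rw [Finset.prod_range_succ, Finset.prod_range_succ]
    have : (∏ x ∈ Finset.range m, (t + 1 + ((x : ℝ) + 1))) * (t + 1 + ((m : ℝ) + 1)) * (t + 1)
      = ((∏ x ∈ Finset.range m, (t + 1 + ((x : ℝ) + 1))) * (t + 1)) * (t + 1 + ((m : ℝ) + 1)) := by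
      ring
    rw [this, ih]
    push_cast
    ring

theorem hp_scale (n : ℕ) (c : ℕ → ℝ) (h : HPGood n c) (a : ℝ) (ha : 0 < a) :
    HPGood n (fun j => a * c j) := by
  refine ⟨fun j hj => mul_pos ha (h.1 j hj), fun z hz => ?_⟩
  have : (∑ j ∈ Finset.range (n + 1), ((a * c j : ℝ) : ℂ) * z ^ j) =
    a * ∑ j ∈ Finset.range (n + 1), (c j : ℂ) * z ^ j := by
    rw [Finset.mul_sum]
    apply Finset.sum_congr rfl
    intro j hj
    push_cast; ring
  rw [this]
  exact mul_ne_zero (by exact_mod_cast ha.ne') (h.2 z hz)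

theorem hp_choose (n : ℕ) : HPGood n (fun j => (n.choose j : ℝ)) := by
  refine ⟨fun j hj => Nat.cast_pos.2 (Nat.choose_pos hj), fun z hz => ?_⟩
  have : (∑ j ∈ Finset.range (n + 1), ((n.choose j : ℝ) : ℂ) * z ^ j) = (z + 1) ^ n := by
    rw [add_pow]
    apply Finset.sum_congr rfl
    intro j hj
    simp; ring
  rw [this]
  apply pow_ne_zero
  intro h0
  apply hz
  have := congrArg Complex.im h0
  simpa using this

theorem hp_congr (n : ℕ) (c d : ℕ → ℝ) (h : HPGood n c) (hcd : ∀ j, c j = d j) : HPGood n d := by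
  have : c = d := funext hcd
  rwa [← this]

theorem hp_goodstep (n : ℕ) (c : ℕ → ℝ) (h : HPGood n c) (β : ℝ) (hβ : |β| < 1) (m : ℕ) :
    HPGood n (fun j => hpg m (j + β) * hpg m (n - j - β) * c j) := by
  obtain ⟨hb1, hb2⟩ := abs_lt.1 hβ
  induction m with
  | zero => exact hp_congr n c _ h (fun j => by simp [hpg])
  | succ m ih =>
    have hm : (0 : ℝ) ≤ m := by positivity
    have h1 := hp_step1 n _ ih (β + (m + 1)) (by linarith)
    have h2 := hp_step2 n _ h1 ((m + 1) - β) (by linarith)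
    refine hp_congr n _ _ h2 (fun j => ?_)
    unfold hpg
    rw [Finset.prod_range_succ, Finset.prod_range_succ]
    ring

theorem hp_lim1 (a b : ℝ) : Tendsto (fun m : ℕ => (a + m) / (b + m)) atTop (𝓝 1) := by
  have h1 : Tendsto (fun m : ℕ => (b + (m : ℝ))) atTop atTop :=
    tendsto_atTop_add_const_left _ _ tendsto_natCast_atTop_atTop
  have h2 : Tendsto (fun m : ℕ => 1 + (a - b) / (b + (m : ℝ))) atTop (𝓝 (1 + 0)) :=
    (h1.const_div_atTop (a - b)).const_add 1
  rw [add_zero] at h2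
  refine h2.congr' ?_
  filter_upwards [h1.eventually_gt_atTop 0] with m hm
  field_simp
  ring

theorem hp_ratio (n j : ℕ) (hj : j < n) (β : ℝ) (hβ : |β| < 1) (m : ℕ) :
    hpg m (((j + 1 : ℕ) : ℝ) + β) * hpg m (n - ((j + 1 : ℕ) : ℝ) - β) =
      hpg m (j + β) * hpg m (n - j - β) * ((n - j - β) / (j + 1 + β)) *
        ((j + 1 + β + m) / (n - j - β + m)) := by
  obtain ⟨hb1, hb2⟩ := abs_lt.1 hβ
  have hm : (0 : ℝ) ≤ m := by positivity
  have hj0 : (0 : ℝ) ≤ j := by positivity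
  have hj1 : (j : ℝ) + 1 ≤ n := by exact_mod_cast hj
  have e1 := hpg_rec m (j + β)
  have e2 := hpg_rec m (n - ((j + 1 : ℕ) : ℝ) - β)
  push_cast at *
  have q1 : (j : ℝ) + β + 1 = j + 1 + β := by ring
  have q2 : (n : ℝ) - (j + 1) - β + 1 = n - j - β := by ring
  rw [q1] at e1
  rw [q2] at e2
  have p1 : 0 < (j : ℝ) + 1 + β := by linarith
  have p2 : 0 < (n : ℝ) - j - β := by linarith
  have p3 : 0 < (n : ℝ) - j - β + m := by linarith
  rw [mul_assoc, div_mul_div_comm, ← mul_div_assoc, eq_div_iff (by positivity)]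
  linear_combination (hpg m (n - (j + 1) - β) * (n - j - β + m)) * e1 - (hpg m (j + β)
    * (j + 1 + β + m)) * e2

theorem hp_good (n : ℕ) (β₁ β₂ : ℝ) (h1 : |β₁| < 1) (h2 : |β₂| < 1) (c : ℕ → ℝ) (hc0 : c 0 = 1)
    (hrec : ∀ j < n, c (j + 1) * (((j : ℝ) + 1) * (j + 1 + β₁) * (j + 1 + β₂)) =
      c j * (((n : ℝ) - j) * (n - j - β₁) * (n - j - β₂))) : HPGood n c := by
  have hpos : ∀ j ≤ n, 0 < c j := by
    intro j
    induction j with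
    | zero => intro _; rw [hc0]; norm_num
    | succ j ih =>
      intro hj
      have e := hrec j (by omega)
      have h0 := ih (by omega)
      obtain ⟨a1, a2⟩ := abs_lt.1 h1
      obtain ⟨b1, b2⟩ := abs_lt.1 h2
      have hj0 : (0 : ℝ) ≤ j := by positivity
      have hj1 : (j : ℝ) + 1 ≤ n := by exact_mod_cast hj
      have p1 : 0 < ((j : ℝ) + 1) * (j + 1 + β₁) * (j + 1 + β₂) :=
        mul_pos (mul_pos (by linarith) (by linarith)) (by linarith)
      have p2 : 0 < ((n : ℝ) - j) * (n - j - β₁) * (n - j - β₂) :=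
        mul_pos (mul_pos (by linarith) (by linarith)) (by linarith)
      have p3 : 0 < c (j + 1) * (((j : ℝ) + 1) * (j + 1 + β₁) * (j + 1 + β₂)) := by
        rw [e]; exact mul_pos h0 p2
      exact pos_of_mul_pos_left p3 p1.le
  set b : ℕ → ℕ → ℝ := fun m j => hpg m (j + β₂) * hpg m (n - j - β₂) *
    (hpg m (j + β₁) * hpg m (n - j - β₁) * (n.choose j : ℝ)) with hb
  have hbG : ∀ m, HPGood n (b m) := fun m =>
    hp_goodstep n _ (hp_goodstep n _ (hp_choose n) β₁ h1 m) β₂ h2 m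
  have hb0 : ∀ m, 0 < b m 0 := fun m => (hbG m).1 0 (Nat.zero_le _)
  refine hp_limit n (fun m j => (b m 0)⁻¹ * b m j) c
    (fun m => hp_scale n _ (hbG m) _ (inv_pos.2 (hb0 m))) hpos ?_
  intro j
  induction j with
  | zero =>
    intro _
    rw [hc0]
    refine tendsto_const_nhds.congr (fun m => ?_)
    rw [inv_mul_cancel₀ (hb0 m).ne']
  | succ j ih =>
    intro hj
    have hj0 : (0 : ℝ) ≤ j := by positivity
    have hj1 : (j : ℝ) + 1 ≤ n := by exact_mod_cast hj
    obtain ⟨a1, a2⟩ := abs_lt.1 h1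
    obtain ⟨b1, b2⟩ := abs_lt.1 h2
    have L := (((ih (by omega)).mul_const
      (((n : ℝ) - j) / (j + 1) * ((n - j - β₁) / (j + 1 + β₁)) * ((n - j - β₂) / (j + 1 + β₂)))).mul
      (hp_lim1 (j + 1 + β₁) (n - j - β₁))).mul (hp_lim1 (j + 1 + β₂) (n - j - β₂))
    have p1 : 0 < (j : ℝ) + 1 := by linarith
    have p2 : 0 < (j : ℝ) + 1 + β₁ := by linarith
    have p3 : 0 < (j : ℝ) + 1 + β₂ := by linarith
    have e : c j * (((n : ℝ) - j) / (j + 1) * ((n - j - β₁) / (j + 1 + β₁)) *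
        ((n - j - β₂) / (j + 1 + β₂))) * 1 * 1 = c (j + 1) := by
      have := hrec j (by omega)
      field_simp
      linarith
    rw [e] at L
    refine L.congr (fun m => ?_)
    have r1 := hp_ratio n j (by omega) β₁ h1 m
    have r2 := hp_ratio n j (by omega) β₂ h2 m
    have r3 : (n.choose (j + 1) : ℝ) = n.choose j * (((n : ℝ) - j) / (j + 1)) := by
      have := Nat.choose_succ_right_eq n j
      have h' : (n.choose (j + 1) : ℝ) * (j + 1) = n.choose j * ((n : ℝ) - j) := by
        rw [← Nat.cast_sub (by omega)]
        exact_mod_cast this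
      field_simp
      linarith
    simp only [hb]
    rw [r1, r2, r3]
    ring


theorem hp_sum_deriv (W : Multiset ℝ) (g : ℝ → ℝ → ℝ) (g' : ℝ → ℝ) (x : ℝ)
    (h : ∀ w ∈ W, HasDerivAt (g w) (g' w) x) :
    HasDerivAt (fun y => (W.map (fun w => g w y)).sum) ((W.map g').sum) x := by
  induction W using Multiset.induction_on with
  | empty => simpa using hasDerivAt_const x (0 : ℝ)
  | cons a W ih =>
    simp only [Multiset.map_cons, Multiset.sum_cons]
    exact (h a (Multiset.mem_cons_self a W)).add
      (ih (fun w hw => h w (Multiset.mem_cons_of_mem hw)))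

theorem hp_sum_bound (W : Multiset ℝ) (g : ℝ → ℝ) (h : ∀ w ∈ W, |g w| ≤ 1) :
    |(W.map g).sum| ≤ Multiset.card W := by
  induction W using Multiset.induction_on with
  | empty => simp
  | cons a W ih =>
    simp only [Multiset.map_cons, Multiset.sum_cons, Multiset.card_cons]
    have h1 := h a (Multiset.mem_cons_self a W)
    have h2 := ih (fun w hw => h w (Multiset.mem_cons_of_mem hw))
    push_cast
    calc _ ≤ |g a| + |(W.map g).sum| := abs_add_le _ _
      _ ≤ _ := by linarith

theorem hp_sum_nonneg (W : Multiset ℝ) (g : ℝ → ℝ) (h : ∀ w ∈ W, 0 ≤ g w) :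
    0 ≤ (W.map g).sum := by
  apply Multiset.sum_nonneg
  intro x hx
  obtain ⟨w, hw, rfl⟩ := Multiset.mem_map.1 hx
  exact h w hw

theorem hp_moments (W : Multiset ℝ) (hW : ∀ w ∈ W, 0 < w) (p : ℝ[X]) (a : ℝ)
    (hp : p = C a * (W.map (fun w => X + C w)).prod) (x : ℝ) (hx : 0 < x) :
    ∃ N V U : ℝ, N = (W.map (fun w => x / (x + w))).sum ∧ |V| ≤ Multiset.card W ∧
      |U| ≤ Multiset.card W ∧
      (X * derivative p).eval x = p.eval x * N ∧
      (X * derivative (X * derivative p)).eval x = p.eval x * (N ^ 2 + V) ∧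
      (X * derivative (X * derivative (X * derivative p))).eval x =
        p.eval x * (N ^ 3 + 3 * N * V + U) := by
  set N : ℝ → ℝ := fun y => (W.map (fun w => y / (y + w))).sum with hN
  set V : ℝ → ℝ := fun y => (W.map (fun w => y * w / (y + w) ^ 2)).sum with hV
  set U : ℝ → ℝ := fun y => (W.map (fun w => y * w * (w - y) / (y + w) ^ 3)).sum with hU
  have dN : ∀ y, 0 < y → HasDerivAt N (V y / y) y := by
    intro y hy
    have h1 := hp_sum_deriv W (fun w y => y / (y + w)) (fun w => w / (y + w) ^ 2) y (by
      intro w hw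
      have hw := hW w hw
      have := (hasDerivAt_id y).div ((hasDerivAt_id y).add_const w) (by simp; positivity)
      refine this.congr_deriv ?_
      simp)
    refine h1.congr_deriv ?_
    rw [hV, eq_div_iff hy.ne', mul_comm, ← Multiset.sum_map_mul_left]
    simp only [mul_div_assoc]
  have dV : ∀ y, 0 < y → HasDerivAt V (U y / y) y := by
    intro y hy
    have h1 := hp_sum_deriv W (fun w y => y * w / (y + w) ^ 2) (fun w => w * (w - y) / (y + w) ^ 3)
      y (by
      intro w hw
      have hw := hW w hw
      have := ((hasDerivAt_id y).mul_const w).div (((hasDerivAt_id y).add_const w).pow 2)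
        (by simp; positivity)
      refine this.congr_deriv ?_
      simp
      field_simp
      ring)
    refine h1.congr_deriv ?_
    rw [hU, eq_div_iff hy.ne', mul_comm, ← Multiset.sum_map_mul_left]
    simp only [mul_div_assoc, mul_assoc]
  have e1 : ∀ y, 0 < y → (X * derivative p).eval y = p.eval y * N y := by
    intro y hy
    have := hp_logder W y (fun w hw => by have := hW w hw; positivity)
    rw [hp]
    simp only [derivative_mul, derivative_C, zero_mul, zero_add, eval_mul, eval_X, eval_C]
    rw [mul_left_comm, this]
    ring
  have e2 : ∀ y, 0 < y → (X * derivative (X * derivative p)).eval y =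
      p.eval y * (N y ^ 2 + V y) := by
    intro y hy
    have h1 := (p.hasDerivAt y).mul (dN y hy)
    have h2 := (X * derivative p).hasDerivAt y
    have h3 : (fun y => p.eval y * N y) =ᶠ[𝓝 y] (fun y => (X * derivative p).eval y) := by
      filter_upwards [lt_mem_nhds hy] with t ht using (e1 t ht).symm
    have h4 := (h2.congr_of_eventuallyEq h3).unique h1
    rw [eval_mul, eval_X, h4]
    have h5 := e1 y hy
    rw [eval_mul, eval_X] at h5
    field_simp
    linear_combination (N y) * h5
  have e3 : ∀ y, 0 < y → (X * derivative (X * derivative (X * derivative p))).eval y =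
      p.eval y * (N y ^ 3 + 3 * N y * V y + U y) := by
    intro y hy
    have h1 := (p.hasDerivAt y).mul (((dN y hy).pow 2).add (dV y hy))
    have h2 := (X * derivative (X * derivative p)).hasDerivAt y
    have h3 : (fun y => p.eval y * (N y ^ 2 + V y)) =ᶠ[𝓝 y]
        (fun y => (X * derivative (X * derivative p)).eval y) := by
      filter_upwards [lt_mem_nhds hy] with t ht using (e2 t ht).symm
    have h4 := (h2.congr_of_eventuallyEq h3).unique h1
    rw [eval_mul, eval_X, h4]
    have h5 := e1 y hy
    rw [eval_mul, eval_X] at h5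
    simp only [Pi.add_apply, Pi.pow_apply]
    field_simp
    push_cast
    linear_combination (N y ^ 2 + V y) * h5
  refine ⟨N x, V x, U x, rfl, ?_, ?_, e1 x hx, e2 x hx, e3 x hx⟩
  · apply hp_sum_bound
    intro w hw
    have hw := hW w hw
    rw [abs_of_nonneg (by positivity), div_le_one (by positivity)]
    nlinarith
  · apply hp_sum_bound
    intro w hw
    have hw := hW w hw
    rw [abs_div, abs_of_pos (show 0 < (x + w) ^ 3 by positivity), div_le_one (by positivity),
      abs_mul, abs_of_pos (show 0 < x * w by positivity)]
    have h1 : |w - x| ≤ x + w := by rw [abs_le]; constructor <;> linarith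
    calc x * w * |w - x| ≤ (x + w) ^ 2 * (x + w) :=
          mul_le_mul (by nlinarith) h1 (abs_nonneg _) (by positivity)
      _ = _ := by ring

theorem hp_ode (n : ℕ) (β₁ β₂ : ℝ) (c : ℕ → ℝ)
    (hrec : ∀ j < n, c (j + 1) * (((j : ℝ) + 1) * (j + 1 + β₁) * (j + 1 + β₂)) =
      c j * (((n : ℝ) - j) * (n - j - β₁) * (n - j - β₂))) (p p₁ p₂ p₃ : ℝ[X])
    (hp : p = hpPoly n c) (h1 : p₁ = X * derivative p) (h2 : p₂ = X * derivative p₁)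
    (h3 : p₃ = X * derivative p₂) :
    p₃ + C (β₁ + β₂) * p₂ + C (β₁ * β₂) * p₁ =
      X * (C (n * (n - β₁) * (n - β₂)) * p -
        C ((n - β₁) * (n - β₂) + n * (n - β₂) + n * (n - β₁)) * p₁ +
        C (3 * n - β₁ - β₂) * p₂ - p₃) := by
  have cT : ∀ (q : ℝ[X]) (j : ℕ), (X * derivative q).coeff j = j * q.coeff j := by
    intro q j
    rcases j with _ | j
    · simp
    · rw [coeff_X_mul, coeff_derivative]; push_cast; ring
  ext j
  rcases j with _ | j
  · simp [h1, h2, h3]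
  · simp only [coeff_add, coeff_sub, coeff_C_mul, coeff_X_mul, h3, h2, h1, cT]
    rw [hp, hpPoly_coeff, hpPoly_coeff]
    rcases lt_trichotomy j n with h | h | h
    · rw [if_pos (by omega), if_pos (by omega)]
      have := hrec j h
      push_cast
      linear_combination this
    · subst h
      simp
      ring
    · rw [if_neg (by omega), if_neg (by omega)]; simp

theorem hp_quant_key (n V β₁ β₂ : ℝ) (hn1 : 1 ≤ n) (hb1 : |β₁| < 1) (hb2 : |β₂| < 1)
    (hV : |V| ≤ n) (M U' b : ℝ) (hM : 0 ≤ M) (hMn : M ≤ n) (hU' : |U'| ≤ n) (hb : |b| ≤ 2) :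
      |3 * M * V + U' + b * (M ^ 2 + V) + β₁ * β₂ * M| ≤ 9 * (n : ℝ) ^ 2 := by
  have hn0 : 0 < n := by linarith
  have q1 : |3 * M * V| ≤ 3 * (n : ℝ) ^ 2 := by
    rw [abs_mul, abs_of_nonneg (show 0 ≤ 3 * M by positivity)]
    nlinarith [mul_le_mul hMn hV (abs_nonneg _) hn0.le]
  have q2 : |U'| ≤ n := hU'
  have q3 : |b * (M ^ 2 + V)| ≤ 2 * ((n : ℝ) ^ 2 + n) := by
    rw [abs_mul]
    apply mul_le_mul hb ?_ (abs_nonneg _) (by norm_num)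
    calc _ ≤ |M ^ 2| + |V| := abs_add_le _ _
      _ ≤ _ := by
        rw [abs_of_nonneg (by positivity)]
        have : M ^ 2 ≤ n ^ 2 := pow_le_pow_left₀ hM hMn 2
        linarith
  have q4 : |β₁ * β₂ * M| ≤ n := by
    rw [abs_mul, abs_mul, abs_of_nonneg hM]
    have : |β₁| * |β₂| ≤ 1 := by nlinarith [abs_nonneg β₁, abs_nonneg β₂]
    calc |β₁| * |β₂| * M ≤ 1 * M := mul_le_mul_of_nonneg_right this hM
      _ ≤ n := by linarith
  have t1 := abs_add_le (3 * M * V + U' + b * (M ^ 2 + V)) (β₁ * β₂ * M)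
  have t2 := abs_add_le (3 * M * V + U') (b * (M ^ 2 + V))
  have t3 := abs_add_le (3 * M * V) U'
  have t4 : n ≤ n ^ 2 := by nlinarith
  linarith

theorem hp_quant_real (n N V U β₁ β₂ x s : ℝ) (hn1 : 1 ≤ n) (hs : 0 < s) (hx : x = s ^ 3)
    (hb1 : |β₁| < 1) (hb2 : |β₂| < 1) (hN0 : 0 ≤ N) (hNn : N ≤ n) (hV : |V| ≤ n) (hU : |U| ≤ n)
    (hid : N ^ 3 + 3 * N * V + U + (β₁ + β₂) * (N ^ 2 + V) + β₁ * β₂ * N =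
      x * ((n - N) ^ 3 + 3 * (n - N) * V - U - (β₁ + β₂) * ((n - N) ^ 2 + V) +
        β₁ * β₂ * (n - N))) :
    |1 / n * N - s / (1 + s)| ≤ ((1 + x) * 9 * (1 + s ^ 2) / s ^ 2) * (1 / n) := by
  have hn0 : 0 < n := by linarith
  have hx0 : 0 < x := by rw [hx]; positivity
  have key := hp_quant_key n V β₁ β₂ hn1 hb1 hb2 hV
  have hbb : |β₁ + β₂| ≤ 2 := by
    have := abs_add_le β₁ β₂; linarith
  have k1 := key N U (β₁ + β₂) hN0 hNn hU hbb
  have k2 := key (n - N) (-U) (-(β₁ + β₂)) (by linarith) (by linarith) (by rwa [abs_neg])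
    (by rwa [abs_neg])
  have k3 : |N ^ 3 - x * (n - N) ^ 3| ≤ (1 + x) * 9 * (n : ℝ) ^ 2 := by
    have : N ^ 3 - x * (n - N) ^ 3 =
      x * (3 * (n - N) * V + -U + -(β₁ + β₂) * ((n - N) ^ 2 + V) + β₁ * β₂ * (n - N)) -
       (3 * N * V + U + (β₁ + β₂) * (N ^ 2 + V) + β₁ * β₂ * N) := by linear_combination hid
    rw [this]
    have := abs_sub (x * (3 * (n - N) * V + -U + -(β₁ + β₂) * ((n - N) ^ 2 + V) +
      β₁ * β₂ * (n - N))) (3 * N * V + U + (β₁ + β₂) * (N ^ 2 + V) + β₁ * β₂ * N)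
    rw [abs_mul, abs_of_pos hx0] at this
    have h2 := mul_le_mul_of_nonneg_left k2 hx0.le
    linarith
  set D := N - s * (n - N) with hD
  set F := N ^ 2 + N * (s * (n - N)) + (s * (n - N)) ^ 2 with hF
  have hfac : N ^ 3 - x * (n - N) ^ 3 = D * F := by rw [hx, hD, hF]; ring
  have hFl : s ^ 2 * (n : ℝ) ^ 2 ≤ (1 + s ^ 2) * F := by
    have : 0 ≤ N * (s * (n - N)) := mul_nonneg hN0 (mul_nonneg hs.le (by linarith))
    have h' : s ^ 2 * (n : ℝ) ^ 2 ≤ (1 + s ^ 2) * (N ^ 2 + (s * (n - N)) ^ 2) := by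
      nlinarith [sq_nonneg (N - s ^ 2 * (n - N))]
    have h'' : (N ^ 2 + (s * (n - N)) ^ 2) ≤ F := by rw [hF]; linarith
    exact h'.trans (mul_le_mul_of_nonneg_left h'' (by positivity))
  have hDb : |D| ≤ (1 + x) * 9 * (1 + s ^ 2) / s ^ 2 := by
    rw [hfac, abs_mul] at k3
    rw [le_div_iff₀ (by positivity)]
    have hF0 : 0 ≤ F := by
      have : 0 ≤ N * (s * (n - N)) := mul_nonneg hN0 (mul_nonneg hs.le (by linarith))
      positivity
    rw [abs_of_nonneg hF0] at k3
    have z1 := mul_le_mul_of_nonneg_left hFl (abs_nonneg D)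
    have z2 := mul_le_mul_of_nonneg_left k3 (show 0 ≤ 1 + s ^ 2 by positivity)
    have z3 : (|D| * s ^ 2) * (n : ℝ) ^ 2 ≤ ((1 + x) * 9 * (1 + s ^ 2)) * (n : ℝ) ^ 2 := by
      linarith
    exact le_of_mul_le_mul_right z3 (by positivity)
  have hfin : 1 / (n : ℝ) * N - s / (1 + s) = D / ((1 + s) * n) := by
    rw [hD]; field_simp; ring
  rw [hfin, abs_div, abs_of_pos (show 0 < (1 + s) * (n : ℝ) by positivity), mul_one_div]
  apply div_le_div₀ (by positivity) hDb hn0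
  nlinarith

theorem hp_quant (n : ℕ) (hn : 0 < n) (β₁ β₂ : ℝ) (hb1 : |β₁| < 1) (hb2 : |β₂| < 1) (c : ℕ → ℝ)
    (hrec : ∀ j < n, c (j + 1) * (((j : ℝ) + 1) * (j + 1 + β₁) * (j + 1 + β₂)) =
      c j * (((n : ℝ) - j) * (n - j - β₁) * (n - j - β₂))) (hcn : c n ≠ 0)
    (W : Multiset ℝ) (hWn : Multiset.card W = n) (hW : ∀ w ∈ W, 0 < w)
    (hp : hpPoly n c = C (c n) * (W.map (fun w => X + C w)).prod) (s : ℝ) (hs : 0 < s) :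
    |(1 / (n : ℝ)) * (W.map (fun w => s ^ 3 / (s ^ 3 + w))).sum - s / (1 + s)| ≤
      ((1 + s ^ 3) * 9 * (1 + s ^ 2) / s ^ 2) * (1 / (n : ℝ)) := by
  set x := s ^ 3 with hx
  have hx0 : 0 < x := by positivity
  obtain ⟨N, V, U, hN, hV, hU, e1, e2, e3⟩ := hp_moments W hW _ _ hp x hx0
  obtain ⟨p, hpp⟩ : ∃ q, q = hpPoly n c := ⟨_, rfl⟩
  rw [← hpp] at e1 e2 e3 hp
  obtain ⟨p₁, hp1⟩ : ∃ q, q = X * derivative p := ⟨_, rfl⟩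
  rw [← hp1] at e1 e2 e3
  obtain ⟨p₂, hp2⟩ : ∃ q, q = X * derivative p₁ := ⟨_, rfl⟩
  rw [← hp2] at e2 e3
  obtain ⟨p₃, hp3⟩ : ∃ q, q = X * derivative p₂ := ⟨_, rfl⟩
  rw [← hp3] at e3
  have hode := congrArg (eval x) (hp_ode n β₁ β₂ c hrec p p₁ p₂ p₃ hpp hp1 hp2 hp3)
  have hpx : p.eval x ≠ 0 := by
    rw [hp, eval_mul, eval_C, eval_multiset_prod]
    apply mul_ne_zero hcn
    apply Multiset.prod_ne_zero
    intro h0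
    simp only [Multiset.map_map, Multiset.mem_map, Function.comp] at h0
    obtain ⟨w, hw, h0⟩ := h0
    have := hW w hw
    simp at h0
    linarith
  have hid : N ^ 3 + 3 * N * V + U + (β₁ + β₂) * (N ^ 2 + V) + β₁ * β₂ * N =
      x * ((n - N) ^ 3 + 3 * (n - N) * V - U - (β₁ + β₂) * ((n - N) ^ 2 + V) +
        β₁ * β₂ * (n - N)) := by
    simp only [eval_add, eval_sub, eval_mul, eval_C, eval_X, e1, e2, e3] at hode
    apply mul_left_cancel₀ hpx
    linear_combination hode
  rw [hWn] at hV hU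
  have hn0 : (0 : ℝ) < n := by exact_mod_cast hn
  have hn1 : (1 : ℝ) ≤ n := by exact_mod_cast hn
  have hN0 : 0 ≤ N := by
    rw [hN]; apply hp_sum_nonneg; intro w hw; have := hW w hw; positivity
  have hNn : N ≤ n := by
    have := hp_sum_bound W (fun w => x / (x + w)) (by
      intro w hw; have := hW w hw
      rw [abs_of_pos (by positivity), div_le_one (by positivity)]; linarith)
    rw [← hN, hWn] at this
    exact (abs_le.1 this).2
  rw [← hN]
  exact hp_quant_real n N V U β₁ β₂ x s hn1 hs hx hb1 hb2 hN0 hNn hV hU hid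


noncomputable def hpRho (v : ℝ) : ℝ := 3 * Real.sqrt 3 / (2 * Real.pi) * (1 / (1 + v + v ^ 2))

theorem hp_arctan_lim (a b : ℝ) (ha : 0 < a) :
    Tendsto (fun v : ℝ => Real.arctan (a * v + b)) atTop (𝓝 (Real.pi / 2)) := by
  have h1 : Tendsto (fun v : ℝ => a * v + b) atTop atTop :=
    tendsto_atTop_add_const_right _ _ (tendsto_id.const_mul_atTop ha)
  exact (Real.tendsto_arctan_atTop.mono_right nhdsWithin_le_nhds).comp h1

theorem hp_arctan_val : Real.arctan (1 / Real.sqrt 3) = Real.pi / 6 := by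
  rw [← Real.tan_pi_div_six]
  apply Real.arctan_tan <;> linarith [Real.pi_pos]

theorem hp_arctan_deriv (a b v : ℝ) :
    HasDerivAt (fun v : ℝ => Real.arctan (a * v + b)) (1 / (1 + (a * v + b) ^ 2) * a) v := by
  have h1 : HasDerivAt (fun v : ℝ => a * v + b) a v := by
    simpa using ((hasDerivAt_id v).const_mul a).add_const b
  exact h1.arctan

theorem hp_rho_nonneg (v : ℝ) : 0 ≤ hpRho v := by
  have : 0 < 1 + v + v ^ 2 := by nlinarith [sq_nonneg (v + 1)]
  unfold hpRho
  have := Real.pi_pos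
  positivity

theorem hp_rho_int : IntegrableOn hpRho (Set.Ioi 0) ∧ ∫ v in Set.Ioi 0, hpRho v = 1 := by
  set r := Real.sqrt 3 with hr
  have r0 : 0 < r := by rw [hr]; positivity
  have r2 : r ^ 2 = 3 := Real.sq_sqrt (by norm_num)
  have hpi := Real.pi_pos
  have hd : ∀ v ∈ Set.Ici (0 : ℝ), HasDerivAt
      (fun v => 3 / Real.pi * Real.arctan (2 / r * v + 1 / r)) (hpRho v) v := by
    intro v hv
    refine ((hp_arctan_deriv _ _ v).const_mul _).congr_deriv ?_
    have : 0 < 1 + v + v ^ 2 := by nlinarith [sq_nonneg (v + 1)]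
    have e : 1 + (2 / r * v + 1 / r) ^ 2 = 4 / 3 * (1 + v + v ^ 2) := by
      field_simp; rw [r2]; ring
    rw [e, hpRho, ← hr]
    field_simp
    rw [r2]; ring
  have hl : Tendsto (fun v => 3 / Real.pi * Real.arctan (2 / r * v + 1 / r)) atTop
      (𝓝 (3 / Real.pi * (Real.pi / 2))) :=
    (hp_arctan_lim _ _ (by positivity)).const_mul _
  have hi := integrableOn_Ioi_deriv_of_nonneg' hd (fun v _ => hp_rho_nonneg v) hl
  refine ⟨hi, ?_⟩
  rw [integral_Ioi_of_hasDerivAt_of_tendsto' hd hi hl]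
  rw [mul_zero, zero_add, hp_arctan_val]
  field_simp
  norm_num

theorem hp_stieltjes (s : ℝ) (hs : 0 < s) :
    ∫ v in Set.Ioi 0, s ^ 3 / (s ^ 3 + v ^ 3) * hpRho v = s / (1 + s) := by
  set r := Real.sqrt 3 with hr
  have r0 : 0 < r := by rw [hr]; positivity
  have r2 : r ^ 2 = 3 := Real.sq_sqrt (by norm_num)
  have hpi := Real.pi_pos
  set k := 3 * (1 + s ^ 3) with hk
  have k0 : 0 < k := by positivity
  set Φ : ℝ → ℝ := fun v => 3 * r / (2 * Real.pi) *
    ((s * (1 + s) / k * (Real.log (v + s) - Real.log (v ^ 2 - s * v + s ^ 2) / 2) +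
      r * s * (1 - s) / k * Real.arctan (2 / (r * s) * v + (-1 / r))) +
      2 * r * s ^ 3 / k * Real.arctan (2 / r * v + 1 / r)) with hΦ
  have hq : ∀ v, 0 < v ^ 2 - s * v + s ^ 2 := by
    intro v; nlinarith [sq_nonneg (v - s / 2)]
  have hd : ∀ v ∈ Set.Ici (0 : ℝ), HasDerivAt Φ (s ^ 3 / (s ^ 3 + v ^ 3) * hpRho v) v := by
    intro v hv
    have hv : 0 ≤ v := hv
    have d1 : HasDerivAt (fun v => Real.log (v + s)) (1 / (v + s)) v :=
      ((hasDerivAt_id v).add_const s).log (by simp; positivity)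
    have d2 : HasDerivAt (fun v => Real.log (v ^ 2 - s * v + s ^ 2))
        ((2 * v - s) / (v ^ 2 - s * v + s ^ 2)) v := by
      have : HasDerivAt (fun v : ℝ => v ^ 2 - s * v + s ^ 2) (2 * v - s) v := by
        have := (((hasDerivAt_id v).pow 2).sub ((hasDerivAt_id v).const_mul s)).add_const (s ^ 2)
        refine this.congr_deriv (by simp)
      exact this.log (hq v).ne'
    have := (((((d1.sub (d2.div_const 2)).const_mul (s * (1 + s) / k)).add
      ((hp_arctan_deriv (2 / (r * s)) (-1 / r) v).const_mul (r * s * (1 - s) / k))).add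
      ((hp_arctan_deriv (2 / r) (1 / r) v).const_mul (2 * r * s ^ 3 / k))).const_mul
      (3 * r / (2 * Real.pi)))
    refine this.congr_deriv ?_
    have e1 : 1 + (2 / r * v + 1 / r) ^ 2 = 4 / 3 * (1 + v + v ^ 2) := by
      field_simp; rw [r2]; ring
    have e2 : 1 + (2 / (r * s) * v + (-1 / r)) ^ 2 = 4 / (3 * s ^ 2) * (v ^ 2 - s * v + s ^ 2) := by
      field_simp; rw [r2]; ring
    have e3 : s ^ 3 + v ^ 3 = (v + s) * (v ^ 2 - s * v + s ^ 2) := by ring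
    have e4 : r * s * (1 - s) / k * (1 / (4 / (3 * s ^ 2) * (v ^ 2 - s * v + s ^ 2)) *
        (2 / (r * s))) = 3 * s ^ 2 * (1 - s) / (2 * k) * (1 / (v ^ 2 - s * v + s ^ 2)) := by
      have := hq v
      field_simp
      ring
    have p3 : 0 < 1 + v + v ^ 2 := by nlinarith [sq_nonneg (v + 1)]
    have e5 : 2 * r * s ^ 3 / k * (1 / (4 / 3 * (1 + v + v ^ 2)) * (2 / r)) =
        3 * s ^ 3 / k * (1 / (1 + v + v ^ 2)) := by
      field_simp
      ring
    rw [e1, e2, e3, hpRho, ← hr, e4, e5]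
    have p1 : 0 < v + s := by positivity
    have p2 := hq v
    rw [mul_left_comm (s ^ 3 / ((v + s) * (v ^ 2 - s * v + s ^ 2)))]
    congr 1
    generalize hqq : v ^ 2 - s * v + s ^ 2 = q at *
    generalize hpp : 1 + v + v ^ 2 = pp at *
    rw [hk]
    field_simp
    rw [← hqq, ← hpp]
    ring
  have hl : Tendsto Φ atTop (𝓝 (3 * r / (2 * Real.pi) *
      ((s * (1 + s) / k * 0 + r * s * (1 - s) / k * (Real.pi / 2)) +
      2 * r * s ^ 3 / k * (Real.pi / 2)))) := by
    refine (((Tendsto.const_mul _ ?_).add ((hp_arctan_lim _ _ (by positivity)).const_mul _)).add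
      ((hp_arctan_lim _ _ (by positivity)).const_mul _)).const_mul _
    have t0 : Tendsto (fun v : ℝ => v + s) atTop atTop :=
      tendsto_atTop_add_const_right _ _ tendsto_id
    have t1 : Tendsto (fun v : ℝ => 1 - 3 * (s / (v + s)) + 3 * (s / (v + s)) ^ 2) atTop
        (𝓝 (1 - 3 * 0 + 3 * 0 ^ 2)) := by
      have := t0.const_div_atTop s
      exact ((this.const_mul 3).const_sub 1).add ((this.pow 2).const_mul 3)
    have t2 : Tendsto (fun v : ℝ => -(1 / 2) * Real.log (1 - 3 * (s / (v + s)) +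
        3 * (s / (v + s)) ^ 2)) atTop (𝓝 (-(1 / 2) * Real.log (1 - 3 * 0 + 3 * 0 ^ 2))) :=
      (t1.log (by norm_num)).const_mul _
    have t3 : -(1 / 2) * Real.log (1 - 3 * 0 + 3 * 0 ^ 2) = 0 := by norm_num
    rw [t3] at t2
    refine t2.congr' ?_
    filter_upwards [eventually_gt_atTop 0] with v hv
    have p1 : 0 < v + s := by positivity
    have : 1 - 3 * (s / (v + s)) + 3 * (s / (v + s)) ^ 2 =
        (v ^ 2 - s * v + s ^ 2) / (v + s) ^ 2 := by
      field_simp; ring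
    rw [this, Real.log_div (hq v).ne' (by positivity), Real.log_pow]
    push_cast
    ring
  have hi := integrableOn_Ioi_deriv_of_nonneg' hd (fun v hv => by
    have hv : 0 < v := hv
    have := hp_rho_nonneg v
    positivity) hl
  rw [integral_Ioi_of_hasDerivAt_of_tendsto' hd hi hl]
  have f1 : Φ 0 = 3 * r / (2 * Real.pi) *
      ((s * (1 + s) / k * 0 + r * s * (1 - s) / k * (-(Real.pi / 6))) +
      2 * r * s ^ 3 / k * (Real.pi / 6)) := by
    simp only [hΦ]
    have : Real.log (0 + s) - Real.log (0 ^ 2 - s * 0 + s ^ 2) / 2 = 0 := by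
      simp [Real.log_pow]
    have hval : Real.arctan (1 / r) = Real.pi / 6 := hp_arctan_val
    rw [this]
    simp only [mul_zero, zero_add, neg_div, Real.arctan_neg, hval]
  rw [f1, hk]
  field_simp
  linear_combination (8 * Real.pi * (1 + s ^ 3)) * r2


noncomputable def hpI (u : ℝ) : Set.Icc (0 : ℝ) 1 := Set.projIcc 0 1 zero_le_one u

theorem hpI_val (w : ℝ) (hw : 0 ≤ w) : ((hpI (1 / (1 + w)) : Set.Icc (0 : ℝ) 1) : ℝ) = 1 / (1 + w) := by
  unfold hpI
  rw [Set.projIcc_of_mem]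
  constructor
  · positivity
  · rw [div_le_one (by positivity)]; linarith

noncomputable def hpGen (t : ℝ) : C(Set.Icc (0 : ℝ) 1, ℝ) where
  toFun u := 1 / (1 + |t| * u)
  continuous_toFun := by
    apply Continuous.div continuous_const (by fun_prop)
    intro u
    have := u.2.1
    positivity

noncomputable def hpU : C(Set.Icc (0 : ℝ) 1, ℝ) := ⟨fun u => u, continuous_subtype_val⟩

theorem hp_dense :
    (Submodule.span ℝ (Set.range hpGen)).topologicalClosure = ⊤ := by
  set S := Submodule.span ℝ (Set.range hpGen) with hS
  set T := S.topologicalClosure with hT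
  have hST : S ≤ T := Submodule.le_topologicalClosure _
  have hTc : IsClosed (T : Set C(Set.Icc (0 : ℝ) 1, ℝ)) := Submodule.isClosed_topologicalClosure _
  have hgen : ∀ t, hpGen t ∈ T := fun t => hST (Submodule.subset_span ⟨t, rfl⟩)
  have hone : (1 : C(Set.Icc (0 : ℝ) 1, ℝ)) ∈ T := by
    have : hpGen 0 = 1 := by ext u; simp [hpGen]
    rw [← this]; exact hgen 0
  have hmul : ∀ t, 0 < t → hpU * hpGen t ∈ T := by
    intro t ht
    have : hpU * hpGen t = t⁻¹ • ((1 : C(Set.Icc (0 : ℝ) 1, ℝ)) - hpGen t) := by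
      ext u
      have := u.2.1
      have h2 : 0 < 1 + t * (u : ℝ) := by positivity
      simp [hpGen, hpU, abs_of_pos ht]
      field_simp
      ring
    rw [this]
    exact T.smul_mem _ (T.sub_mem hone (hgen t))
  have hU : hpU ∈ T := by
    have hlim : Tendsto (fun t : ℝ => hpU * hpGen t) (𝓝[>] 0) (𝓝 hpU) := by
      rw [tendsto_iff_norm_sub_tendsto_zero]
      have h0 : Tendsto (fun t : ℝ => t) (𝓝[>] 0) (𝓝 0) := tendsto_id.mono_left nhdsWithin_le_nhds
      refine squeeze_zero' (Eventually.of_forall fun t => norm_nonneg _) ?_ h0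
      filter_upwards [self_mem_nhdsWithin] with t ht
      have ht : 0 < t := ht
      rw [ContinuousMap.norm_le _ ht.le]
      intro u
      have u0 := u.2.1
      have u1 := u.2.2
      have h2 : 0 < 1 + t * (u : ℝ) := by positivity
      have e : (hpU * hpGen t - hpU) u = -(t * (u : ℝ) ^ 2 / (1 + t * u)) := by
        simp [hpGen, hpU, abs_of_pos ht]
        field_simp
        ring
      rw [e, norm_neg, Real.norm_of_nonneg (by positivity), div_le_iff₀ h2]
      have : (u : ℝ) ^ 2 ≤ 1 := by nlinarith
      have h3 : 0 ≤ t * (t * (u : ℝ)) := by positivity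
      nlinarith
    refine hTc.mem_of_tendsto hlim ?_
    filter_upwards [self_mem_nhdsWithin] with t ht using hmul t ht
  have hstab : ∀ x ∈ T, hpU * x ∈ T := by
    have : T ≤ T.comap (LinearMap.mulLeft ℝ hpU) := by
      apply Submodule.topologicalClosure_minimal
      · rw [hS, Submodule.span_le]
        rintro _ ⟨t, rfl⟩
        simp only [SetLike.mem_coe, Submodule.mem_comap, LinearMap.mulLeft_apply]
        rcases eq_or_ne t 0 with h | h
        · have : hpGen t = 1 := by ext u; simp [hpGen, h]
          rw [this, mul_one]; exact hU
        · have : hpGen t = hpGen |t| := by ext u; simp [hpGen]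
          rw [this]; exact hmul _ (abs_pos.2 h)
      · exact hTc.preimage (continuous_const.mul continuous_id)
    intro x hx
    exact this hx
  have hpoly : ∀ p : ℝ[X], p.toContinuousMapOn (Set.Icc (0 : ℝ) 1) ∈ T := by
    intro p
    induction p using Polynomial.induction_on with
    | C a =>
      have : (C a : ℝ[X]).toContinuousMapOn (Set.Icc (0 : ℝ) 1) = a • 1 := by ext u; simp
      rw [this]; exact T.smul_mem _ hone
    | add p q hp hq =>
      have : (p + q).toContinuousMapOn (Set.Icc (0 : ℝ) 1) =
        p.toContinuousMapOn _ + q.toContinuousMapOn _ := by ext u; simp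
      rw [this]; exact T.add_mem hp hq
    | monomial n a h =>
      have : (C a * X ^ (n + 1) : ℝ[X]).toContinuousMapOn (Set.Icc (0 : ℝ) 1) =
        hpU * (C a * X ^ n : ℝ[X]).toContinuousMapOn (Set.Icc (0 : ℝ) 1) := by
        ext u; simp [hpU]; ring
      rw [this]; exact hstab _ h
  rw [eq_top_iff]
  intro x _
  have hx : x ∈ (polynomialFunctions (Set.Icc (0 : ℝ) 1)).topologicalClosure := by
    rw [polynomialFunctions_closure_eq_top]; trivial
  have hsub : ((polynomialFunctions (Set.Icc (0 : ℝ) 1) : Set C(Set.Icc (0 : ℝ) 1, ℝ))) ⊆ T := by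
    intro y hy
    rw [polynomialFunctions_coe] at hy
    obtain ⟨p, rfl⟩ := hy
    exact hpoly p
  exact closure_minimal hsub hTc hx

noncomputable def hpL (W : Multiset ℝ) (n : ℕ) (h : C(Set.Icc (0 : ℝ) 1, ℝ)) : ℝ :=
  (1 / (n : ℝ)) * (W.map (fun w => h (hpI (1 / (1 + w))))).sum

noncomputable def hpLam (h : C(Set.Icc (0 : ℝ) 1, ℝ)) : ℝ :=
  ∫ v in Set.Ioi 0, h (hpI (1 / (1 + v ^ 3))) * hpRho v

theorem hpLam_integrable (h : C(Set.Icc (0 : ℝ) 1, ℝ)) :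
    IntegrableOn (fun v => h (hpI (1 / (1 + v ^ 3))) * hpRho v) (Set.Ioi 0) := by
  refine Integrable.bdd_mul (c := ‖h‖) hp_rho_int.1 ?_ ?_
  · apply ContinuousOn.aestronglyMeasurable _ measurableSet_Ioi
    apply h.continuous.comp_continuousOn
    apply continuous_projIcc.comp_continuousOn
    apply ContinuousOn.div continuousOn_const (by fun_prop)
    intro v hv
    have hv : 0 < v := hv
    positivity
  · exact Eventually.of_forall fun v => h.norm_coe_le_norm _

theorem hpLam_bound (h : C(Set.Icc (0 : ℝ) 1, ℝ)) : |hpLam h| ≤ ‖h‖ := by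
  have h1 := norm_integral_le_of_norm_le (μ := volume.restrict (Set.Ioi 0))
    (f := fun v => h (hpI (1 / (1 + v ^ 3))) * hpRho v)
    (g := fun v => ‖h‖ * hpRho v) (hp_rho_int.1.const_mul _) (Eventually.of_forall fun v => by
      rw [norm_mul, Real.norm_of_nonneg (hp_rho_nonneg v)]
      exact mul_le_mul_of_nonneg_right (h.norm_coe_le_norm _) (hp_rho_nonneg v))
  rw [integral_const_mul, hp_rho_int.2, mul_one] at h1
  exact h1

theorem hpLam_add (g h : C(Set.Icc (0 : ℝ) 1, ℝ)) : hpLam (g + h) = hpLam g + hpLam h := by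
  unfold hpLam
  rw [← integral_add (hpLam_integrable g) (hpLam_integrable h)]
  simp only [ContinuousMap.add_apply, add_mul]

theorem hpLam_smul (a : ℝ) (h : C(Set.Icc (0 : ℝ) 1, ℝ)) : hpLam (a • h) = a * hpLam h := by
  unfold hpLam
  rw [← integral_const_mul]
  simp only [ContinuousMap.smul_apply, smul_eq_mul, mul_assoc]

theorem hpL_add (W : Multiset ℝ) (n : ℕ) (g h : C(Set.Icc (0 : ℝ) 1, ℝ)) :
    hpL W n (g + h) = hpL W n g + hpL W n h := by
  unfold hpL
  rw [← mul_add, ← Multiset.sum_map_add]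
  rfl

theorem hpL_smul (W : Multiset ℝ) (n : ℕ) (a : ℝ) (h : C(Set.Icc (0 : ℝ) 1, ℝ)) :
    hpL W n (a • h) = a * hpL W n h := by
  unfold hpL
  rw [mul_left_comm]
  congr 1
  rw [← Multiset.sum_map_mul_left]
  rfl

theorem hpL_bound (W : Multiset ℝ) (n : ℕ) (hW : Multiset.card W = n)
    (h : C(Set.Icc (0 : ℝ) 1, ℝ)) : |hpL W n h| ≤ ‖h‖ := by
  unfold hpL
  have h1 : ∀ W : Multiset ℝ, |(W.map (fun w => h (hpI (1 / (1 + w))))).sum| ≤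
      Multiset.card W * ‖h‖ := by
    intro W
    induction W using Multiset.induction_on with
    | empty => simp
    | cons a W ih =>
      simp only [Multiset.map_cons, Multiset.sum_cons, Multiset.card_cons]
      have h2 := h.norm_coe_le_norm (hpI (1 / (1 + a)))
      rw [Real.norm_eq_abs] at h2
      push_cast
      have := abs_add_le (h (hpI (1 / (1 + a)))) (W.map (fun w => h (hpI (1 / (1 + w))))).sum
      linarith
  rcases Nat.eq_zero_or_pos n with h0 | h0
  · subst h0; simp
  · have hn : (0 : ℝ) < n := by exact_mod_cast h0
    rw [abs_mul, abs_of_pos (by positivity)]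
    have := h1 W
    rw [hW] at this
    rw [one_div, inv_mul_le_iff₀ hn]
    exact this

theorem hp_weak (W : ℕ → Multiset ℝ) (hc : ∀ n, Multiset.card (W n) = n)
    (hpos : ∀ n, ∀ w ∈ W n, 0 < w)
    (hS : ∀ s : ℝ, 0 < s → Tendsto
      (fun n : ℕ => (1 / (n : ℝ)) * ((W n).map (fun w => s ^ 3 / (s ^ 3 + w))).sum) atTop
      (𝓝 (s / (1 + s)))) (h : C(Set.Icc (0 : ℝ) 1, ℝ)) :
    Tendsto (fun n => hpL (W n) n h) atTop (𝓝 (hpLam h)) := by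
  have hgen : ∀ t, Tendsto (fun n => hpL (W n) n (hpGen t)) atTop (𝓝 (hpLam (hpGen t))) := by
    intro t
    obtain ⟨s, hs, hst⟩ : ∃ s : ℝ, 0 < s ∧ s ^ 3 = 1 + |t| := by
      refine ⟨(1 + |t|) ^ ((1 : ℝ) / 3), by positivity, ?_⟩
      rw [← Real.rpow_natCast, ← Real.rpow_mul (by positivity)]
      norm_num
    have hs3 : 0 < s ^ 3 := by positivity
    have key : ∀ w : ℝ, 0 < w → hpGen t (hpI (1 / (1 + w))) =
        1 - (|t| / s ^ 3) * (s ^ 3 / (s ^ 3 + w)) := by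
      intro w hw
      simp only [hpGen, ContinuousMap.coe_mk]
      rw [hpI_val w hw.le]
      have : 0 < 1 + w + |t| := by positivity
      have h' : 0 < s ^ 3 + w := by positivity
      have e : 1 + |t| * (1 / (1 + w)) = (s ^ 3 + w) / (1 + w) := by
        rw [hst]; field_simp; ring
      rw [e]
      field_simp
      rw [hst]; ring
    have hLam : hpLam (hpGen t) = 1 - (|t| / s ^ 3) * (s / (1 + s)) := by
      have e1 : hpLam (hpGen t) = ∫ v in Set.Ioi 0, (hpRho v -
          (|t| / s ^ 3) * (s ^ 3 / (s ^ 3 + v ^ 3) * hpRho v)) := by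
        unfold hpLam
        apply setIntegral_congr_fun measurableSet_Ioi
        intro v hv
        have hv : 0 < v := hv
        simp only
        rw [key _ (by positivity)]
        ring
      have hi : IntegrableOn (fun v => s ^ 3 / (s ^ 3 + v ^ 3) * hpRho v) (Set.Ioi 0) := by
        refine Integrable.bdd_mul (c := 1) hp_rho_int.1 ?_ ?_
        · apply ContinuousOn.aestronglyMeasurable _ measurableSet_Ioi
          apply ContinuousOn.div continuousOn_const (by fun_prop)
          intro v hv
          have hv : 0 < v := hv
          positivity
        · filter_upwards [ae_restrict_mem measurableSet_Ioi] with v hv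
          have hv : 0 < v := hv
          have : 0 < v ^ 3 := by positivity
          rw [Real.norm_of_nonneg (by positivity), div_le_one (by positivity)]
          linarith
      rw [e1, integral_sub hp_rho_int.1 (hi.const_mul _), integral_const_mul, hp_rho_int.2,
        hp_stieltjes s hs]
    rw [hLam]
    refine (((hS s hs).const_mul (|t| / s ^ 3)).const_sub 1).congr' ?_
    filter_upwards [eventually_gt_atTop 0] with n hn
    have hn0 : (n : ℝ) ≠ 0 := by positivity
    unfold hpL
    have : (W n).map (fun w => hpGen t (hpI (1 / (1 + w)))) =
        (W n).map (fun w => 1 - (|t| / s ^ 3) * (s ^ 3 / (s ^ 3 + w))) :=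
      Multiset.map_congr rfl (fun w hw => key w (hpos n w hw))
    rw [this, Multiset.sum_map_sub, Multiset.sum_map_mul_left]
    simp only [Multiset.map_const', Multiset.sum_replicate, hc, nsmul_eq_mul, mul_one]
    field_simp
  have hspan : ∀ g ∈ Submodule.span ℝ (Set.range hpGen),
      Tendsto (fun n => hpL (W n) n g) atTop (𝓝 (hpLam g)) := by
    intro g hg
    induction hg using Submodule.span_induction with
    | mem x hx => obtain ⟨t, rfl⟩ := hx; exact hgen t
    | zero =>
      have e1 : ∀ n, hpL (W n) n 0 = 0 := fun n => by simp [hpL]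
      have e2 : hpLam 0 = 0 := by simp [hpLam]
      simp only [e1, e2]; exact tendsto_const_nhds
    | add x y _ _ hx hy =>
      simp only [hpL_add, hpLam_add]; exact hx.add hy
    | smul a x _ hx =>
      simp only [hpL_smul, hpLam_smul]; exact hx.const_mul a
  rw [Metric.tendsto_atTop]
  intro ε hε
  have hmem : h ∈ (Submodule.span ℝ (Set.range hpGen)).topologicalClosure := by
    rw [hp_dense]; trivial
  obtain ⟨g, hg, hgd⟩ := Metric.mem_closure_iff.1 hmem (ε / 3) (by positivity)
  rw [dist_eq_norm] at hgd
  obtain ⟨N, hN⟩ := Metric.tendsto_atTop.1 (hspan g hg) (ε / 3) (by positivity)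
  refine ⟨N, fun n hn => ?_⟩
  have h1 := hN n hn
  have hdec : h = (h - g) + g := by abel
  have h2 := hpL_bound (W n) n (hc n) (h - g)
  have h3 := hpLam_bound (h - g)
  rw [Real.dist_eq] at *
  rw [hdec, hpL_add, hpLam_add]
  rw [abs_lt] at *
  rw [abs_le] at *
  constructor <;> linarith [h1.1, h1.2, h2.1, h2.2, h3.1, h3.2]

theorem hp_test (φ : ℝ → ℝ) (hφ : Continuous φ) (hs : HasCompactSupport φ) :
    Continuous (fun t : ℝ => if t = 0 then 0 else φ (1 / t)) := by
  rw [continuous_iff_continuousAt]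
  intro t
  rcases eq_or_ne t 0 with h | h
  · subst h
    have h1 : (fun t : ℝ => if t = 0 then 0 else φ (1 / t)) =ᶠ[𝓝 0] fun _ => 0 := by
      have h2 : ∀ᶠ x in cocompact ℝ, φ x = 0 := by
        have := hs.isCompact.compl_mem_cocompact
        filter_upwards [this] with x hx
        exact image_eq_zero_of_notMem_tsupport hx
      rw [Metric.cobounded_eq_cocompact.symm] at h2
      have h3 := tendsto_inv₀_nhdsNE_zero (α := ℝ) |>.eventually h2
      rw [eventually_nhdsWithin_iff] at h3
      filter_upwards [h3] with x hx
      by_cases h0 : x = 0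
      · simp [h0]
      · simp only [h0, if_false, one_div]; exact hx h0
    exact (continuousAt_const.congr h1.symm)
  · have h1 : (fun t : ℝ => if t = 0 then 0 else φ (1 / t)) =ᶠ[𝓝 t] fun t => φ (1 / t) := by
      filter_upwards [isOpen_ne.mem_nhds h] with x hx
      simp [show x ≠ 0 from hx]
    refine ContinuousAt.congr ?_ h1.symm
    exact hφ.continuousAt.comp (continuousAt_const.div continuousAt_id h)


theorem hp_cube (a : ℝ) (ha : 0 < a) : (a ^ 3) ^ (-(1 / 3) : ℝ) = a⁻¹ := by
  rw [← Real.rpow_natCast, ← Real.rpow_mul ha.le]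
  norm_num
  rw [Real.rpow_neg_one]

theorem hp_jac_alg (v a b k : ℝ) (hv : 0 < v) (ha : 0 < a) (hb : 0 < b) (hb2 : b ^ 3 = 2) :
    k * (((b ^ 2 * v * a ^ 2) ^ 3) ^ (-(1 / 3) : ℝ)) *
      ((((b * v * a) ^ 3) ^ (-(1 / 3) : ℝ)) - (((b * a) ^ 3) ^ (-(1 / 3) : ℝ))) =
      k * ((1 - v) / (2 * v ^ 2 * a ^ 3)) := by
  rw [hp_cube _ (by positivity), hp_cube _ (by positivity), hp_cube _ (by positivity), ← hb2]
  field_simp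

theorem hp_jac (v : ℝ) (hv : 0 < v) (h1 : v ≠ 1) :
    |6 * v ^ 2 / (1 - v ^ 3) ^ 2| * nuDensity ((1 + v ^ 3) / (1 - v ^ 3)) = hpRho v := by
  have hq : 0 < 1 + v + v ^ 2 := by positivity
  have hfac : 1 - v ^ 3 = (1 - v) * (1 + v + v ^ 2) := by ring
  have hne : 1 - v ^ 3 ≠ 0 := by
    rw [hfac]; exact mul_ne_zero (sub_ne_zero.2 h1.symm) hq.ne'
  obtain ⟨b, hb, hb2⟩ : ∃ b : ℝ, 0 < b ∧ b ^ 3 = 2 := by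
    refine ⟨2 ^ ((1 : ℝ) / 3), by positivity, ?_⟩
    rw [← Real.rpow_natCast, ← Real.rpow_mul (by positivity)]; norm_num
  obtain ⟨a, ha, ha2⟩ : ∃ a : ℝ, 0 < a ∧ a ^ 3 = 1 / |1 - v ^ 3| := by
    have : 0 < |1 - v ^ 3| := abs_pos.2 hne
    refine ⟨(1 / |1 - v ^ 3|) ^ ((1 : ℝ) / 3), by positivity, ?_⟩
    rw [← Real.rpow_natCast, ← Real.rpow_mul (by positivity)]; norm_num
  have hpi := Real.pi_pos
  have hx2 : ((1 + v ^ 3) / (1 - v ^ 3)) ^ 2 - 1 = (b ^ 2 * v * a ^ 2) ^ 3 := by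
    have : (b ^ 2 * v * a ^ 2) ^ 3 = (b ^ 3) ^ 2 * v ^ 3 * (a ^ 3) ^ 2 := by ring
    rw [this, hb2, ha2, div_pow 1, sq_abs]
    field_simp
    ring
  have habs : |(1 + v ^ 3) / (1 - v ^ 3)| = (1 + v ^ 3) / |1 - v ^ 3| := by
    rw [abs_div, abs_of_pos (by positivity)]
  have hjabs : |6 * v ^ 2 / (1 - v ^ 3) ^ 2| = 6 * v ^ 2 * (a ^ 3) ^ 2 := by
    rw [abs_of_nonneg (by positivity), ha2, div_pow 1, sq_abs]; ring
  unfold nuDensity hpRho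
  rw [hx2, habs, hjabs]
  rcases lt_or_gt_of_ne h1 with h | h
  · have hpos : 0 < 1 - v ^ 3 := by rw [hfac]; exact mul_pos (by linarith) hq
    rw [abs_of_pos hpos] at ha2 ⊢
    have e1 : (1 + v ^ 3) / (1 - v ^ 3) - 1 = (b * v * a) ^ 3 := by
      have : (b * v * a) ^ 3 = b ^ 3 * v ^ 3 * a ^ 3 := by ring
      rw [this, hb2, ha2]; field_simp; ring
    have e2 : (1 + v ^ 3) / (1 - v ^ 3) + 1 = (b * a) ^ 3 := by
      have : (b * a) ^ 3 = b ^ 3 * a ^ 3 := by ring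
      rw [this, hb2, ha2]; field_simp; ring
    rw [e1, e2, hp_jac_alg v a b _ hv ha hb hb2, ha2, hfac]
    have : 0 < 1 - v := by linarith
    field_simp; norm_num
  · have hpos : 0 < v ^ 3 - 1 := by
      have : v ^ 3 - 1 = (v - 1) * (1 + v + v ^ 2) := by ring
      rw [this]; exact mul_pos (by linarith) hq
    rw [abs_of_neg (by linarith)] at ha2 ⊢
    have hne' : -(1 - v ^ 3) ≠ 0 := by linarith
    have e1 : (1 + v ^ 3) / -(1 - v ^ 3) - 1 = (b * a) ^ 3 := by
      have : (b * a) ^ 3 = b ^ 3 * a ^ 3 := by ring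
      rw [this, hb2, ha2]; field_simp; ring
    have e2 : (1 + v ^ 3) / -(1 - v ^ 3) + 1 = (b * v * a) ^ 3 := by
      have : (b * v * a) ^ 3 = b ^ 3 * v ^ 3 * a ^ 3 := by ring
      rw [this, hb2, ha2]; field_simp; ring
    have e3 := hp_jac_alg v a b (Real.sqrt 3 / (2 * Real.pi)) hv ha hb hb2
    have e4 : Real.sqrt 3 / (2 * Real.pi) * (((b ^ 2 * v * a ^ 2) ^ 3) ^ (-(1 / 3) : ℝ)) *
      ((((b * a) ^ 3) ^ (-(1 / 3) : ℝ)) - (((b * v * a) ^ 3) ^ (-(1 / 3) : ℝ))) =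
      - (Real.sqrt 3 / (2 * Real.pi) * ((1 - v) / (2 * v ^ 2 * a ^ 3))) := by
      rw [← e3]; ring
    rw [e1, e2, e4, ha2, hfac]
    have : 1 - v ≠ 0 := by linarith
    field_simp; norm_num

theorem hp_cov (φ : ℝ → ℝ) :
    ∫ x in {x : ℝ | 1 < |x|}, φ x * nuDensity x =
      ∫ v in Set.Ioi 0, φ ((1 + v ^ 3) / (1 - v ^ 3)) * hpRho v := by
  set s : Set ℝ := Set.Ioi 0 \ {1} with hs
  set F : ℝ → ℝ := fun v => (1 + v ^ 3) / (1 - v ^ 3) with hF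
  have hms : MeasurableSet s := measurableSet_Ioi.diff (measurableSet_singleton 1)
  have hne : ∀ v ∈ s, 1 - v ^ 3 ≠ 0 := by
    rintro v ⟨hv, hv1⟩
    have hv : 0 < v := hv
    have : 1 - v ^ 3 = (1 - v) * (1 + v + v ^ 2) := by ring
    rw [this]
    exact mul_ne_zero (sub_ne_zero.2 (fun h => hv1 h.symm)) (by positivity)
  have hinj : Set.InjOn F s := by
    intro x hx y hy hxy
    have h1 := hne x hx
    have h2 := hne y hy
    have hx0 : 0 < x := hx.1
    have hy0 : 0 < y := hy.1
    simp only [hF] at hxy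
    rw [div_eq_div_iff h1 h2] at hxy
    have : x ^ 3 = y ^ 3 := by linarith
    exact (pow_left_inj₀ hx0.le hy0.le (by norm_num)).1 this
  have himg : F '' s = {x : ℝ | 1 < |x|} := by
    ext x
    constructor
    · rintro ⟨v, hv, rfl⟩
      have h1 := hne v hv
      have hv0 : 0 < v := hv.1
      simp only [Set.mem_ofPred_eq, hF]
      rw [abs_div, abs_of_pos (show 0 < 1 + v ^ 3 by positivity), lt_div_iff₀ (abs_pos.2 h1), one_mul,
        abs_lt]
      have : 0 < v ^ 3 := by positivity
      constructor <;> linarith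
    · intro hx
      have hx : 1 < |x| := hx
      have hx1 : x + 1 ≠ 0 := by
        intro h
        have : x = -1 := by linarith
        rw [this] at hx; norm_num at hx
      have hpos : 0 < (x - 1) / (x + 1) := by
        rcases lt_abs.1 hx with h | h
        · exact div_pos (by linarith) (by linarith)
        · exact div_pos_of_neg_of_neg (by linarith) (by linarith)
      have hcube : (((x - 1) / (x + 1)) ^ ((1 : ℝ) / 3)) ^ 3 = (x - 1) / (x + 1) := by
        rw [← Real.rpow_natCast, ← Real.rpow_mul hpos.le]; norm_num
      refine ⟨((x - 1) / (x + 1)) ^ ((1 : ℝ) / 3), ⟨Real.rpow_pos_of_pos hpos _, ?_⟩, ?_⟩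
      · intro h
        rw [Set.mem_singleton_iff.1 h] at hcube
        rw [eq_div_iff hx1] at hcube
        linarith
      · simp only [hF]
        rw [hcube]
        have e1 : 1 - (x - 1) / (x + 1) = 2 / (x + 1) := by field_simp; ring
        have e2 : 1 + (x - 1) / (x + 1) = 2 * x / (x + 1) := by field_simp; ring
        rw [e1, e2]; field_simp
  have hder : ∀ v ∈ s, HasDerivWithinAt F (6 * v ^ 2 / (1 - v ^ 3) ^ 2) s v := by
    intro v hv
    have h1 := (((hasDerivAt_id v).pow 3).const_add 1).div (((hasDerivAt_id v).pow 3).const_sub 1)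
      (hne v hv)
    refine HasDerivAt.hasDerivWithinAt (h1.congr_deriv ?_)
    simp
    congr 1
    ring
  rw [← himg, integral_image_eq_integral_abs_deriv_smul hms hder hinj]
  have hae : s =ᵐ[volume] Set.Ioi (0 : ℝ) := sdiff_null_ae_eq_self (by simp)
  rw [← setIntegral_congr_set hae]
  apply setIntegral_congr_fun hms
  intro v hv
  have hv0 : 0 < v := hv.1
  have := hp_jac v hv0 (fun h => hv.2 h)
  simp only [smul_eq_mul, hF]
  rw [← this]
  ring

noncomputable def hpTest (φ : ℝ → ℝ) (hφ : Continuous φ) (hs : HasCompactSupport φ) :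
    C(Set.Icc (0 : ℝ) 1, ℝ) :=
  ⟨fun u => (fun t : ℝ => if t = 0 then 0 else φ (1 / t)) (2 * (u : ℝ) - 1),
    (hp_test φ hφ hs).comp (by fun_prop)⟩

theorem hpTest_apply (φ : ℝ → ℝ) (hφ : Continuous φ) (hs : HasCompactSupport φ) (w : ℝ)
    (hw : 0 < w) : hpTest φ hφ hs (hpI (1 / (1 + w))) =
      if w = 1 then 0 else φ ((1 + w) / (1 - w)) := by
  simp only [hpTest, ContinuousMap.coe_mk, hpI_val w hw.le]
  have e : 2 * (1 / (1 + w)) - 1 = (1 - w) / (1 + w) := by field_simp; ring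
  rw [e, one_div_div]
  by_cases h : w = 1
  · simp [h]
  · have : (1 - w) / (1 + w) ≠ 0 := div_ne_zero (sub_ne_zero.2 (fun h' => h h'.symm)) (by positivity)
    rw [if_neg this, if_neg h]

theorem hp_lam_test (φ : ℝ → ℝ) (hφ : Continuous φ) (hs : HasCompactSupport φ) :
    hpLam (hpTest φ hφ hs) = ∫ x in {x : ℝ | 1 < |x|}, φ x * nuDensity x := by
  rw [hp_cov]
  unfold hpLam
  apply setIntegral_congr_ae measurableSet_Ioi
  have : ∀ᵐ v : ℝ, v ≠ 1 := by
    have := compl_mem_ae_iff.2 (show volume ({1} : Set ℝ) = 0 by simp)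
    filter_upwards [this] with v hv using hv
  filter_upwards [this] with v hv1 hv
  have hv : 0 < v := hv
  rw [hpTest_apply φ hφ hs _ (by positivity), if_neg]
  intro h
  apply hv1
  exact (pow_eq_one_iff_of_nonneg hv.le (by norm_num)).1 h


/-! ### Polynomials small at the origin, moments -/

theorem hp_small_dvd (p : ℝ[X]) (M : ℕ)
    (h : (fun s : ℝ => p.eval s) =O[𝓝[>] 0] fun s => s ^ M) : X ^ M ∣ p := by
  induction M with
  | zero => simp
  | succ M ih =>
    have h1 : (fun s : ℝ => p.eval s) =O[𝓝[>] 0] fun s => s ^ M := by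
      refine h.trans ?_
      have h0 : (fun s : ℝ => s ^ (M + 1)) =O[𝓝 0] fun s : ℝ => s ^ M :=
        (isLittleO_pow_pow (Nat.lt_succ_self M)).isBigO
      exact h0.mono nhdsWithin_le_nhds
    obtain ⟨r, rfl⟩ := ih h1
    have h2 : (fun s : ℝ => r.eval s) =O[𝓝[>] 0] fun s => s := by
      rw [isBigO_iff] at h ⊢
      obtain ⟨c, hc⟩ := h
      refine ⟨c, ?_⟩
      filter_upwards [hc, self_mem_nhdsWithin] with s hs hs0
      have hs0 : 0 < s := hs0
      simp only [eval_mul, eval_pow, eval_X, norm_mul, norm_pow, pow_succ] at hs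
      have hp : 0 < ‖s‖ ^ M := pow_pos (norm_pos_iff.2 hs0.ne') _
      have : ‖s‖ ^ M * ‖eval s r‖ ≤ ‖s‖ ^ M * (c * ‖s‖) := by linarith
      exact le_of_mul_le_mul_left this hp
    have h3 : Tendsto (fun s : ℝ => r.eval s) (𝓝[>] 0) (𝓝 0) :=
      h2.trans_tendsto (tendsto_id.mono_left nhdsWithin_le_nhds)
    have h4 : Tendsto (fun s : ℝ => r.eval s) (𝓝[>] 0) (𝓝 (r.eval 0)) :=
      (r.continuous.tendsto 0).mono_left nhdsWithin_le_nhds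
    have h5 : r.eval 0 = 0 := tendsto_nhds_unique h4 h3
    have h6 : X ∣ r := by
      rw [X_dvd_iff, coeff_zero_eq_eval_zero, h5]
    rw [pow_succ]
    exact mul_dvd_mul_left _ h6

theorem hp_moments_zero {ι : Type*} (I : Finset ι) (a l : ι → ℝ) (M : ℕ)
    (h : (fun s : ℝ => ∑ i ∈ I, a i * Real.exp (-(s * l i))) =O[𝓝[>] 0] fun s => s ^ M)
    (m : ℕ) (hm : m < M) : ∑ i ∈ I, a i * l i ^ m = 0 := by
  set p : ℝ[X] := ∑ r ∈ Finset.range M,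
    C ((∑ i ∈ I, a i * (-l i) ^ r) / (r.factorial : ℝ)) * X ^ r with hp
  have hpe : ∀ s, p.eval s = ∑ i ∈ I, a i * ∑ r ∈ Finset.range M,
      (-(s * l i)) ^ r / (r.factorial : ℝ) := by
    intro s
    simp only [hp, eval_finsetSum, eval_mul, eval_C, eval_pow, eval_X, Finset.mul_sum]
    rw [Finset.sum_comm]
    refine Finset.sum_congr rfl fun r _ => ?_
    rw [Finset.sum_div, Finset.sum_mul]
    refine Finset.sum_congr rfl fun i _ => ?_
    rw [← mul_neg, mul_pow]; ring
  have hO : (fun s : ℝ => p.eval s) =O[𝓝[>] 0] fun s => s ^ M := by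
    have h2 : (fun s : ℝ => ∑ i ∈ I, a i * (Real.exp (-(s * l i)) -
        ∑ r ∈ Finset.range M, (-(s * l i)) ^ r / (r.factorial : ℝ))) =O[𝓝[>] 0]
          fun s => s ^ M := by
      refine IsBigO.fun_sum fun i _ => ?_
      refine IsBigO.const_mul_left ?_ _
      have ht : Tendsto (fun s : ℝ => -(s * l i)) (𝓝[>] 0) (𝓝 0) := by
        have : Continuous (fun s : ℝ => -(s * l i)) := by fun_prop
        have h := this.tendsto 0
        simp only [zero_mul, neg_zero] at h
        exact h.mono_left nhdsWithin_le_nhds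
      refine ((Real.exp_sub_sum_range_isBigO_pow M).comp_tendsto ht).trans ?_
      refine IsBigO.of_bound (|l i| ^ M) (Eventually.of_forall fun s => ?_)
      simp [abs_mul, mul_pow, mul_comm]
    have h3 := h.sub h2
    refine h3.congr_left fun s => ?_
    rw [hpe, ← Finset.sum_sub_distrib]
    refine Finset.sum_congr rfl fun i _ => ?_
    ring
  have h7 := X_pow_dvd_iff.1 (hp_small_dvd p M hO) m hm
  rw [hp, finsetSum_coeff] at h7
  simp only [coeff_C_mul, coeff_X_pow] at h7
  rw [Finset.sum_eq_single m] at h7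
  · have hf : (m.factorial : ℝ) ≠ 0 := by positivity
    simp only [if_true, mul_one, div_eq_zero_iff, hf, or_false] at h7
    have : ∑ i ∈ I, a i * (-l i) ^ m = (-1) ^ m * ∑ i ∈ I, a i * l i ^ m := by
      rw [Finset.mul_sum]
      refine Finset.sum_congr rfl fun i _ => ?_
      rw [neg_pow]; ring
    rw [this] at h7
    rcases mul_eq_zero.1 h7 with h8 | h8
    · exact absurd h8 (by simp)
    · exact h8
  · intro b _ hb; rw [if_neg (Ne.symm hb), mul_zero]
  · intro hh; exact absurd (Finset.mem_range.2 hm) hh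

theorem hp_moments_poly {ι : Type*} (I : Finset ι) (a l : ι → ℝ) (M : ℕ)
    (h : ∀ m < M, ∑ i ∈ I, a i * l i ^ m = 0) (q : ℝ[X]) (hq : q.natDegree < M) :
    ∑ i ∈ I, a i * q.eval (l i) = 0 := by
  simp_rw [eval_eq_sum_range, Finset.mul_sum]
  rw [Finset.sum_comm]
  refine Finset.sum_eq_zero fun m hm => ?_
  have := h m (by have := Finset.mem_range.1 hm; omega)
  calc _ = q.coeff m * ∑ i ∈ I, a i * l i ^ m := by
        rw [Finset.mul_sum]; refine Finset.sum_congr rfl fun i _ => ?_; ring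
    _ = 0 := by rw [this, mul_zero]

theorem hp_two {ι : Type*} [DecidableEq ι] (I : Finset ι) (a l : ι → ℝ)
    (h : ∀ m < I.card - 1, ∑ i ∈ I, a i * l i ^ m = 0) (i j : ι) (hi : i ∈ I) (hj : j ∈ I)
    (hij : i ≠ j) :
    a i * ∏ r ∈ (I.erase i).erase j, (l i - l r) +
      a j * ∏ r ∈ (I.erase i).erase j, (l j - l r) = 0 := by
  set q : ℝ[X] := ∏ r ∈ (I.erase i).erase j, (X - C (l r)) with hq
  have hji : j ∈ I.erase i := Finset.mem_erase.2 ⟨hij.symm, hj⟩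
  have hc : ((I.erase i).erase j).card = I.card - 2 := by
    rw [Finset.card_erase_of_mem hji, Finset.card_erase_of_mem hi]; omega
  have hcI : 2 ≤ I.card := by
    have := Finset.card_pos.2 ⟨j, hji⟩
    rw [Finset.card_erase_of_mem hi] at this; omega
  have hqd : q.natDegree < I.card - 1 := by
    rw [hq, natDegree_prod_of_monic _ _ (fun r _ => monic_X_sub_C _)]
    simp only [natDegree_X_sub_C, Finset.sum_const, smul_eq_mul, mul_one, hc]
    omega
  have hqe : ∀ x, q.eval x = ∏ r ∈ (I.erase i).erase j, (x - l r) := by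
    intro x; simp [hq, eval_prod]
  have h0 := hp_moments_poly I a l _ h q hqd
  rw [← Finset.add_sum_erase _ _ hi, ← Finset.add_sum_erase _ _ hji, Finset.sum_eq_zero, add_zero,
    hqe, hqe] at h0
  · exact h0
  · intro r hr
    rw [hqe, Finset.prod_eq_zero hr (sub_self _), mul_zero]

/-! ### telescoping products -/

theorem hp_shift (n : ℕ) (x : ℝ) :
    (x - n) * ∏ j ∈ Finset.range (n + 1), (x + 1 - (j : ℝ)) =
      (x + 1) * ∏ j ∈ Finset.range (n + 1), (x - (j : ℝ)) := by
  rw [Finset.prod_range_succ', Finset.prod_range_succ (fun j : ℕ => x - (j : ℝ))]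
  have : ∏ k ∈ Finset.range n, (x + 1 - ((k + 1 : ℕ) : ℝ)) = ∏ k ∈ Finset.range n, (x - (k : ℝ)) := by
    refine Finset.prod_congr rfl fun k _ => ?_
    push_cast; ring
  rw [this]; push_cast; ring

theorem hp_shift_erase (n j : ℕ) (hj : j < n) :
    ((n : ℝ) - j) * ∏ r ∈ ((Finset.range (n + 1)).erase j).erase (j + 1), ((j : ℝ) + 1 - (r : ℝ)) =
      ((j : ℝ) + 1) * ∏ r ∈ ((Finset.range (n + 1)).erase j).erase (j + 1), ((j : ℝ) - (r : ℝ)) := by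
  set S := ((Finset.range (n + 1)).erase j).erase (j + 1) with hS
  have h1 : j ∈ Finset.range (n + 1) := by simp; omega
  have h2 : j + 1 ∈ (Finset.range (n + 1)).erase j := by simp; omega
  have hG : ∀ x : ℝ, ∏ r ∈ Finset.range (n + 1), (x - (r : ℝ)) =
      (x - j) * ((x - (j + 1)) * ∏ r ∈ S, (x - (r : ℝ))) := by
    intro x
    rw [← Finset.mul_prod_erase _ _ h1, ← Finset.mul_prod_erase _ _ h2]
    push_cast; rfl
  have hx : ∀ x : ℝ, x ≠ j → (x - n) * ((x + 1 - j) * ∏ r ∈ S, (x + 1 - (r : ℝ))) =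
      (x + 1) * ((x - (j + 1)) * ∏ r ∈ S, (x - (r : ℝ))) := by
    intro x hxj
    have h := hp_shift n x
    rw [hG, hG] at h
    have h3 : x - j ≠ 0 := sub_ne_zero.2 hxj
    apply mul_left_cancel₀ h3
    linear_combination h
  have hl : Continuous fun x : ℝ => (x - n) * ((x + 1 - j) * ∏ r ∈ S, (x + 1 - (r : ℝ))) := by
    fun_prop
  have hr : Continuous fun x : ℝ => (x + 1) * ((x - (j + 1)) * ∏ r ∈ S, (x - (r : ℝ))) := by
    fun_prop
  have heq := Continuous.ext_on (dense_compl_singleton (j : ℝ)) hl hr (fun x hxx => hx x hxx)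
  have := congrFun heq (j : ℝ)
  linear_combination -this

/-- index set -/
def hpIdx (n : ℕ) : Finset (Fin 3 × ℕ) := Finset.univ ×ˢ Finset.range (n + 1)

/-- exponents -/
def hpExp (α : ℝ) (i : Fin 3 × ℕ) : ℝ := (i.2 : ℝ) + ((i.1 : ℕ) : ℝ) * α

theorem hpIdx_card (n : ℕ) : (hpIdx n).card = 3 * (n + 1) := by
  simp [hpIdx]

theorem hp_fin_abs (α : ℝ) (hα2 : |α| < 1 / 2) (k k' : Fin 3) :
    |(((k : ℕ) : ℝ) - ((k' : ℕ) : ℝ)) * α| < 1 := by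
  rw [abs_mul]
  have : |((k : ℕ) : ℝ) - ((k' : ℕ) : ℝ)| ≤ 2 := by
    fin_cases k <;> fin_cases k' <;> norm_num
  nlinarith [abs_nonneg α]

theorem hpExp_inj (α : ℝ) (hα0 : 0 < |α|) (hα2 : |α| < 1 / 2) (i j : Fin 3 × ℕ)
    (h : hpExp α i = hpExp α j) : i = j := by
  obtain ⟨k, u⟩ := i
  obtain ⟨k', v⟩ := j
  simp only [hpExp] at h
  have h1 := hp_fin_abs α hα2 k k'
  have h2 : (((k : ℕ) : ℝ) - ((k' : ℕ) : ℝ)) * α = (v : ℝ) - u := by linarith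
  rw [h2] at h1
  have h3 : |((v : ℤ) - (u : ℤ))| < 1 := by exact_mod_cast h1
  have h4 : (v : ℤ) - u = 0 := Int.abs_lt_one_iff.1 h3
  have h5 : u = v := by omega
  subst h5
  rw [sub_self] at h2
  have h6 : α ≠ 0 := abs_pos.1 hα0
  have h7 := (mul_eq_zero.1 h2).resolve_right h6
  have h8 : ((k : ℕ) : ℝ) = ((k' : ℕ) : ℝ) := by linarith
  have h9 : k = k' := by
    apply Fin.ext; exact_mod_cast h8
  rw [h9]

theorem hp_all_ne (α : ℝ) (hα0 : 0 < |α|) (hα2 : |α| < 1 / 2) (n : ℕ) (a : Fin 3 × ℕ → ℝ)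
    (h : ∀ m < 3 * n + 2, ∑ i ∈ hpIdx n, a i * hpExp α i ^ m = 0)
    (hne : ∃ i ∈ hpIdx n, a i ≠ 0) : ∀ i ∈ hpIdx n, a i ≠ 0 := by
  intro j hj hj0
  obtain ⟨i, hi, hi0⟩ := hne
  have hij : i ≠ j := by rintro rfl; exact hi0 hj0
  have h2 := hp_two (hpIdx n) a (hpExp α) (by
    intro m hm; rw [hpIdx_card] at hm; exact h m (by omega)) i j hi hj hij
  rw [hj0, zero_mul, add_zero] at h2
  rcases mul_eq_zero.1 h2 with h3 | h3
  · exact hi0 h3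
  · rw [Finset.prod_eq_zero_iff] at h3
    obtain ⟨r, hr, hr0⟩ := h3
    have := hpExp_inj α hα0 hα2 i r (by linarith)
    subst this
    simp at hr

theorem hp_rec_gen (α : ℝ) (hα0 : 0 < |α|) (hα2 : |α| < 1 / 2) (n : ℕ) (a : Fin 3 × ℕ → ℝ)
    (h : ∀ m < 3 * n + 2, ∑ i ∈ hpIdx n, a i * hpExp α i ^ m = 0)
    (k k₁ k₂ : Fin 3) (h1 : k ≠ k₁) (h2 : k ≠ k₂) (h12 : k₁ ≠ k₂) (j : ℕ) (hj : j < n) :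
    a (k, j) * (((n : ℝ) - j) * (n - j - (((k : ℕ) : ℝ) - ((k₁ : ℕ) : ℝ)) * α) *
      (n - j - (((k : ℕ) : ℝ) - ((k₂ : ℕ) : ℝ)) * α)) =
    - (a (k, j + 1) * (((j : ℝ) + 1) * (j + 1 + (((k : ℕ) : ℝ) - ((k₁ : ℕ) : ℝ)) * α) *
      (j + 1 + (((k : ℕ) : ℝ) - ((k₂ : ℕ) : ℝ)) * α))) := by
  have hI1 : (k, j) ∈ hpIdx n := by simp [hpIdx]; omega
  have hI2 : (k, j + 1) ∈ hpIdx n := by simp [hpIdx]; omega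
  have h3 := hp_two (hpIdx n) a (hpExp α) (by
    intro m hm; rw [hpIdx_card] at hm; exact h m (by omega)) (k, j) (k, j + 1) hI1 hI2 (by simp)
  set S := ((Finset.range (n + 1)).erase j).erase (j + 1) with hS
  have hset : ((hpIdx n).erase (k, j)).erase (k, j + 1) =
      (S.image (fun r => (k, r))) ∪ (((Finset.range (n + 1)).image (fun r => (k₁, r))) ∪
        ((Finset.range (n + 1)).image (fun r => (k₂, r)))) := by
    ext ⟨q, r⟩
    have hq : q = k ∨ q = k₁ ∨ q = k₂ := by
      clear hI1 hI2 h3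
      revert h1 h2 h12
      revert q k k₁ k₂
      decide
    simp only [hpIdx, hS, Finset.mem_erase, Finset.mem_product, Finset.mem_univ, true_and,
      Finset.mem_union, Finset.mem_image, Prod.mk.injEq, ne_eq]
    rcases hq with rfl | rfl | rfl
    · simp [h1.symm, h2.symm]
    · simp [h1, h1.symm, h12.symm]
    · simp [h2, h2.symm, h12]
  have hprod : ∀ g : Fin 3 × ℕ → ℝ, ∏ r ∈ ((hpIdx n).erase (k, j)).erase (k, j + 1), g r =
      (∏ r ∈ S, g (k, r)) * ((∏ r ∈ Finset.range (n + 1), g (k₁, r)) *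
        ∏ r ∈ Finset.range (n + 1), g (k₂, r)) := by
    intro g
    rw [hset, Finset.prod_union, Finset.prod_union, Finset.prod_image, Finset.prod_image,
      Finset.prod_image]
    · simp
    · simp
    · simp
    · rw [Finset.disjoint_left]
      rintro ⟨q, r⟩ hq hq'
      simp only [Finset.mem_image, Prod.mk.injEq] at hq hq'
      obtain ⟨_, _, e1, _⟩ := hq
      obtain ⟨_, _, e2, _⟩ := hq'
      exact h12 (e1.trans e2.symm)
    · rw [Finset.disjoint_left]
      rintro ⟨q, r⟩ hq hq'
      simp only [Finset.mem_union, Finset.mem_image, Prod.mk.injEq] at hq hq'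
      obtain ⟨_, _, e1, _⟩ := hq
      rcases hq' with ⟨_, _, e2, _⟩ | ⟨_, _, e2, _⟩
      · exact h1 (e1.trans e2.symm)
      · exact h2 (e1.trans e2.symm)
  rw [hprod, hprod] at h3
  set b₁ := (((k : ℕ) : ℝ) - ((k₁ : ℕ) : ℝ)) * α with hb₁
  set b₂ := (((k : ℕ) : ℝ) - ((k₂ : ℕ) : ℝ)) * α with hb₂
  have e1 : ∀ u r : ℕ, hpExp α (k, u) - hpExp α (k, r) = (u : ℝ) - r := by
    intro u r; simp only [hpExp]; ring
  have e2 : ∀ u r : ℕ, hpExp α (k, u) - hpExp α (k₁, r) = (b₁ + u) - r := by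
    intro u r; simp only [hpExp, hb₁]; ring
  have e3 : ∀ u r : ℕ, hpExp α (k, u) - hpExp α (k₂, r) = (b₂ + u) - r := by
    intro u r; simp only [hpExp, hb₂]; ring
  simp only [e1, e2, e3] at h3
  push_cast at h3
  have t0 := hp_shift_erase n j hj
  have t1 := hp_shift n (b₁ + j)
  have t2 := hp_shift n (b₂ + j)
  simp only [← add_assoc] at h3
  have ne1 : ∏ r ∈ Finset.range (n + 1), (b₁ + (j : ℝ) - (r : ℝ)) ≠ 0 := by
    rw [Finset.prod_ne_zero_iff]
    intro r _ h0
    have := hpExp_inj α hα0 hα2 (k, j) (k₁, r) (by have := e2 j r; linarith)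
    exact h1 (congrArg Prod.fst this)
  have ne2 : ∏ r ∈ Finset.range (n + 1), (b₂ + (j : ℝ) - (r : ℝ)) ≠ 0 := by
    rw [Finset.prod_ne_zero_iff]
    intro r _ h0
    have := hpExp_inj α hα0 hα2 (k, j) (k₂, r) (by have := e3 j r; linarith)
    exact h2 (congrArg Prod.fst this)
  have ne0 : ∏ r ∈ S, ((j : ℝ) - (r : ℝ)) ≠ 0 := by
    rw [Finset.prod_ne_zero_iff]
    intro r hr h0
    have : (j : ℝ) = r := by linarith
    have : j = r := by exact_mod_cast this
    subst this
    simp [hS] at hr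
  rw [← hS] at t0
  generalize (∏ r ∈ S, ((j : ℝ) - (r : ℝ))) = A at *
  generalize (∏ r ∈ S, ((j : ℝ) + 1 - (r : ℝ))) = A' at *
  generalize (∏ r ∈ Finset.range (n + 1), (b₁ + (j : ℝ) - (r : ℝ))) = D at *
  generalize (∏ r ∈ Finset.range (n + 1), (b₁ + (j : ℝ) + 1 - (r : ℝ))) = D' at *
  generalize (∏ r ∈ Finset.range (n + 1), (b₂ + (j : ℝ) - (r : ℝ))) = F at *
  generalize (∏ r ∈ Finset.range (n + 1), (b₂ + (j : ℝ) + 1 - (r : ℝ))) = F' at *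
  have hne : A * (D * F) ≠ 0 := mul_ne_zero ne0 (mul_ne_zero ne1 ne2)
  apply mul_right_cancel₀ hne
  have hB : ((n : ℝ) - j) * A' * (((b₁ + j - n) * D') * ((b₂ + j - n) * F')) =
      ((j : ℝ) + 1) * A * (((b₁ + j + 1) * D) * ((b₂ + j + 1) * F)) := by
    rw [t0, t1, t2]
  linear_combination (((n : ℝ) - j) * (b₁ + j - n) * (b₂ + j - n)) * h3 - a (k, j + 1) * hB


/-! ### the function on the real half line -/

noncomputable def hpZ (s : ℝ) : ℝ := (1 + Real.exp (-s)) / (1 - Real.exp (-s))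

theorem hpZ_pos_den (s : ℝ) (hs : 0 < s) : 0 < 1 - Real.exp (-s) := by
  have : Real.exp (-s) < 1 := by
    rw [← Real.exp_zero]; exact Real.exp_lt_exp.2 (by linarith)
  linarith

theorem hpZ_gt (s : ℝ) (hs : 0 < s) : 1 < hpZ s := by
  have h := hpZ_pos_den s hs
  rw [hpZ, lt_div_iff₀ h]
  linarith [Real.exp_pos (-s)]

theorem hpZ_deriv (s : ℝ) (hs : 0 < s) : HasDerivAt hpZ (-((hpZ s) ^ 2 - 1) / 2) s := by
  have h := hpZ_pos_den s hs
  have he : HasDerivAt (fun t : ℝ => Real.exp (-t)) (-Real.exp (-s)) s := by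
    have := (hasDerivAt_neg s).exp
    simpa using this
  have h1 := (he.const_add 1).div (he.const_sub 1) h.ne'
  refine h1.congr_deriv ?_
  rw [hpZ]
  field_simp
  ring

theorem hpZ_inv_le (s : ℝ) (hs : 0 < s) : (hpZ s)⁻¹ ≤ s := by
  have h := hpZ_pos_den s hs
  rw [hpZ, inv_div, div_le_iff₀ (by positivity)]
  have := Real.add_one_le_exp (-s)
  nlinarith [Real.exp_pos (-s)]

theorem hpZ_tendsto : Tendsto hpZ (𝓝[>] 0) atTop := by
  have h1 : Tendsto (fun s : ℝ => s⁻¹) (𝓝[>] 0) atTop := tendsto_inv_nhdsGT_zero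
  refine tendsto_atTop_mono' _ ?_ h1
  filter_upwards [self_mem_nhdsWithin] with s hs
  have hs : 0 < s := hs
  have h2 := hpZ_inv_le s hs
  have h3 := hpZ_gt s hs
  exact (inv_le_comm₀ (by linarith) hs).1 h2

theorem hpZ_tendstoC : Tendsto (fun s => ((hpZ s : ℝ) : ℂ)) (𝓝[>] 0) (cobounded ℂ) := by
  rw [← tendsto_norm_atTop_iff_cobounded]
  refine hpZ_tendsto.congr' ?_
  filter_upwards [self_mem_nhdsWithin] with s hs
  have h3 := hpZ_gt s hs
  rw [Complex.norm_real, Real.norm_of_nonneg (by linarith)]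

theorem hp_f_real (α : ℝ) (f : ℂ → ℂ)
    (hf_dom : DifferentiableOn ℂ f {z : ℂ | ¬(z.im = 0 ∧ |z.re| ≤ 1)})
    (hf_pearson : ∀ z ∈ {z : ℂ | ¬(z.im = 0 ∧ |z.re| ≤ 1)},
      (z ^ 2 - 1) * deriv f z = 2 * (α : ℂ) * f z)
    (hf_inf : Tendsto f (cobounded ℂ) (𝓝 1)) (s : ℝ) (hs : 0 < s) :
    f (hpZ s) = (Real.exp (-(s * α)) : ℝ) := by
  have hopen : IsOpen {z : ℂ | ¬(z.im = 0 ∧ |z.re| ≤ 1)} := by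
    have : IsClosed {z : ℂ | z.im = 0 ∧ |z.re| ≤ 1} := by
      apply IsClosed.and
      · exact isClosed_eq Complex.continuous_im continuous_const
      · exact isClosed_le (Complex.continuous_re.abs) continuous_const
    exact this.isOpen_compl
  have hmem : ∀ t : ℝ, 0 < t → ((hpZ t : ℝ) : ℂ) ∈ {z : ℂ | ¬(z.im = 0 ∧ |z.re| ≤ 1)} := by
    rintro t ht ⟨-, h⟩
    rw [Complex.ofReal_re, abs_of_pos (by linarith [hpZ_gt t ht])] at h
    linarith [hpZ_gt t ht]
  set g : ℝ → ℂ := fun t => f (hpZ t) * ((Real.exp (t * α) : ℝ) : ℂ) with hg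
  have hder : ∀ t : ℝ, 0 < t → HasDerivAt g 0 t := by
    intro t ht
    have h1 : HasDerivAt f (deriv f (hpZ t)) (hpZ t) :=
      ((hf_dom _ (hmem t ht)).differentiableAt (hopen.mem_nhds (hmem t ht))).hasDerivAt
    have h2 := (hpZ_deriv t ht).ofReal_comp
    have h3 : HasDerivAt (fun t : ℝ => f (hpZ t)) _ t := h1.comp t h2
    have h4 : HasDerivAt (fun t : ℝ => Real.exp (t * α)) (Real.exp (t * α) * α) t := by
      simpa using ((hasDerivAt_id t).mul_const α).exp
    have h5 := h3.mul h4.ofReal_comp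
    refine h5.congr_deriv ?_
    have h6 := hf_pearson _ (hmem t ht)
    push_cast
    linear_combination (-(1 / 2 : ℂ) * Complex.exp (t * α)) * h6
  have hconst : ∀ t : ℝ, 0 < t → g t = g s := by
    intro t ht
    exact isOpen_Ioi.is_const_of_deriv_eq_zero (s := Set.Ioi (0 : ℝ)) isPreconnected_Ioi
      (fun x hx => (hder x hx).differentiableAt.differentiableWithinAt)
      (fun x hx => (hder x hx).deriv) ht hs
  have hl1 : Tendsto g (𝓝[>] 0) (𝓝 1) := by
    have h1 := hf_inf.comp hpZ_tendstoC
    have h2 : Tendsto (fun t : ℝ => ((Real.exp (t * α) : ℝ) : ℂ)) (𝓝[>] 0) (𝓝 1) := by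
      have : Continuous (fun t : ℝ => ((Real.exp (t * α) : ℝ) : ℂ)) := by fun_prop
      have h := this.tendsto 0
      simp only [zero_mul, Real.exp_zero, Complex.ofReal_one] at h
      exact h.mono_left nhdsWithin_le_nhds
    have h3 := h1.mul h2
    rw [mul_one] at h3
    exact h3
  have hl2 : Tendsto g (𝓝[>] 0) (𝓝 (g s)) := by
    refine tendsto_const_nhds.congr' ?_
    filter_upwards [self_mem_nhdsWithin] with t ht
    exact (hconst t ht).symm
  have hgs : g s = 1 := tendsto_nhds_unique hl2 hl1
  have hne : ((Real.exp (s * α) : ℝ) : ℂ) ≠ 0 := by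
    exact_mod_cast (Real.exp_pos _).ne'
  rw [Real.exp_neg, Complex.ofReal_inv]
  exact eq_inv_of_mul_eq_one_left hgs

/-! ### the Moebius transform of polynomials -/

noncomputable def hpTr (n : ℕ) (Q : ℝ[X]) : ℝ[X] :=
  ∑ i ∈ Finset.range (n + 1), C (Q.coeff i) * ((1 + X) ^ i * (1 - X) ^ (n - i))

theorem hpTr_natDegree (n : ℕ) (Q : ℝ[X]) : (hpTr n Q).natDegree ≤ n := by
  refine natDegree_sum_le_of_forall_le _ _ fun i hi => ?_
  have hi := Finset.mem_range.1 hi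
  refine (natDegree_C_mul_le _ _).trans ?_
  refine natDegree_mul_le.trans ?_
  have h1 : ((1 + X : ℝ[X]) ^ i).natDegree ≤ i := by
    refine natDegree_pow_le.trans ?_
    have : (1 + X : ℝ[X]).natDegree ≤ 1 := by compute_degree
    nlinarith
  have h2 : ((1 - X : ℝ[X]) ^ (n - i)).natDegree ≤ n - i := by
    refine natDegree_pow_le.trans ?_
    have : (1 - X : ℝ[X]).natDegree ≤ 1 := by compute_degree
    nlinarith
  omega

theorem hpTr_eval (n : ℕ) (Q : ℝ[X]) (hQ : Q.natDegree ≤ n) (e : ℝ) (he : 1 - e ≠ 0) :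
    (hpTr n Q).eval e = (1 - e) ^ n * Q.eval ((1 + e) / (1 - e)) := by
  rw [eval_eq_sum_range' (Nat.lt_succ_of_le hQ), Finset.mul_sum, hpTr, eval_finsetSum]
  refine Finset.sum_congr rfl fun i hi => ?_
  have hi := Finset.mem_range.1 hi
  have : n = (n - i) + i := by omega
  simp only [eval_mul, eval_C, eval_pow, eval_add, eval_sub, eval_one, eval_X]
  rw [div_pow]
  conv_rhs => rw [this, pow_add]
  field_simp

theorem hpTr_eval' (n : ℕ) (Q : ℝ[X]) (hQ : Q.natDegree ≤ n) (z : ℝ) (hz : z + 1 ≠ 0) :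
    Q.eval z = ((z + 1) / 2) ^ n * (hpTr n Q).eval ((z - 1) / (z + 1)) := by
  have h1 : 1 - (z - 1) / (z + 1) = 2 / (z + 1) := by field_simp; ring
  have h2 : (1 + (z - 1) / (z + 1)) / (2 / (z + 1)) = z := by field_simp; ring
  rw [hpTr_eval n Q hQ _ (by rw [h1]; positivity), h1, h2, ← mul_assoc, ← mul_pow]
  have h3 : (z + 1) / 2 * (2 / (z + 1)) = 1 := by field_simp
  rw [h3, one_pow, one_mul]

theorem hpTr_ne (n : ℕ) (Q : ℝ[X]) (hQ : Q.natDegree ≤ n) (h0 : Q ≠ 0) : hpTr n Q ≠ 0 := by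
  intro h
  apply h0
  apply Polynomial.eq_of_infinite_eval_eq
  refine (Set.Ioi_infinite (0 : ℝ)).mono fun z hz => ?_
  have hz : 0 < z := hz
  simp only [Set.mem_ofPred_eq]
  rw [hpTr_eval' n Q hQ z (by linarith), h]
  simp

/-- the coefficients -/
noncomputable def hpCoef (n : ℕ) (Q : Fin 3 → ℝ[X]) (i : Fin 3 × ℕ) : ℝ :=
  (hpTr n (Q i.1)).coeff i.2

theorem hp_expsum (α : ℝ) (n : ℕ) (Q : Fin 3 → ℝ[X]) (hdeg : ∀ k, (Q k).natDegree ≤ n)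
    (s : ℝ) (hs : 0 < s) :
    ∑ i ∈ hpIdx n, hpCoef n Q i * Real.exp (-(s * hpExp α i)) =
      (1 - Real.exp (-s)) ^ n * ((Q 0).eval (hpZ s) + (Q 1).eval (hpZ s) * Real.exp (-(s * α)) +
        (Q 2).eval (hpZ s) * Real.exp (-(s * α)) ^ 2) := by
  have h := hpZ_pos_den s hs
  have key : ∀ k : Fin 3, ∑ j ∈ Finset.range (n + 1),
      hpCoef n Q (k, j) * Real.exp (-(s * hpExp α (k, j))) =
      (1 - Real.exp (-s)) ^ n * ((Q k).eval (hpZ s) * Real.exp (-(s * α)) ^ (k : ℕ)) := by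
    intro k
    rw [← mul_assoc, hpZ, ← hpTr_eval n (Q k) (hdeg k) _ h.ne',
      eval_eq_sum_range' (Nat.lt_succ_of_le (hpTr_natDegree n (Q k))), Finset.sum_mul]
    refine Finset.sum_congr rfl fun j _ => ?_
    rw [hpCoef, mul_assoc, ← Real.exp_nat_mul, ← Real.exp_nat_mul, ← Real.exp_add]
    congr 2
    simp only [hpExp]; ring
  rw [hpIdx, Finset.sum_product, Fin.sum_univ_three, key, key, key]
  simp
  ring

theorem hp_moment_final (α : ℝ) (f : ℂ → ℂ)
    (hf_dom : DifferentiableOn ℂ f {z : ℂ | ¬(z.im = 0 ∧ |z.re| ≤ 1)})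
    (hf_pearson : ∀ z ∈ {z : ℂ | ¬(z.im = 0 ∧ |z.re| ≤ 1)},
      (z ^ 2 - 1) * deriv f z = 2 * (α : ℂ) * f z)
    (hf_inf : Tendsto f (cobounded ℂ) (𝓝 1)) (n : ℕ)
    (Q : Fin 3 → ℝ[X]) (hdeg : ∀ k, (Q k).natDegree ≤ n)
    (hHP : (fun z : ℂ =>
        aeval z (Q 0) + aeval z (Q 1) * f z + aeval z (Q 2) * f z ^ 2)
      =O[cobounded ℂ] fun z => (z ^ (2 * n + 2))⁻¹) :
    ∀ m < 3 * n + 2, ∑ i ∈ hpIdx n, hpCoef n Q i * hpExp α i ^ m = 0 := by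
  intro m hm
  refine hp_moments_zero (hpIdx n) (hpCoef n Q) (hpExp α) (3 * n + 2) ?_ m hm
  have h1 := hHP.comp_tendsto hpZ_tendstoC
  rw [isBigO_iff'] at h1
  obtain ⟨c, hc, hb⟩ := h1
  refine IsBigO.of_bound c ?_
  filter_upwards [hb, self_mem_nhdsWithin] with s hs hs0
  have hs0 : 0 < s := hs0
  rw [hp_expsum α n Q hdeg s hs0]
  simp only [Function.comp_apply] at hs
  rw [hp_f_real α f hf_dom hf_pearson hf_inf s hs0] at hs
  have hae : ∀ k, aeval ((hpZ s : ℝ) : ℂ) (Q k) = (((Q k).eval (hpZ s) : ℝ) : ℂ) := by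
    intro k
    have := aeval_algebraMap_apply ℂ (hpZ s) (Q k)
    simpa [coe_aeval_eq_eval] using this
  rw [hae, hae, hae] at hs
  have e1 : ((((Q 0).eval (hpZ s) : ℝ) : ℂ) + (((Q 1).eval (hpZ s) : ℝ) : ℂ) *
      (Real.exp (-(s * α)) : ℝ) + (((Q 2).eval (hpZ s) : ℝ) : ℂ) * (Real.exp (-(s * α)) : ℝ) ^ 2) =
      (((Q 0).eval (hpZ s) + (Q 1).eval (hpZ s) * Real.exp (-(s * α)) +
        (Q 2).eval (hpZ s) * Real.exp (-(s * α)) ^ 2 : ℝ) : ℂ) := by push_cast; ring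
  rw [e1, Complex.norm_real, norm_inv, norm_pow, Complex.norm_real] at hs
  have hz := hpZ_gt s hs0
  have hd := hpZ_pos_den s hs0
  have hds : 1 - Real.exp (-s) ≤ s := by linarith [Real.add_one_le_exp (-s)]
  rw [norm_mul, norm_pow, norm_pow, Real.norm_of_nonneg hd.le, Real.norm_of_nonneg hs0.le]
  rw [Real.norm_of_nonneg (show 0 ≤ hpZ s by linarith), ← inv_pow] at hs
  have hzi := hpZ_inv_le s hs0
  have hzi0 : 0 ≤ (hpZ s)⁻¹ := by positivity
  calc _ ≤ s ^ n * (c * s ^ (2 * n + 2)) := by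
        gcongr
        exact hs.trans (by gcongr)
    _ = c * s ^ (3 * n + 2) := by ring

theorem hp_coef_ne (α : ℝ) (hα0 : 0 < |α|) (hα2 : |α| < 1 / 2) (n : ℕ)
    (Q : Fin 3 → ℝ[X]) (hdeg : ∀ k, (Q k).natDegree ≤ n) (hQ : ∃ k, Q k ≠ 0)
    (h : ∀ m < 3 * n + 2, ∑ i ∈ hpIdx n, hpCoef n Q i * hpExp α i ^ m = 0) :
    ∀ k : Fin 3, ∀ j ≤ n, (hpTr n (Q k)).coeff j ≠ 0 := by
  intro k j hj
  obtain ⟨k', hk'⟩ := hQ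
  have h1 := hpTr_ne n (Q k') (hdeg k') hk'
  have h2 : (hpTr n (Q k')).coeff (hpTr n (Q k')).natDegree ≠ 0 := by
    simpa using h1
  refine hp_all_ne α hα0 hα2 n (hpCoef n Q) h ⟨(k', _), ?_, h2⟩ (k, j) ?_
  · simp only [hpIdx, Finset.mem_product, Finset.mem_univ, true_and, Finset.mem_range]
    exact Nat.lt_succ_of_le (hpTr_natDegree n (Q k'))
  · simp only [hpIdx, Finset.mem_product, Finset.mem_univ, true_and, Finset.mem_range]
    omega


/-! ### roots and final assembly -/

theorem hp_lin_ne (w : ℝ) : C (w - 1) * X + C (w + 1) ≠ (0 : ℝ[X]) := by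
  intro h
  have h1 := congrArg (fun p : ℝ[X] => p.coeff 0) h
  have h2 := congrArg (fun p : ℝ[X] => p.coeff 1) h
  simp [coeff_C, -map_add, -map_sub] at h1 h2
  linarith

theorem hp_lin_roots (φ : ℝ → ℝ) (w : ℝ) :
    ((C (w - 1) * X + C (w + 1) : ℝ[X]).roots.map φ).sum =
      if w = 1 then 0 else φ ((1 + w) / (1 - w)) := by
  split_ifs with h
  · subst h
    rw [sub_self, C_0, zero_mul, zero_add, roots_C]; simp
  · have h1 : w - 1 ≠ 0 := sub_ne_zero.2 h
    have h2 : 1 - w ≠ 0 := sub_ne_zero.2 (Ne.symm h)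
    rw [roots_C_mul_X_add_C _ h1, Multiset.map_singleton, Multiset.sum_singleton]
    congr 1
    field_simp
    ring

theorem hp_prod_ne (W : Multiset ℝ) :
    (W.map (fun w => (C (w - 1) * X + C (w + 1) : ℝ[X]))).prod ≠ 0 := by
  induction W using Multiset.induction_on with
  | empty => simp
  | cons w W ih =>
    rw [Multiset.map_cons, Multiset.prod_cons]
    exact mul_ne_zero (hp_lin_ne w) ih

theorem hp_roots_sum (φ : ℝ → ℝ) (W : Multiset ℝ) :
    ((W.map (fun w => (C (w - 1) * X + C (w + 1) : ℝ[X]))).prod.roots.map φ).sum =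
      (W.map (fun w => if w = 1 then 0 else φ ((1 + w) / (1 - w)))).sum := by
  induction W using Multiset.induction_on with
  | empty => simp
  | cons w W ih =>
    rw [Multiset.map_cons, Multiset.prod_cons, roots_mul (mul_ne_zero (hp_lin_ne w) (hp_prod_ne W)),
      Multiset.map_add, Multiset.sum_add, ih, hp_lin_roots, Multiset.map_cons, Multiset.sum_cons]

theorem hp_prod_eval (W : Multiset ℝ) (z : ℝ) (hz : z + 1 ≠ 0) :
    (W.map (fun w => (C (w - 1) * X + C (w + 1) : ℝ[X]))).prod.eval z =
      (z + 1) ^ (Multiset.card W) *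
        ((W.map (fun w => (X + C w : ℝ[X]))).prod.eval (-((z - 1) / (z + 1)))) := by
  induction W using Multiset.induction_on with
  | empty => simp
  | cons w W ih =>
    rw [Multiset.map_cons, Multiset.prod_cons, eval_mul, ih, Multiset.map_cons, Multiset.prod_cons,
      eval_mul, Multiset.card_cons, pow_succ]
    simp only [eval_add, eval_mul, eval_C, eval_X]
    field_simp
    ring

theorem hp_others (k : Fin 3) : ∃ k₁ k₂ : Fin 3, k ≠ k₁ ∧ k ≠ k₂ ∧ k₁ ≠ k₂ := by
  revert k; decide

theorem hp_fixed (α : ℝ) (hα0 : 0 < |α|) (hα2 : |α| < 1 / 2) (n : ℕ)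
    (Q : Fin 3 → ℝ[X]) (hdeg : ∀ k, (Q k).natDegree ≤ n) (hQ : ∃ k, Q k ≠ 0)
    (h : ∀ m < 3 * n + 2, ∑ i ∈ hpIdx n, hpCoef n Q i * hpExp α i ^ m = 0) (k : Fin 3) :
    ∃ W : Multiset ℝ, Multiset.card W = n ∧ (∀ w ∈ W, 0 < w) ∧
      (∀ s : ℝ, 0 < s → |(1 / (n : ℝ)) * (W.map (fun w => s ^ 3 / (s ^ 3 + w))).sum - s / (1 + s)| ≤
      ((1 + s ^ 3) * 9 * (1 + s ^ 2) / s ^ 2 + 1) * (1 / (n : ℝ)) ∨ n = 0) ∧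
      ∀ φ : ℝ → ℝ, ((Q k).roots.map φ).sum =
        (W.map (fun w => if w = 1 then 0 else φ ((1 + w) / (1 - w)))).sum := by
  have hne := hp_coef_ne α hα0 hα2 n Q hdeg hQ h k
  obtain ⟨k₁, k₂, h1, h2, h12⟩ := hp_others k
  set P := hpTr n (Q k) with hP
  set c : ℕ → ℝ := fun j => (-1) ^ j * P.coeff j / P.coeff 0 with hc
  have h00 := hne 0 (Nat.zero_le _)
  have hb1 := hp_fin_abs α hα2 k k₁
  have hb2 := hp_fin_abs α hα2 k k₂
  have hrec : ∀ j < n, c (j + 1) * (((j : ℝ) + 1) * (j + 1 + (((k : ℕ) : ℝ) - ((k₁ : ℕ) : ℝ)) * α) *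
      (j + 1 + (((k : ℕ) : ℝ) - ((k₂ : ℕ) : ℝ)) * α)) =
      c j * (((n : ℝ) - j) * (n - j - (((k : ℕ) : ℝ) - ((k₁ : ℕ) : ℝ)) * α) *
      (n - j - (((k : ℕ) : ℝ) - ((k₂ : ℕ) : ℝ)) * α)) := by
    intro j hj
    have hr := hp_rec_gen α hα0 hα2 n (hpCoef n Q) h k k₁ k₂ h1 h2 h12 j hj
    simp only [hpCoef, ← hP] at hr
    simp only [hc, pow_succ]
    linear_combination (-(-1 : ℝ) ^ j / P.coeff 0) * hr
  have hc0 : c 0 = 1 := by simp [hc, h00]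
  have hgood := hp_good n _ _ hb1 hb2 c hc0 hrec
  obtain ⟨W, hWn, hW, hfac⟩ := hp_factor n c hgood
  have hcn : c n ≠ 0 := by
    simp only [hc]
    exact div_ne_zero (mul_ne_zero (by simp) (hne n le_rfl)) h00
  refine ⟨W, hWn, hW, ?_, ?_⟩
  · intro s hs
    rcases Nat.eq_zero_or_pos n with h0 | h0
    · right; exact h0
    left
    refine (hp_quant n h0 _ _ hb1 hb2 c hrec hcn W hWn hW hfac s hs).trans ?_
    have : 0 ≤ 1 / (n : ℝ) := by positivity
    nlinarith
  · intro φ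
    have hPe : ∀ x, P.eval x = P.coeff 0 * (hpPoly n c).eval (-x) := by
      intro x
      rw [eval_eq_sum_range' (Nat.lt_succ_of_le (hpTr_natDegree n (Q k))), hpPoly, eval_finsetSum,
        Finset.mul_sum]
      refine Finset.sum_congr rfl fun j _ => ?_
      simp only [eval_mul, eval_C, eval_pow, eval_X, hc]
      rw [neg_pow x]
      have h3 : ((-1 : ℝ) ^ j) * (-1) ^ j = 1 := by
        rw [← mul_pow]; simp
      field_simp
      linear_combination (-(P.coeff j) * x ^ j) * h3
    have hQe : Q k = C (P.coeff 0 * c n / 2 ^ n) *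
        (W.map (fun w => (C (w - 1) * X + C (w + 1) : ℝ[X]))).prod := by
      apply Polynomial.eq_of_infinite_eval_eq
      refine (Set.Ioi_infinite (0 : ℝ)).mono fun z hz => ?_
      have hz : 0 < z := hz
      have hz1 : z + 1 ≠ 0 := by linarith
      show _ = _
      rw [hpTr_eval' n (Q k) (hdeg k) z hz1, ← hP, hPe, hfac, eval_mul, eval_C, eval_mul, eval_C,
        hp_prod_eval W z hz1, hWn, div_pow]
      ring
    have hK : P.coeff 0 * c n / 2 ^ n ≠ 0 :=
      div_ne_zero (mul_ne_zero h00 hcn) (by positivity)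
    rw [hQe, roots_C_mul _ hK, hp_roots_sum]


/-- For real `α` with `|α| ∈ (0,1/2)`, `f` the branch of `((z−1)/(z+1))^α` on
`ℂ∖[−1,1]` with `f(∞)=1`, and `Q_{n,0}, Q_{n,1}, Q_{n,2}` type I Hermite–Padé polynomials of
order `n` for `(1,f,f²)` (real coefficients), the normalized zero counting measures of
`Q_{n,k}` converge weakly, for each `k`, to the probability measure with density `ν'`:
for every continuous compactly supported `φ : ℝ → ℝ`,
`(1/n) Σ_{x : Q_{n,k}(x)=0} φ(x) → ∫_{|x|>1} φ(x) ν'(x) dx` (zeros with multiplicity). -/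
theorem stmt_5 (α : ℝ) (hα0 : 0 < |α|) (hα2 : |α| < 1 / 2)
    (f : ℂ → ℂ)
    (hf_dom : DifferentiableOn ℂ f {z : ℂ | ¬(z.im = 0 ∧ |z.re| ≤ 1)})
    (hf_pearson : ∀ z ∈ {z : ℂ | ¬(z.im = 0 ∧ |z.re| ≤ 1)},
      (z ^ 2 - 1) * deriv f z = 2 * (α : ℂ) * f z)
    (hf_inf : Tendsto f (cobounded ℂ) (𝓝 1))
    (Q : ℕ → Fin 3 → Polynomial ℝ)
    (hQ : ∀ n, ∃ k, Q n k ≠ 0)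
    (hdeg : ∀ n k, (Q n k).natDegree ≤ n)
    (hHP : ∀ n, (fun z : ℂ =>
        aeval z (Q n 0) + aeval z (Q n 1) * f z + aeval z (Q n 2) * f z ^ 2)
      =O[cobounded ℂ] fun z => (z ^ (2 * n + 2))⁻¹) :
    ∀ (k : Fin 3) (φ : ℝ → ℝ), Continuous φ → HasCompactSupport φ →
      Tendsto (fun n : ℕ => (1 / (n : ℝ)) * (((Q n k).roots.map φ).sum))
        atTop (𝓝 (∫ x in {x : ℝ | 1 < |x|}, φ x * nuDensity x)) := by
  intro k φ hφ hs
  have hm := fun n => hp_moment_final α f hf_dom hf_pearson hf_inf n (Q n) (hdeg n) (hHP n)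
  choose W hWc hWp hWq hWr using fun n =>
    hp_fixed α hα0 hα2 n (Q n) (hdeg n) (hQ n) (hm n) k
  have hS : ∀ s : ℝ, 0 < s → Tendsto (fun n : ℕ => (1 / (n : ℝ)) *
      ((W n).map (fun w => s ^ 3 / (s ^ 3 + w))).sum) atTop (𝓝 (s / (1 + s))) := by
    intro s hs0
    rw [tendsto_iff_norm_sub_tendsto_zero]
    refine squeeze_zero' (Eventually.of_forall fun n => norm_nonneg _) ?_
      (g := fun n : ℕ => ((1 + s ^ 3) * 9 * (1 + s ^ 2) / s ^ 2 + 1) * (1 / (n : ℝ))) ?_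
    · filter_upwards [eventually_gt_atTop 0] with n hn
      exact (hWq n s hs0).resolve_right (by omega)
    · simpa using (tendsto_one_div_atTop_nhds_zero_nat (𝕜 := ℝ)).const_mul
        ((1 + s ^ 3) * 9 * (1 + s ^ 2) / s ^ 2 + 1)
  have hmain := hp_weak W hWc hWp hS (hpTest φ hφ hs)
  rw [hp_lam_test] at hmain
  refine hmain.congr fun n => ?_
  rw [hpL, hWr n φ]
  congr 2
  exact Multiset.map_congr rfl fun w hw => hpTest_apply φ hφ hs w (hWp n w hw)
end
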